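/- Assume f satisfies (f1), (f2), and (f4'): (F/f)'(s) ≥ (n−2)/2 for all s > β, let k be odd, and let α* ∈ G_k. Then there exists δ > 0 such that for all α₁ < α₂ in (α*−δ, α*+δ): if α₁ ∈ G_k ∪ N_k, then α₂ ∈ N_k, Z_k(α₁) > Z_k(α₂), and |u'(Z_k(α₁),α₁)| < |u'(Z_k(α₂),α₂)|; and if α₂ ∈ G_k, then α₁ ∈ F_k. -/

import Mathlib

open Set Filter MeasureTheory

namespace Paper

noncomputable section

/-- `F s = ∫₀ˢ f t dt`. -/
def Fint (f : ℝ → ℝ) (s : ℝ) : ℝ := ∫ t in (0:ℝ)..s, f t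

/-- Hypothesis (f1): `f` is odd, `f 0 = 0`, there are `β > b > 0` with `f > 0` on `(b,∞)`,
`f ≤ 0`, `f ≢ 0` on `[0,b]`, and `F β = 0`. -/
def Hf1 (f : ℝ → ℝ) (b β : ℝ) : Prop :=
  (∀ s, f (-s) = -f s) ∧ f 0 = 0 ∧ 0 < b ∧ b < β ∧
    (∀ s, b < s → 0 < f s) ∧ (∀ s ∈ Icc (0:ℝ) b, f s ≤ 0) ∧
    (∃ s ∈ Icc (0:ℝ) b, f s ≠ 0) ∧ Fint f β = 0

/-- Hypothesis (f2): `f` continuous on `[0,∞)`, C¹ on `(0,∞)`, `f' ∈ L¹(0,1)`. -/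
def Hf2 (f : ℝ → ℝ) : Prop :=
  ContinuousOn f (Ici 0) ∧ (∀ s : ℝ, 0 < s → DifferentiableAt ℝ f s) ∧
    ContinuousOn (deriv f) (Ioi 0) ∧ IntegrableOn (deriv f) (Ioo 0 1)

/-- Hypothesis (f3): `f s ≥ f' s * (s - β)` for `s ≥ β`. -/
def Hf3 (f : ℝ → ℝ) (β : ℝ) : Prop := ∀ s, β ≤ s → deriv f s * (s - β) ≤ f s

/-- Hypothesis (f4): `(F/f)' s ≥ (n-2)/(2n)` for `s > β`. -/
def Hf4 (n : ℕ) (f : ℝ → ℝ) (β : ℝ) : Prop :=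
  ∀ s, β < s → ((n : ℝ) - 2) / (2 * (n : ℝ)) ≤ deriv (fun t => Fint f t / f t) s

/-- Hypothesis (f4'): `(F/f)' s ≥ (n-2)/2` for `s > β`. -/
def Hf4' (n : ℕ) (f : ℝ → ℝ) (β : ℝ) : Prop :=
  ∀ s, β < s → ((n : ℝ) - 2) / 2 ≤ deriv (fun t => Fint f t / f t) s

/-- Hypothesis (f5): `s ↦ s f' s / f s` is nonincreasing on `[β,∞)`. -/
def Hf5 (f : ℝ → ℝ) (β : ℝ) : Prop := AntitoneOn (fun s => s * deriv f s / f s) (Ici β)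

/-- Hypothesis (f6): `β f' β / f β ≤ n/(n-2)`. -/
def Hf6 (n : ℕ) (f : ℝ → ℝ) (β : ℝ) : Prop := β * deriv f β / f β ≤ (n : ℝ) / ((n : ℝ) - 2)

/-- Hypothesis (f1'): `f 0 = 0` and `s f s > 0` for `s > 0`. -/
def Hf1' (f : ℝ → ℝ) : Prop := f 0 = 0 ∧ ∀ s : ℝ, 0 < s → 0 < s * f s

/-- Hypothesis (f3'): `f s ≥ s f' s` for `s > 0`, with strict inequality at points
arbitrarily close to `0`. -/
def Hf3' (f : ℝ → ℝ) : Prop :=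
  (∀ s : ℝ, 0 < s → s * deriv f s ≤ f s) ∧
    ∀ ε : ℝ, 0 < ε → ∃ s ∈ Ioo (0:ℝ) ε, s * deriv f s < f s

/-- `v` is a C² solution of (E) on `(0,∞)`, continuous on `[0,∞)`,
with `v 0 = α` and `v' 0 = 0`. -/
def IVPsol (n : ℕ) (f : ℝ → ℝ) (α : ℝ) (v : ℝ → ℝ) : Prop :=
  v 0 = α ∧ deriv v 0 = 0 ∧ ContinuousOn v (Ici 0) ∧
    (∀ r : ℝ, 0 < r → DifferentiableAt ℝ v r ∧ DifferentiableAt ℝ (deriv v) r) ∧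
    (∀ r : ℝ, 0 < r → deriv (deriv v) r + ((n : ℝ) - 1) / r * deriv v r + f (v r) = 0)

/-- The family `α ↦ u α` of solutions of the IVP, with `u α r` and `u' α r`
continuous in `(α, r)`. -/
def Family (n : ℕ) (f : ℝ → ℝ) (u : ℝ → ℝ → ℝ) : Prop :=
  (∀ α : ℝ, 0 < α → IVPsol n f α (u α)) ∧
    ContinuousOn (fun p : ℝ × ℝ => u p.1 p.2) (Ioi 0 ×ˢ Ici 0) ∧
    ContinuousOn (fun p : ℝ × ℝ => deriv (u p.1) p.2) (Ioi 0 ×ˢ Ici 0)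

/-- The set whose supremum is `Z_k α`, given `T = T_{k-1} α`. -/
def ZsetAux (u : ℝ → ℝ → ℝ) (k : ℕ) (T α : ℝ) : Set ℝ :=
  {r | T < r ∧ ∀ s ∈ Ioo T r, (-1 : ℝ) ^ k * u α s < 0 ∧ 0 < (-1 : ℝ) ^ k * deriv (u α) s}

/-- The pair `(Z_k, T_k)`, with `T₀ = 0`;
`Z_k α = sup {r > T_{k-1} α | (-1)^k u < 0, (-1)^k u' > 0 on (T_{k-1} α, r)}` and
`T_k α = inf {r > Z_k α | u'(r, α) = 0}`. -/
def ZT (u : ℝ → ℝ → ℝ) : ℕ → (ℝ → ℝ) × (ℝ → ℝ)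
  | 0 => (fun _ => 0, fun _ => 0)
  | k + 1 =>
    let Z : ℝ → ℝ := fun α => sSup (ZsetAux u (k + 1) ((ZT u k).2 α) α)
    (Z, fun α => sInf {r | Z α < r ∧ deriv (u α) r = 0})

/-- `Z_k α` (as a real number; the genuine value when the defining set is bounded above). -/
def Zk (u : ℝ → ℝ → ℝ) (k : ℕ) (α : ℝ) : ℝ := (ZT u k).1 α

/-- `T_k α`, with `T₀ = 0`. -/
def Tk (u : ℝ → ℝ → ℝ) (k : ℕ) (α : ℝ) : ℝ := (ZT u k).2 α

/-- The defining set of `Z_k α`; `Z_k α = ∞` iff this set is unbounded above. -/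
def ZsetK (u : ℝ → ℝ → ℝ) (k : ℕ) (α : ℝ) : Set ℝ := ZsetAux u k (Tk u (k - 1) α) α

open Classical in
/-- The value of `u (·, α)` at `Z_k α`, as a limit `r → ∞` when `Z_k α = ∞`. -/
def uAtZ (u : ℝ → ℝ → ℝ) (k : ℕ) (α : ℝ) : ℝ :=
  if BddAbove (ZsetK u k α) then u α (Zk u k α) else limUnder atTop (u α)

open Classical in
/-- The value of `u' (·, α)` at `Z_k α`, as a limit `r → ∞` when `Z_k α = ∞`. -/
def duAtZ (u : ℝ → ℝ → ℝ) (k : ℕ) (α : ℝ) : ℝ :=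
  if BddAbove (ZsetK u k α) then deriv (u α) (Zk u k α) else limUnder atTop (deriv (u α))

open Classical in
/-- `Z_k α` as an extended real number. -/
def ZkE (u : ℝ → ℝ → ℝ) (k : ℕ) (α : ℝ) : WithTop ℝ :=
  if BddAbove (ZsetK u k α) then (Zk u k α : WithTop ℝ) else ⊤

/-- Membership in `F̃_k` (for `α ∈ N_{k-1}`): `(-1)^k u' (r, α) < 0` for all `r > Z_{k-1} α`. -/
def Ftil (u : ℝ → ℝ → ℝ) (k : ℕ) (α : ℝ) : Prop :=
  ∀ r, Zk u (k - 1) α < r → (-1 : ℝ) ^ k * deriv (u α) r < 0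

/-- The sets `N_k` (with `N₀ := (0,∞)`). -/
def Nk (u : ℝ → ℝ → ℝ) : ℕ → Set ℝ
  | 0 => Ioi 0
  | 1 => {α | 0 < α ∧ uAtZ u 1 α = 0 ∧ duAtZ u 1 α < 0}
  | k + 2 => {α | α ∈ Nk u (k + 1) ∧ ¬Ftil u (k + 2) α ∧ uAtZ u (k + 2) α = 0 ∧
      0 < (-1 : ℝ) ^ (k + 2) * duAtZ u (k + 2) α}

/-- The sets `G_k`. -/
def Gk (u : ℝ → ℝ → ℝ) : ℕ → Set ℝ
  | 0 => ∅
  | 1 => {α | 0 < α ∧ uAtZ u 1 α = 0 ∧ duAtZ u 1 α = 0}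
  | k + 2 => {α | α ∈ Nk u (k + 1) ∧ ¬Ftil u (k + 2) α ∧ uAtZ u (k + 2) α = 0 ∧
      duAtZ u (k + 2) α = 0}

/-- The set `F̃_k` (for `k ≥ 2`). -/
def FtilSet (u : ℝ → ℝ → ℝ) (k : ℕ) : Set ℝ := {α | α ∈ Nk u (k - 1) ∧ Ftil u k α}

/-- The set `F_k` (for `k ≥ 2`). -/
def Fk (u : ℝ → ℝ → ℝ) (k : ℕ) : Set ℝ :=
  {α | α ∈ Nk u (k - 1) ∧ ¬Ftil u k α ∧ (-1 : ℝ) ^ k * uAtZ u k α < 0}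

/-- The sets `P_k`. -/
def Pk (u : ℝ → ℝ → ℝ) : ℕ → Set ℝ
  | 0 => ∅
  | 1 => {α | 0 < α ∧ 0 < uAtZ u 1 α}
  | k + 2 => FtilSet u (k + 2) ∪ Fk u (k + 2)

/-- The set of extremal points (zeros of `u' (·, α)`) in `[0, A]`. -/
def ExtSet (u : ℝ → ℝ → ℝ) (α A : ℝ) : Set ℝ := {r | r ∈ Icc 0 A ∧ deriv (u α) r = 0}

/-- The conclusion of the δ₁-lemma (Lemma 4.1): every solution with initial value in
`(α*-δ₁, α*+δ₁)` has exactly `k` extremal points in `[0, T_{k-1}(α*) + a]`, with minimum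
values `< -β` and maximum values `> β`; moreover any two such solutions intersect between
any two of their consecutive extremal points, and in `(T_{k-1}(α*), Z_k(α*))`. -/
def DeltaOneLemma (f : ℝ → ℝ) (β : ℝ) (u : ℝ → ℝ → ℝ) (k : ℕ) (αs a δ₁ : ℝ) : Prop :=
  0 < a ∧ 0 < δ₁ ∧
    (∀ α ∈ Ioo (αs - δ₁) (αs + δ₁),
      (ExtSet u α (Tk u (k - 1) αs + a)).Finite ∧
        (ExtSet u α (Tk u (k - 1) αs + a)).ncard = k ∧
        ∀ r ∈ ExtSet u α (Tk u (k - 1) αs + a),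
          (IsLocalMin (u α) r → u α r < -β) ∧ (IsLocalMax (u α) r → β < u α r)) ∧
    ∀ α₁ ∈ Ioo (αs - δ₁) (αs + δ₁), ∀ α₂ ∈ Ioo (αs - δ₁) (αs + δ₁), α₁ < α₂ →
      (∀ i : ℕ, 1 ≤ i → i ≤ k - 1 →
        ∃ t, max (Tk u (i - 1) α₁) (Tk u (i - 1) α₂) < t ∧
          t < min (Tk u i α₁) (Tk u i α₂) ∧ u α₁ t = u α₂ t) ∧
      ∃ t, Tk u (k - 1) αs < t ∧ (BddAbove (ZsetK u k αs) → t < Zk u k αs) ∧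
        u α₁ t = u α₂ t

/-- `ρ` is the inverse of the monotone branch of `v` on `[t₁, t₂]`, whose set of values
is `[m, M]`. -/
def InvBranch (v ρ : ℝ → ℝ) (t₁ t₂ m M : ℝ) : Prop :=
  (∀ s ∈ Icc m M, ρ s ∈ Icc t₁ t₂ ∧ v (ρ s) = s) ∧
    ∀ s ∈ Ioo m M, HasDerivAt ρ (1 / deriv v (ρ s)) s

/-- `ρ` inverts a decreasing branch of `v` over the value interval `[m, M]`, along which
`(v')² + 2F > 0`. -/
def DecBranchInv (f : ℝ → ℝ) (v ρ : ℝ → ℝ) (m M : ℝ) : Prop :=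
  ∀ s ∈ Icc m M, 0 ≤ ρ s ∧ v (ρ s) = s ∧ deriv v (ρ s) < 0 ∧
    HasDerivAt ρ (1 / deriv v (ρ s)) s ∧ 0 < (deriv v (ρ s)) ^ 2 + 2 * Fint f s

/-- The functional `Q(s) = -4 (F/f)(s) r/r' - r²/(r')² - 2 r² F(s) + H(s)` computed along
the branch inverse `ρ`. -/
def Qfun (f H ρ : ℝ → ℝ) (s : ℝ) : ℝ :=
  -4 * (Fint f s / f s) * (ρ s / deriv ρ s) - (ρ s) ^ 2 / (deriv ρ s) ^ 2 -
    2 * (ρ s) ^ 2 * Fint f s + H s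

/-- The functional `P(s) = -2n (F/f)(s) r^{n-1}/r' - r^n/(r')² - 2 r^n F(s)`. -/
def Pfun (n : ℕ) (f : ℝ → ℝ) (ρ : ℝ → ℝ) (s : ℝ) : ℝ :=
  -(2 * (n : ℝ)) * (Fint f s / f s) * (ρ s ^ (n - 1) / deriv ρ s) -
    ρ s ^ n / (deriv ρ s) ^ 2 - 2 * ρ s ^ n * Fint f s

/-- The functional `W(s) = r(s) √((u'(r(s)))² + 2 F(s))`. -/
def Wfun (f v ρ : ℝ → ℝ) (s : ℝ) : ℝ :=
  ρ s * Real.sqrt ((deriv v (ρ s)) ^ 2 + 2 * Fint f s)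

/-- The functional `W̃(s) = r(s)^{n-1} √((u'(r(s)))² + 2 F(s))`. -/
def Wtil (n : ℕ) (f : ℝ → ℝ) (v ρ : ℝ → ℝ) (s : ℝ) : ℝ :=
  ρ s ^ (n - 1) * Real.sqrt ((deriv v (ρ s)) ^ 2 + 2 * Fint f s)

/-- `v` changes sign at `z ∈ (0,∞)`: `v z = 0` and `v` takes both signs in every
neighborhood of `z` (within `(0,∞)`). -/
def SignChange (v : ℝ → ℝ) (z : ℝ) : Prop :=
  v z = 0 ∧ ∀ ε : ℝ, 0 < ε →
    (∃ x ∈ Ioo (z - ε) (z + ε) ∩ Ioi 0, 0 < v x) ∧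
    (∃ x ∈ Ioo (z - ε) (z + ε) ∩ Ioi 0, v x < 0)

/-- `v` has exactly `m` sign changes in `(0,∞)`. -/
def ExactSignChanges (v : ℝ → ℝ) (m : ℕ) : Prop :=
  {z | 0 < z ∧ SignChange v z}.Finite ∧ {z | 0 < z ∧ SignChange v z}.ncard = m

/-- Bound state: a C² solution of (E) on `(0,∞)` with `v' 0 = 0` and `v r → 0` as `r → ∞`. -/
def BoundState (n : ℕ) (f : ℝ → ℝ) (v : ℝ → ℝ) : Prop :=
  ContinuousOn v (Ici 0) ∧
    (∀ r : ℝ, 0 < r → DifferentiableAt ℝ v r ∧ DifferentiableAt ℝ (deriv v) r) ∧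
    (∀ r : ℝ, 0 < r → deriv (deriv v) r + ((n : ℝ) - 1) / r * deriv v r + f (v r) = 0) ∧
    deriv v 0 = 0 ∧ Tendsto v atTop (nhds 0)

/-- Solution of the Dirichlet problem on the ball of radius `R`. -/
def DirichletSol (n : ℕ) (f : ℝ → ℝ) (R : ℝ) (v : ℝ → ℝ) : Prop :=
  ContinuousOn v (Icc 0 R) ∧
    (∀ r ∈ Ioo (0:ℝ) R, DifferentiableAt ℝ v r ∧ DifferentiableAt ℝ (deriv v) r) ∧
    (∀ r ∈ Ioo (0:ℝ) R, deriv (deriv v) r + ((n : ℝ) - 1) / r * deriv v r + f (v r) = 0) ∧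
    deriv v 0 = 0 ∧ v R = 0

end
end Paper

section

open Set Filter Topology MeasureTheory

namespace Paper

/-- The standing assumptions on the nonlinearity. -/
structure Nonlin (n : ℕ) (f : ℝ → ℝ) (b β : ℝ) : Prop where
  two_le : 2 ≤ n
  cont : Continuous f
  h1 : Hf1 f b β
  h2 : Hf2 f
  h4 : Hf4' n f β

namespace Nonlin

variable {n : ℕ} {f : ℝ → ℝ} {b β : ℝ}

theorem odd (H : Nonlin n f b β) (s : ℝ) : f (-s) = -f s := H.h1.1 s
theorem b_pos (H : Nonlin n f b β) : 0 < b := H.h1.2.2.1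
theorem b_lt (H : Nonlin n f b β) : b < β := H.h1.2.2.2.1
theorem β_pos (H : Nonlin n f b β) : 0 < β := H.b_pos.trans H.b_lt
theorem f_pos (H : Nonlin n f b β) {s : ℝ} (hs : b < s) : 0 < f s := H.h1.2.2.2.2.1 s hs
theorem f_nonpos (H : Nonlin n f b β) {s : ℝ} (h0 : 0 ≤ s) (hs : s ≤ b) : f s ≤ 0 :=
  H.h1.2.2.2.2.2.1 s ⟨h0, hs⟩
theorem F_β (H : Nonlin n f b β) : Fint f β = 0 := H.h1.2.2.2.2.2.2.2
theorem one_le (H : Nonlin n f b β) : (1 : ℝ) ≤ (n : ℝ) - 1 := by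
  have : (2 : ℝ) ≤ n := by exact_mod_cast H.two_le
  linarith

theorem hasDerivAt_F (H : Nonlin n f b β) (s : ℝ) : HasDerivAt (Fint f) (f s) s :=
  intervalIntegral.integral_hasDerivAt_right (H.cont.intervalIntegrable _ _)
    (H.cont.stronglyMeasurableAtFilter _ _) H.cont.continuousAt

theorem continuous_F (H : Nonlin n f b β) : Continuous (Fint f) :=
  continuous_iff_continuousAt.2 fun s => (H.hasDerivAt_F s).continuousAt

theorem F_zero (_H : Nonlin n f b β) : Fint f 0 = 0 := by simp [Fint]

theorem F_neg (H : Nonlin n f b β) (s : ℝ) : Fint f (-s) = Fint f s := by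
  have h := intervalIntegral.integral_comp_neg (a := 0) (b := s) f
  simp only [neg_zero] at h
  unfold Fint
  rw [intervalIntegral.integral_symm, ← h, ← intervalIntegral.integral_neg]
  exact intervalIntegral.integral_congr fun x _ => by simp [H.odd x]

theorem F_strictMonoOn (H : Nonlin n f b β) : StrictMonoOn (Fint f) (Ici b) := by
  apply strictMonoOn_of_deriv_pos (convex_Ici b) H.continuous_F.continuousOn
  intro x hx
  rw [interior_Ici] at hx
  rw [(H.hasDerivAt_F x).deriv]
  exact H.f_pos hx

theorem F_antitoneOn (H : Nonlin n f b β) : AntitoneOn (Fint f) (Icc 0 b) := by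
  apply antitoneOn_of_deriv_nonpos (convex_Icc 0 b) H.continuous_F.continuousOn
  · intro x _; exact (H.hasDerivAt_F x).differentiableAt.differentiableWithinAt
  · intro x hx
    rw [interior_Icc] at hx
    rw [(H.hasDerivAt_F x).deriv]
    exact H.f_nonpos hx.1.le hx.2.le

theorem F_lt (H : Nonlin n f b β) {s : ℝ} (h1 : b ≤ s) (h2 : s < β) : Fint f s < 0 := by
  rw [← H.F_β]; exact H.F_strictMonoOn h1 (h1.trans h2.le) h2

theorem F_pos (H : Nonlin n f b β) {s : ℝ} (h : β < s) : 0 < Fint f s := by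
  rw [← H.F_β]; exact H.F_strictMonoOn H.b_lt.le (H.b_lt.le.trans h.le) h

theorem F_nonneg (H : Nonlin n f b β) {s : ℝ} (h : β ≤ s) : 0 ≤ Fint f s := by
  rcases h.eq_or_lt with rfl | h
  · exact H.F_β.ge
  · exact (H.F_pos h).le

theorem F_nonpos (H : Nonlin n f b β) {s : ℝ} (h : |s| ≤ β) : Fint f s ≤ 0 := by
  have key : ∀ s, 0 ≤ s → s ≤ β → Fint f s ≤ 0 := by
    intro s h0 h1
    rcases le_total s b with h | h
    · rw [← H.F_zero]; exact H.F_antitoneOn ⟨le_rfl, H.b_pos.le⟩ ⟨h0, h⟩ h0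
    · rcases h1.eq_or_lt with rfl | h1
      · exact H.F_β.le
      · exact (H.F_lt h h1).le
  rcases le_total 0 s with h0 | h0
  · exact key s h0 (abs_of_nonneg h0 ▸ h)
  · rw [← H.F_neg]; exact key _ (by linarith) (abs_of_nonpos h0 ▸ h)

theorem abs_gt_of_F_pos (H : Nonlin n f b β) {s : ℝ} (h : 0 < Fint f s) : β < |s| := by
  by_contra hc
  exact absurd (H.F_nonpos (not_lt.1 hc)) (not_le.2 h)

theorem differentiableAt_f (H : Nonlin n f b β) {s : ℝ} (hs : 0 < s) : DifferentiableAt ℝ f s :=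
  H.h2.2.1 s hs

/-- The quotient `F / f`. -/
noncomputable def _root_.Paper.Kq (f : ℝ → ℝ) (s : ℝ) : ℝ := Fint f s / f s

theorem hasDerivAt_K (H : Nonlin n f b β) {s : ℝ} (hs : b < s) :
    HasDerivAt (Kq f) (deriv (Kq f) s) s :=
  ((H.hasDerivAt_F s).differentiableAt.div (H.differentiableAt_f (H.b_pos.trans hs))
    (H.f_pos hs).ne').hasDerivAt

theorem K_deriv_ge (H : Nonlin n f b β) {s : ℝ} (hs : β < s) :
    ((n : ℝ) - 2) / 2 ≤ deriv (Kq f) s := H.h4 s hs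

theorem K_pos (H : Nonlin n f b β) {s : ℝ} (hs : β < s) : 0 < Kq f s :=
  div_pos (H.F_pos hs) (H.f_pos (H.b_lt.trans hs))

theorem K_nonneg (H : Nonlin n f b β) {s : ℝ} (hs : β ≤ s) : 0 ≤ Kq f s :=
  div_nonneg (H.F_nonneg hs) (H.f_pos (H.b_lt.trans_le hs)).le

theorem K_β (H : Nonlin n f b β) : Kq f β = 0 := by simp [Kq, H.F_β]

theorem K_mul_f (H : Nonlin n f b β) {s : ℝ} (hs : b < s) : Kq f s * f s = Fint f s :=
  div_mul_cancel₀ _ (H.f_pos hs).ne'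

theorem K_continuousOn (H : Nonlin n f b β) : ContinuousOn (Kq f) (Ioi b) := fun _ hs =>
  (H.hasDerivAt_K hs).continuousAt.continuousWithinAt

/-- A primitive of `F / f`. -/
noncomputable def _root_.Paper.IK (f : ℝ → ℝ) (β s : ℝ) : ℝ := ∫ t in β..s, Kq f t

theorem hasDerivAt_IK (H : Nonlin n f b β) {s : ℝ} (hs : b < s) :
    HasDerivAt (IK f β) (Kq f s) s := by
  apply intervalIntegral.integral_hasDerivAt_right
  · apply ContinuousOn.intervalIntegrable
    apply H.K_continuousOn.mono
    intro x hx
    rcases le_total β s with h | h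
    · rw [uIcc_of_le h] at hx; exact H.b_lt.trans_le hx.1
    · rw [uIcc_of_ge h] at hx; exact hs.trans_le hx.1
  · exact H.K_continuousOn.stronglyMeasurableAtFilter isOpen_Ioi _ hs
  · exact (H.hasDerivAt_K hs).continuousAt

theorem IK_β : IK f β β = 0 := by simp [IK]

/-- The functional `Q` at radius `t`, value `s` and slope `p`. -/
noncomputable def _root_.Paper.Qv (n : ℕ) (f : ℝ → ℝ) (β t s p : ℝ) : ℝ :=
  -4 * Kq f s * (t * p) - t ^ 2 * p ^ 2 - 2 * t ^ 2 * Fint f s - 4 * ((n : ℝ) - 2) * IK f β s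

end Nonlin

/-- `v` solves the radial equation on `[0, ∞)`, with derivative `w`. -/
structure IsSol (n : ℕ) (f v w : ℝ → ℝ) : Prop where
  cont : ContinuousOn v (Ici 0)
  dcont : ContinuousOn w (Ici 0)
  d_zero : w 0 = 0
  d1 : ∀ r, 0 < r → HasDerivAt v (w r) r
  d2 : ∀ r, 0 < r → HasDerivAt w (-(((n : ℝ) - 1) / r * w r) - f (v r)) r

namespace IsSol

variable {n : ℕ} {f v w : ℝ → ℝ} {b β : ℝ}

theorem neg (S : IsSol n f v w) (H : Nonlin n f b β) :
    IsSol n f (fun r => -v r) (fun r => -w r) where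
  cont := S.cont.neg
  dcont := S.dcont.neg
  d_zero := by simp [S.d_zero]
  d1 r hr := (S.d1 r hr).neg
  d2 r hr := by
    refine (S.d2 r hr).neg.congr_deriv ?_
    rw [H.odd]; ring

/-- The energy. -/
noncomputable def _root_.Paper.En (f v w : ℝ → ℝ) (r : ℝ) : ℝ := w r ^ 2 / 2 + Fint f (v r)

theorem hasDerivAt_En (S : IsSol n f v w) (H : Nonlin n f b β) {r : ℝ} (hr : 0 < r) :
    HasDerivAt (En f v w) (-(((n : ℝ) - 1) / r * w r ^ 2)) r := by
  have h1 := ((S.d2 r hr).pow 2).div_const 2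
  have h2 := (H.hasDerivAt_F (v r)).comp r (S.d1 r hr)
  refine (h1.add h2).congr_deriv ?_
  simp only [Nat.cast_ofNat]; ring

theorem continuousOn_En (S : IsSol n f v w) (H : Nonlin n f b β) :
    ContinuousOn (En f v w) (Ici 0) :=
  ((S.dcont.pow 2).div_const 2).add (H.continuous_F.comp_continuousOn S.cont)

theorem En_antitoneOn (S : IsSol n f v w) (H : Nonlin n f b β) :
    AntitoneOn (En f v w) (Ici 0) := by
  apply antitoneOn_of_deriv_nonpos (convex_Ici 0) (S.continuousOn_En H)
  · intro x hx
    rw [interior_Ici] at hx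
    exact (S.hasDerivAt_En H hx).differentiableAt.differentiableWithinAt
  · intro x hx
    rw [interior_Ici] at hx
    rw [(S.hasDerivAt_En H hx).deriv]
    have := H.one_le
    have hx' : (0 : ℝ) < x := hx
    have : 0 ≤ ((n : ℝ) - 1) / x := div_nonneg (by linarith) hx'.le
    nlinarith [mul_nonneg this (sq_nonneg (w x))]

theorem hasDerivAt_Q (S : IsSol n f v w) (H : Nonlin n f b β) {r : ℝ} (hr : 0 < r)
    (hb : b < v r) :
    HasDerivAt (fun r => Qv n f β r (v r) (w r))
      (-4 * r * w r ^ 2 * (deriv (Kq f) (v r) - ((n : ℝ) - 2) / 2)) r := by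
  have hK := (H.hasDerivAt_K hb).comp r (S.d1 r hr)
  have hF := (H.hasDerivAt_F (v r)).comp r (S.d1 r hr)
  have hI := (H.hasDerivAt_IK hb).comp r (S.d1 r hr)
  have hid := hasDerivAt_id r
  have h := ((((hK.const_mul (-4)).mul (hid.mul (S.d2 r hr))).sub
    ((hid.pow 2).mul ((S.d2 r hr).pow 2))).sub
    (((hid.pow 2).const_mul 2).mul hF)).sub (hI.const_mul (4 * ((n : ℝ) - 2)))
  refine h.congr_deriv ?_
  have hKf := H.K_mul_f hb
  simp only [Function.comp, id, Nat.cast_ofNat, Pi.mul_apply, Pi.pow_apply]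
  rw [← hKf]
  field_simp
  ring

end IsSol

/-- A continuous function positive at the left end point and never vanishing first stays
positive. -/
theorem pos_of_no_first_zero {g : ℝ → ℝ} {x y : ℝ} (hg : ContinuousOn g (Icc x y))
    (hx : 0 < g x) (h : ∀ t ∈ Ioc x y, (∀ s ∈ Ico x t, 0 < g s) → 0 < g t) :
    ∀ t ∈ Icc x y, 0 < g t := by
  by_contra hc
  push Not at hc
  have hne : (Icc x y ∩ g ⁻¹' Iic 0).Nonempty := hc
  have hcl : IsClosed (Icc x y ∩ g ⁻¹' Iic 0) :=
    hg.preimage_isClosed_of_isClosed isClosed_Icc isClosed_Iic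
  have hcpt : IsCompact (Icc x y ∩ g ⁻¹' Iic 0) :=
    isCompact_Icc.of_isClosed_subset hcl inter_subset_left
  obtain ⟨t, ⟨ht, htg⟩, hmin⟩ := hcpt.exists_isLeast hne
  have htx : x < t := by
    rcases ht.1.eq_or_lt with rfl | h'
    · exact absurd htg (not_le.2 hx)
    · exact h'
  refine absurd htg (not_le.2 (h t ⟨htx, ht.2⟩ fun s hs => ?_))
  by_contra hs0
  exact absurd (hmin ⟨⟨hs.1, hs.2.le.trans ht.2⟩, not_lt.1 hs0⟩) (not_le.2 hs.2)

theorem pos_of_ne_zero_first {g : ℝ → ℝ} {x y : ℝ} (hg : ContinuousOn g (Icc x y))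
    (hx : 0 < g x) (h : ∀ t ∈ Ioc x y, (∀ s ∈ Ico x t, 0 < g s) → g t ≠ 0) :
    ∀ t ∈ Icc x y, 0 < g t := by
  refine pos_of_no_first_zero hg hx fun t ht hpos => ?_
  refine lt_of_le_of_ne ?_ (h t ht hpos).symm
  have hcl : closure (Ioo x t) = Icc x t := closure_Ioo ht.1.ne
  have htm : t ∈ closure (Ioo x t) := by rw [hcl]; exact ⟨ht.1.le, le_rfl⟩
  exact ContinuousWithinAt.closure_le htm continuousWithinAt_const
    ((hg t ⟨ht.1.le, ht.2⟩).mono fun s hs => ⟨hs.1.le, hs.2.le.trans ht.2⟩)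
    fun s hs => (hpos s ⟨hs.1.le, hs.2⟩).le

theorem nonneg_right_of_Ioo {g : ℝ → ℝ} {x y : ℝ} (hxy : x < y)
    (hg : ContinuousWithinAt g (Icc x y) y) (h : ∀ t ∈ Ioo x y, 0 ≤ g t) : 0 ≤ g y := by
  have hm : y ∈ closure (Ioo x y) := by rw [closure_Ioo hxy.ne]; exact ⟨hxy.le, le_rfl⟩
  exact ContinuousWithinAt.closure_le hm continuousWithinAt_const
    (hg.mono Ioo_subset_Icc_self) h

theorem nonneg_left_of_Ioo {g : ℝ → ℝ} {x y : ℝ} (hxy : x < y)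
    (hg : ContinuousWithinAt g (Icc x y) x) (h : ∀ t ∈ Ioo x y, 0 ≤ g t) : 0 ≤ g x := by
  have hm : x ∈ closure (Ioo x y) := by rw [closure_Ioo hxy.ne]; exact ⟨le_rfl, hxy.le⟩
  exact ContinuousWithinAt.closure_le hm continuousWithinAt_const
    (hg.mono Ioo_subset_Icc_self) h

theorem monotoneOn_of_hasDerivAt_nonneg {g g' : ℝ → ℝ} {x y : ℝ}
    (hg : ContinuousOn g (Icc x y)) (hd : ∀ t ∈ Ioo x y, HasDerivAt g (g' t) t)
    (h : ∀ t ∈ Ioo x y, 0 ≤ g' t) : MonotoneOn g (Icc x y) := by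
  apply monotoneOn_of_deriv_nonneg (convex_Icc x y) hg
  · rw [interior_Icc]
    exact fun t ht => (hd t ht).differentiableAt.differentiableWithinAt
  · rw [interior_Icc]
    exact fun t ht => (hd t ht).deriv ▸ h t ht

theorem antitoneOn_of_hasDerivAt_nonpos {g g' : ℝ → ℝ} {x y : ℝ}
    (hg : ContinuousOn g (Icc x y)) (hd : ∀ t ∈ Ioo x y, HasDerivAt g (g' t) t)
    (h : ∀ t ∈ Ioo x y, g' t ≤ 0) : AntitoneOn g (Icc x y) := by
  apply antitoneOn_of_deriv_nonpos (convex_Icc x y) hg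
  · rw [interior_Icc]
    exact fun t ht => (hd t ht).differentiableAt.differentiableWithinAt
  · rw [interior_Icc]
    exact fun t ht => (hd t ht).deriv ▸ h t ht

theorem strictMonoOn_of_hasDerivAt_pos {g g' : ℝ → ℝ} {x y : ℝ}
    (hg : ContinuousOn g (Icc x y)) (hd : ∀ t ∈ Ioo x y, HasDerivAt g (g' t) t)
    (h : ∀ t ∈ Ioo x y, 0 < g' t) : StrictMonoOn g (Icc x y) := by
  apply strictMonoOn_of_deriv_pos (convex_Icc x y) hg
  rw [interior_Icc]
  exact fun t ht => (hd t ht).deriv ▸ h t ht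

theorem strictAntiOn_of_hasDerivAt_neg {g g' : ℝ → ℝ} {x y : ℝ}
    (hg : ContinuousOn g (Icc x y)) (hd : ∀ t ∈ Ioo x y, HasDerivAt g (g' t) t)
    (h : ∀ t ∈ Ioo x y, g' t < 0) : StrictAntiOn g (Icc x y) := by
  apply strictAntiOn_of_deriv_neg (convex_Icc x y) hg
  rw [interior_Icc]
  exact fun t ht => (hd t ht).deriv ▸ h t ht

/-- Two decreasing arcs parametrized by the time of the first one: `ρ t` is the time at which
the second arc takes the value `v₁ t`. -/
structure Matched (v₁ w₁ v₂ w₂ ρ : ℝ → ℝ) (x y : ℝ) : Prop where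
  nonneg : 0 ≤ x
  cont : ContinuousOn ρ (Icc x y)
  pos : ∀ t ∈ Icc x y, 0 < ρ t
  val : ∀ t ∈ Icc x y, v₂ (ρ t) = v₁ t
  w1neg : ∀ t ∈ Ioo x y, w₁ t < 0
  w2neg : ∀ t ∈ Ico x y, w₂ (ρ t) < 0
  w1le : ∀ t ∈ Icc x y, w₁ t ≤ 0
  w2le : ∀ t ∈ Icc x y, w₂ (ρ t) ≤ 0
  der : ∀ t ∈ Ioo x y, HasDerivAt ρ (w₁ t / w₂ (ρ t)) t

/-- The functional `W`. -/
noncomputable def Wv (f : ℝ → ℝ) (t s p : ℝ) : ℝ := t * √(p ^ 2 + 2 * Fint f s)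

namespace Matched

variable {n : ℕ} {f v₁ w₁ v₂ w₂ ρ : ℝ → ℝ} {b β x y : ℝ}

theorem sub (M : Matched v₁ w₁ v₂ w₂ ρ x y) {x' y' : ℝ} (hx : x ≤ x') (hy : y' ≤ y) :
    Matched v₁ w₁ v₂ w₂ ρ x' y' where
  nonneg := M.nonneg.trans hx
  cont := M.cont.mono (Icc_subset_Icc hx hy)
  pos t ht := M.pos t (Icc_subset_Icc hx hy ht)
  val t ht := M.val t (Icc_subset_Icc hx hy ht)
  w1neg t ht := M.w1neg t (Ioo_subset_Ioo hx hy ht)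
  w2neg t ht := M.w2neg t (Ico_subset_Ico hx hy ht)
  w1le t ht := M.w1le t (Icc_subset_Icc hx hy ht)
  w2le t ht := M.w2le t (Icc_subset_Icc hx hy ht)
  der t ht := M.der t (Ioo_subset_Ioo hx hy ht)

theorem cont_v1 (M : Matched v₁ w₁ v₂ w₂ ρ x y) (S₁ : IsSol n f v₁ w₁) :
    ContinuousOn v₁ (Icc x y) := S₁.cont.mono fun _ ht => M.nonneg.trans ht.1

theorem cont_w1 (M : Matched v₁ w₁ v₂ w₂ ρ x y) (S₁ : IsSol n f v₁ w₁) :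
    ContinuousOn w₁ (Icc x y) := S₁.dcont.mono fun _ ht => M.nonneg.trans ht.1

theorem cont_w2 (M : Matched v₁ w₁ v₂ w₂ ρ x y) (S₂ : IsSol n f v₂ w₂) :
    ContinuousOn (fun t => w₂ (ρ t)) (Icc x y) :=
  S₂.dcont.comp M.cont fun t ht => (M.pos t ht).le

theorem der_w2 (M : Matched v₁ w₁ v₂ w₂ ρ x y) (S₂ : IsSol n f v₂ w₂) {t : ℝ}
    (ht : t ∈ Ioo x y) :
    HasDerivAt (fun t => w₂ (ρ t))
      ((-(((n : ℝ) - 1) / ρ t * w₂ (ρ t)) - f (v₁ t)) * (w₁ t / w₂ (ρ t))) t := by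
  have h := (S₂.d2 (ρ t) (M.pos t (Ioo_subset_Icc_self ht))).comp t (M.der t ht)
  rw [M.val t (Ioo_subset_Icc_self ht)] at h
  exact h

theorem v1_strictAnti (M : Matched v₁ w₁ v₂ w₂ ρ x y) (S₁ : IsSol n f v₁ w₁) :
    StrictAntiOn v₁ (Icc x y) :=
  strictAntiOn_of_hasDerivAt_neg (M.cont_v1 S₁)
    (fun t ht => S₁.d1 t (M.nonneg.trans_lt ht.1)) M.w1neg

/-- Weighted comparison of the squared slopes while the second arc is to the right. -/
theorem slope_mono (M : Matched v₁ w₁ v₂ w₂ ρ x y) (H : Nonlin n f b β)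
    (S₁ : IsSol n f v₁ w₁) (S₂ : IsSol n f v₂ w₂) (h : ∀ t ∈ Ioo x y, t ≤ ρ t) :
    MonotoneOn (fun t => t ^ (n - 1) * (w₂ (ρ t) ^ 2 - w₁ t ^ 2)) (Icc x y) := by
  have hd : ∀ t ∈ Ioo x y, HasDerivAt (fun t => t ^ (n - 1) * (w₂ (ρ t) ^ 2 - w₁ t ^ 2))
      (((n : ℝ) - 1) * t ^ (n - 1 - 1) *
        (w₂ (ρ t) ^ 2 + w₁ t ^ 2 - 2 * (t / ρ t) * (w₁ t * w₂ (ρ t)))) t := by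
    intro t ht
    have ht0 : 0 < t := M.nonneg.trans_lt ht.1
    have hρ := M.pos t (Ioo_subset_Icc_self ht)
    have hq := M.w2neg t (Ioo_subset_Ico_self ht)
    have h1 := (hasDerivAt_id t).pow (n - 1)
    have h2 := ((M.der_w2 S₂ ht).pow 2).sub ((S₁.d2 t ht0).pow 2)
    refine (h1.mul h2).congr_deriv ?_
    have hn := H.two_le
    have hc : ((n - 1 : ℕ) : ℝ) = (n : ℝ) - 1 := by
      rw [Nat.cast_sub (by omega)]; simp
    have hp : t ^ (n - 1) = t ^ (n - 1 - 1) * t := by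
      rw [← pow_succ]; congr 1; omega
    simp only [id, Pi.pow_apply, Pi.sub_apply, hc, hp, Nat.cast_ofNat]
    have := hq.ne
    field_simp
    ring
  refine monotoneOn_of_hasDerivAt_nonneg ?_ hd ?_
  · exact (continuousOn_id.pow _).mul (((M.cont_w2 S₂).pow 2).sub ((M.cont_w1 S₁).pow 2))
  · intro t ht
    have ht0 : 0 < t := M.nonneg.trans_lt ht.1
    have hρ := M.pos t (Ioo_subset_Icc_self ht)
    have hq := M.w2neg t (Ioo_subset_Ico_self ht)
    have hp := M.w1neg t ht
    have hr : t / ρ t ≤ 1 := (div_le_one hρ).2 (h t ht)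
    have := H.one_le
    have hpq := mul_pos_of_neg_of_neg hp hq
    refine mul_nonneg (mul_nonneg (by linarith) (pow_nonneg ht0.le _)) ?_
    nlinarith [sq_nonneg (w₂ (ρ t) - w₁ t)]

/-- The second arc stays steeper while it is to the right. -/
theorem slope_of_le (M : Matched v₁ w₁ v₂ w₂ ρ x y) (H : Nonlin n f b β)
    (S₁ : IsSol n f v₁ w₁) (S₂ : IsSol n f v₂ w₂) (h : ∀ t ∈ Ioo x y, t ≤ ρ t)
    (hx : w₂ (ρ x) < w₁ x) : ∀ t ∈ Icc x y, w₂ (ρ t) < w₁ t := by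
  have key := pos_of_no_first_zero (g := fun t => w₁ t - w₂ (ρ t)) (x := x) (y := y)
    ((M.cont_w1 S₁).sub (M.cont_w2 S₂)) (by linarith) ?_
  · intro t ht; have := key t ht; linarith
  intro t ht hpos
  have hs0 : 0 < (x + t) / 2 := by linarith [M.nonneg, ht.1]
  have hs : (x + t) / 2 ∈ Icc x y := ⟨by linarith [ht.1], by linarith [ht.1, ht.2]⟩
  have hm := M.slope_mono H S₁ S₂ h hs ⟨ht.1.le, ht.2⟩ (by linarith [ht.1])
  have h1 := hpos _ ⟨hs.1, by linarith [ht.1]⟩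
  have h2 := M.w1le _ hs
  have h3 := M.w2le _ ⟨ht.1.le, ht.2⟩
  have h4 := M.w1le _ ⟨ht.1.le, ht.2⟩
  simp only at hm h1 ⊢
  have h5 : 0 < ((x + t) / 2) ^ (n - 1) *
      (w₂ (ρ ((x + t) / 2)) ^ 2 - w₁ ((x + t) / 2) ^ 2) :=
    mul_pos (pow_pos hs0 _) (by nlinarith)
  have h6 : 0 < w₂ (ρ t) ^ 2 - w₁ t ^ 2 := by
    have ht0 : 0 < t := M.nonneg.trans_lt ht.1
    exact pos_of_mul_pos_right (h5.trans_le hm) (pow_nonneg ht0.le _)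
  nlinarith

theorem der_X (M : Matched v₁ w₁ v₂ w₂ ρ x y)
    (S₁ : IsSol n f v₁ w₁) (S₂ : IsSol n f v₂ w₂) {t : ℝ} (ht : t ∈ Ioo x y) :
    HasDerivAt (fun t => t * w₁ t - ρ t * w₂ (ρ t))
      (f (v₁ t) * (ρ t * (w₁ t / w₂ (ρ t)) - t)) t := by
  have ht0 : 0 < t := M.nonneg.trans_lt ht.1
  have hρ := M.pos t (Ioo_subset_Icc_self ht)
  have hq := (M.w2neg t (Ioo_subset_Ico_self ht)).ne
  have h := ((hasDerivAt_id t).mul (S₁.d2 t ht0)).sub ((M.der t ht).mul (M.der_w2 S₂ ht))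
  refine h.congr_deriv ?_
  simp only [id]
  field_simp
  ring

theorem cont_X (M : Matched v₁ w₁ v₂ w₂ ρ x y)
    (S₁ : IsSol n f v₁ w₁) (S₂ : IsSol n f v₂ w₂) :
    ContinuousOn (fun t => t * w₁ t - ρ t * w₂ (ρ t)) (Icc x y) :=
  (continuousOn_id.mul (M.cont_w1 S₁)).sub (M.cont.mul (M.cont_w2 S₂))

theorem ratio_strictAnti (M : Matched v₁ w₁ v₂ w₂ ρ x y) (hx : 0 < x)
    (hX : ∀ t ∈ Ioo x y, 0 < t * w₁ t - ρ t * w₂ (ρ t)) :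
    StrictAntiOn (fun t => ρ t / t) (Icc x y) := by
  refine strictAntiOn_of_hasDerivAt_neg
    (g' := fun t => (w₁ t / w₂ (ρ t) * t - ρ t * 1) / t ^ 2)
    (M.cont.div continuousOn_id fun t ht => (hx.trans_le ht.1).ne') ?_ ?_
  · intro t ht
    exact (M.der t ht).div (hasDerivAt_id t) (hx.trans ht.1).ne'
  · intro t ht
    have ht0 := hx.trans ht.1
    have hq := M.w2neg t (Ioo_subset_Ico_self ht)
    refine div_neg_of_neg_of_pos ?_ (by positivity)
    have h := hX t ht
    have : w₁ t / w₂ (ρ t) * t - ρ t * 1 = (t * w₁ t - ρ t * w₂ (ρ t)) / w₂ (ρ t) := by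
      have := hq.ne
      field_simp
    rw [this]
    exact div_neg_of_pos_of_neg h hq

/-- Monotonicity of the difference of the `Q` functionals along matched arcs. -/
theorem _root_.Paper.Qdiff_mono {V₁ P₁ V₂ P₂ : ℝ → ℝ} (H : Nonlin n f b β)
    (S₁ : IsSol n f V₁ P₁) (S₂ : IsSol n f V₂ P₂)
    (hx : 0 ≤ x) (hc : ContinuousOn ρ (Icc x y)) (hpos : ∀ t ∈ Icc x y, 0 < ρ t)
    (hval : ∀ t ∈ Icc x y, V₂ (ρ t) = V₁ t)
    (hder : ∀ t ∈ Ioo x y, HasDerivAt ρ (P₁ t / P₂ (ρ t)) t)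
    (hne : ∀ t ∈ Ioo x y, P₂ (ρ t) ≠ 0)
    (hb : ∀ t ∈ Icc x y, b < V₁ t) (hβ : ∀ t ∈ Ioo x y, β < V₁ t)
    (hX : ∀ t ∈ Ioo x y, P₁ t * (t * P₁ t - ρ t * P₂ (ρ t)) ≤ 0) :
    MonotoneOn (fun t => Qv n f β t (V₁ t) (P₁ t) - Qv n f β (ρ t) (V₁ t) (P₂ (ρ t)))
      (Icc x y) := by
  refine monotoneOn_of_hasDerivAt_nonneg (g' := fun t =>
    -4 * (deriv (Kq f) (V₁ t) - ((n : ℝ) - 2) / 2) *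
      (P₁ t * (t * P₁ t - ρ t * P₂ (ρ t)))) ?_ ?_ ?_
  · have hV : ContinuousOn V₁ (Icc x y) := S₁.cont.mono fun t ht => hx.trans ht.1
    have hP : ContinuousOn P₁ (Icc x y) := S₁.dcont.mono fun t ht => hx.trans ht.1
    have hP2 : ContinuousOn (fun t => P₂ (ρ t)) (Icc x y) :=
      S₂.dcont.comp hc fun t ht => (hpos t ht).le
    have hK : ContinuousOn (fun t => Kq f (V₁ t)) (Icc x y) := H.K_continuousOn.comp hV hb
    have hF : ContinuousOn (fun t => Fint f (V₁ t)) (Icc x y) :=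
      H.continuous_F.comp_continuousOn hV
    have hI : ContinuousOn (fun t => IK f β (V₁ t)) (Icc x y) := fun t ht =>
      (H.hasDerivAt_IK (hb t ht)).continuousAt.comp_continuousWithinAt (hV t ht)
    have hc' : ∀ {τ P : ℝ → ℝ}, ContinuousOn τ (Icc x y) → ContinuousOn P (Icc x y) →
        ContinuousOn (fun t => Qv n f β (τ t) (V₁ t) (P t)) (Icc x y) := fun hτ hP =>
      (((((continuousOn_const.mul hK).mul (hτ.mul hP)).sub ((hτ.pow 2).mul (hP.pow 2))).sub
        ((continuousOn_const.mul (hτ.pow 2)).mul hF)).sub (continuousOn_const.mul hI))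
    exact (hc' continuousOn_id hP).sub (hc' hc hP2)
  · intro t ht
    have ht' := Ioo_subset_Icc_self ht
    have ht0 : 0 < t := hx.trans_lt ht.1
    have h1 := S₁.hasDerivAt_Q H ht0 (hb t ht')
    have h2 := (S₂.hasDerivAt_Q H (hpos t ht') (by rw [hval t ht']; exact hb t ht')).comp t
      (hder t ht)
    have h3 : HasDerivAt (fun t => Qv n f β (ρ t) (V₁ t) (P₂ (ρ t)))
        (-4 * ρ t * P₂ (ρ t) ^ 2 * (deriv (Kq f) (V₂ (ρ t)) - ((n : ℝ) - 2) / 2) *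
          (P₁ t / P₂ (ρ t))) t := by
      refine h2.congr_of_eventuallyEq ?_
      filter_upwards [isOpen_Ioo.mem_nhds ht] with s hs
      simp only [Function.comp, hval s (Ioo_subset_Icc_self hs)]
    refine (h1.sub h3).congr_deriv ?_
    rw [hval t ht']
    have := hne t ht
    field_simp
    ring
  · intro t ht
    have h1 := H.K_deriv_ge (hβ t ht)
    have h2 := hX t ht
    nlinarith

/-- Upper region: both arcs above `β`. -/
theorem upper (M : Matched v₁ w₁ v₂ w₂ ρ x y) (H : Nonlin n f b β)
    (S₁ : IsSol n f v₁ w₁) (S₂ : IsSol n f v₂ w₂) (hβ : ∀ t ∈ Ico x y, β < v₁ t)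
    (hxy : x < y)
    (hx : w₂ (ρ x) < w₁ x) (hX : 0 < x * w₁ x - ρ x * w₂ (ρ x))
    (hQ : Qv n f β (ρ x) (v₁ x) (w₂ (ρ x)) ≤ Qv n f β x (v₁ x) (w₁ x))
    (hq : w₂ (ρ y) < 0) :
    (0 ≤ y * w₁ y - ρ y * w₂ (ρ y)) ∧ (β < v₁ y → 0 < y * w₁ y - ρ y * w₂ (ρ y)) ∧
    Qv n f β (ρ y) (v₁ y) (w₂ (ρ y)) ≤ Qv n f β y (v₁ y) (w₁ y) ∧
    w₂ (ρ y) < w₁ y ∧ ∀ t ∈ Icc x y, ρ t ≤ t → ρ y ≤ y := by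
  have hβy : β ≤ v₁ y := by
    have := nonneg_right_of_Ioo (g := fun t => v₁ t - β) hxy
      (((M.cont_v1 S₁) y ⟨hxy.le, le_rfl⟩).sub continuousWithinAt_const)
      (fun t ht => by linarith [hβ t (Ioo_subset_Ico_self ht)])
    linarith
  have hQm : ∀ t ∈ Ioc x y, (∀ s ∈ Ico x t, 0 < s * w₁ s - ρ s * w₂ (ρ s)) →
      Qv n f β (ρ t) (v₁ t) (w₂ (ρ t)) ≤ Qv n f β t (v₁ t) (w₁ t) := by
    intro t ht hpos
    have hsub : Icc x t ⊆ Icc x y := Icc_subset_Icc le_rfl ht.2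
    have hsub' : Ioo x t ⊆ Ioo x y := Ioo_subset_Ioo le_rfl ht.2
    have hm := Qdiff_mono (ρ := ρ) (x := x) (y := t) H S₁ S₂ M.nonneg (M.cont.mono hsub)
      (fun s hs => M.pos s (hsub hs)) (fun s hs => M.val s (hsub hs))
      (fun s hs => M.der s (hsub' hs))
      (fun s hs => (M.w2neg s (Ioo_subset_Ico_self (hsub' hs))).ne)
      (fun s hs => by
        rcases hs.2.eq_or_lt with h | h
        · rcases ht.2.eq_or_lt with h' | h'
          · rw [h, h']; exact H.b_lt.trans_le hβy
          · rw [h]; exact H.b_lt.trans (hβ t ⟨ht.1.le, h'⟩)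
        · exact H.b_lt.trans (hβ s ⟨hs.1, h.trans_le ht.2⟩))
      (fun s hs => hβ s ⟨hs.1.le, hs.2.trans_le ht.2⟩)
      (fun s hs => mul_nonpos_of_nonpos_of_nonneg (M.w1neg s (hsub' hs)).le
        (hpos s ⟨hs.1.le, hs.2⟩).le)
    have := hm (left_mem_Icc.2 ht.1.le) (right_mem_Icc.2 ht.1.le) ht.1.le
    simp only at this
    linarith
  have hR : ∀ t ∈ Ioc x y, (∀ s ∈ Ico x t, 0 < s * w₁ s - ρ s * w₂ (ρ s)) →
      ∀ s ∈ Ico x t, ρ t * s ≤ ρ s * t ∧ (0 < s → ρ t * s < ρ s * t) := by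
    intro t ht hpos s hs
    have hst : s ∈ Icc x y := ⟨hs.1, hs.2.le.trans ht.2⟩
    have ht0 : 0 < t := M.nonneg.trans_lt ht.1
    have hlt : 0 < s → ρ t * s < ρ s * t := by
      intro hs0
      have hm := (M.sub hs.1 ht.2).ratio_strictAnti hs0 (fun r hr => hpos r ⟨hs.1.trans hr.1.le, hr.2⟩)
      have h3 := hm (left_mem_Icc.2 hs.2.le) (right_mem_Icc.2 hs.2.le) hs.2
      simp only at h3
      rwa [div_lt_div_iff₀ ht0 hs0] at h3
    refine ⟨?_, hlt⟩
    rcases (M.nonneg.trans hs.1).eq_or_lt with h0 | h0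
    · have := (mul_pos (M.pos s hst) ht0).le
      rw [← h0] at this ⊢; simpa using this
    · exact (hlt h0).le
  have hslope : ∀ t ∈ Ioc x y, (∀ s ∈ Ico x t, 0 < s * w₁ s - ρ s * w₂ (ρ s)) →
      t ≤ ρ t → w₂ (ρ t) < w₁ t := by
    intro t ht hpos htρ
    refine (M.sub le_rfl ht.2).slope_of_le H S₁ S₂ (fun s hs => ?_) hx t ⟨ht.1.le, le_rfl⟩
    have h1 := (hR t ht hpos s (Ioo_subset_Ico_self hs)).1
    have hs0 : 0 < s := M.nonneg.trans_lt hs.1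
    have ht0 : 0 < t := M.nonneg.trans_lt ht.1
    have : t * s ≤ ρ s * t := (mul_le_mul_of_nonneg_right htρ hs0.le).trans h1
    nlinarith
  have hne : ∀ t ∈ Ioc x y, β < v₁ t → (∀ s ∈ Ico x t, 0 < s * w₁ s - ρ s * w₂ (ρ s)) →
      t * w₁ t - ρ t * w₂ (ρ t) ≠ 0 := by
    intro t ht hβt hpos h0
    have ht0 : 0 < t := M.nonneg.trans_lt ht.1
    have hρ := M.pos t ⟨ht.1.le, ht.2⟩
    have hQt := hQm t ht hpos
    have hF := H.F_pos hβt
    have htρ : t ≤ ρ t := by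
      unfold Qv at hQt
      have e : ρ t * w₂ (ρ t) = t * w₁ t := by linarith
      have e2 : ρ t ^ 2 * w₂ (ρ t) ^ 2 = t ^ 2 * w₁ t ^ 2 := by
        rw [← mul_pow, e, mul_pow]
      rw [e, e2] at hQt
      have : Fint f (v₁ t) * (t ^ 2 - ρ t ^ 2) ≤ 0 := by linarith
      have : t ^ 2 - ρ t ^ 2 ≤ 0 := by
        by_contra hc
        exact absurd this (not_le.2 (mul_pos hF (not_le.1 hc)))
      nlinarith
    have h1 := hslope t ht hpos htρ
    have h2 := M.w1le t ⟨ht.1.le, ht.2⟩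
    nlinarith
  have hXpos : ∀ t ∈ Ico x y, 0 < t * w₁ t - ρ t * w₂ (ρ t) := by
    intro t ht
    have := pos_of_ne_zero_first (x := x) (y := t)
      ((M.cont_X S₁ S₂).mono (Icc_subset_Icc le_rfl ht.2.le)) hX
      (fun s hs => hne s ⟨hs.1, hs.2.trans ht.2.le⟩ (hβ s ⟨hs.1.le, hs.2.trans_lt ht.2⟩))
    exact this t ⟨ht.1, le_rfl⟩
  have hy : y ∈ Ioc x y := ⟨hxy, le_rfl⟩
  have hX0 : 0 ≤ y * w₁ y - ρ y * w₂ (ρ y) :=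
    nonneg_right_of_Ioo (g := fun t => t * w₁ t - ρ t * w₂ (ρ t)) hxy
      ((M.cont_X S₁ S₂) y ⟨hxy.le, le_rfl⟩)
      (fun t ht => (hXpos t (Ioo_subset_Ico_self ht)).le)
  have hy0 : 0 < y := M.nonneg.trans_lt hxy
  refine ⟨hX0, fun h => lt_of_le_of_ne hX0 (hne y hy h hXpos).symm, hQm y hy hXpos, ?_, ?_⟩
  · rcases le_or_gt y (ρ y) with h | h
    · exact hslope y hy hXpos h
    · nlinarith
  · intro t ht htρ
    rcases ht.2.eq_or_lt with h | h
    · rw [h] at htρ; exact htρ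
    rcases (M.nonneg.trans ht.1).eq_or_lt with h0 | h0
    · rw [← h0] at htρ
      have := M.pos t ht
      rw [← h0] at this
      exact absurd htρ (not_le.2 this)
    have h1 := (hR y hy hXpos t ⟨ht.1, h⟩).1
    have : ρ t * y ≤ t * y := mul_le_mul_of_nonneg_right htρ hy0.le
    nlinarith

theorem _root_.Paper.W_slope_le {p q F m A C : ℝ} (hp : p < 0) (hqp : q < p) (hF : F ≤ 0) (hm : 0 ≤ m)
    (hA : 0 < A) (hC : 0 < C) (eA : A ^ 2 = p ^ 2 + 2 * F) (eC : C ^ 2 = q ^ 2 + 2 * F) :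
    A - m * p ^ 2 / A ≤ p / q * C - m * (q * p) / C ∧
      (F < 0 → A - m * p ^ 2 / A < p / q * C - m * (q * p) / C) := by
  have hq : q < 0 := hqp.trans hp
  have k0 : (p * C) ^ 2 - (q * A) ^ 2 = 2 * F * (p ^ 2 - q ^ 2) := by
    rw [mul_pow, mul_pow, eA, eC]; ring
  have k1 : p ^ 2 - q ^ 2 < 0 := by nlinarith
  have hpC : p * C < 0 := mul_neg_of_neg_of_pos hp hC
  have hqA : q * A < 0 := mul_neg_of_neg_of_pos hq hA
  have e : p / q * C - m * (q * p) / C - (A - m * p ^ 2 / A) =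
      (q * A - p * C) * (1 / (-q) + m * (-p) / (C * A)) := by
    have := hq.ne
    field_simp
    ring
  have hc : 0 < 1 / (-q) + m * (-p) / (C * A) := by
    have h1 : 0 < 1 / (-q) := by apply one_div_pos.2; linarith
    have h2 : 0 ≤ m * (-p) / (C * A) :=
      div_nonneg (mul_nonneg hm (by linarith)) (mul_pos hC hA).le
    linarith
  constructor
  · have : 0 ≤ q * A - p * C := by
      have : 0 ≤ 2 * F * (p ^ 2 - q ^ 2) := by nlinarith
      nlinarith
    nlinarith [mul_nonneg this hc.le]
  · intro hF
    have : 0 < q * A - p * C := by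
      have : 0 < 2 * F * (p ^ 2 - q ^ 2) := by nlinarith
      nlinarith
    nlinarith [mul_pos this hc]

theorem cont_W (M : Matched v₁ w₁ v₂ w₂ ρ x y) (H : Nonlin n f b β)
    (S₁ : IsSol n f v₁ w₁) (S₂ : IsSol n f v₂ w₂) :
    ContinuousOn (fun t => Wv f (ρ t) (v₁ t) (w₂ (ρ t)) - Wv f t (v₁ t) (w₁ t)) (Icc x y) := by
  have hF : ContinuousOn (fun t => Fint f (v₁ t)) (Icc x y) :=
    H.continuous_F.comp_continuousOn (M.cont_v1 S₁)
  have h1 := M.cont_w1 S₁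
  have h2 := M.cont_w2 S₂
  have h3 := M.cont
  exact (h3.mul ((h2.pow 2).add (continuousOn_const.mul hF)).sqrt).sub
    (continuousOn_id.mul ((h1.pow 2).add (continuousOn_const.mul hF)).sqrt)

theorem der_W (M : Matched v₁ w₁ v₂ w₂ ρ x y) (H : Nonlin n f b β)
    (S₁ : IsSol n f v₁ w₁) (S₂ : IsSol n f v₂ w₂) {t : ℝ} (ht : t ∈ Ioo x y)
    (hA : 0 < w₁ t ^ 2 + 2 * Fint f (v₁ t)) (hC : 0 < w₂ (ρ t) ^ 2 + 2 * Fint f (v₁ t)) :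
    HasDerivAt (fun t => Wv f (ρ t) (v₁ t) (w₂ (ρ t)) - Wv f t (v₁ t) (w₁ t))
      ((w₁ t / w₂ (ρ t) * √(w₂ (ρ t) ^ 2 + 2 * Fint f (v₁ t)) -
          ((n : ℝ) - 1) * (w₂ (ρ t) * w₁ t) / √(w₂ (ρ t) ^ 2 + 2 * Fint f (v₁ t))) -
        (√(w₁ t ^ 2 + 2 * Fint f (v₁ t)) -
          ((n : ℝ) - 1) * w₁ t ^ 2 / √(w₁ t ^ 2 + 2 * Fint f (v₁ t)))) t := by
  have ht0 : 0 < t := M.nonneg.trans_lt ht.1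
  have hρ := M.pos t (Ioo_subset_Icc_self ht)
  have hq := (M.w2neg t (Ioo_subset_Ico_self ht)).ne
  have hF := ((H.hasDerivAt_F (v₁ t)).comp t (S₁.d1 t ht0)).const_mul 2
  have h1 := (hasDerivAt_id t).mul ((((S₁.d2 t ht0).pow 2).add hF).sqrt hA.ne')
  have h2 := (M.der t ht).mul ((((M.der_w2 S₂ ht).pow 2).add hF).sqrt hC.ne')
  refine (h2.sub h1).congr_deriv ?_
  have sA := Real.sqrt_pos.2 hA
  have sC := Real.sqrt_pos.2 hC
  simp only [id, Pi.add_apply, Pi.pow_apply, Function.comp, Nat.cast_ofNat]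
  field_simp
  ring

theorem W_mono (M : Matched v₁ w₁ v₂ w₂ ρ x y) (H : Nonlin n f b β)
    (S₁ : IsSol n f v₁ w₁) (S₂ : IsSol n f v₂ w₂) (hβ : ∀ t ∈ Ioo x y, |v₁ t| ≤ β)
    (hE : ∀ t ∈ Ioo x y, 0 < En f v₁ w₁ t) (hs : ∀ t ∈ Ioo x y, w₂ (ρ t) < w₁ t) :
    MonotoneOn (fun t => Wv f (ρ t) (v₁ t) (w₂ (ρ t)) - Wv f t (v₁ t) (w₁ t)) (Icc x y) ∧
    ((∀ t ∈ Ioo x y, Fint f (v₁ t) < 0) →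
      StrictMonoOn (fun t => Wv f (ρ t) (v₁ t) (w₂ (ρ t)) - Wv f t (v₁ t) (w₁ t))
        (Icc x y)) := by
  have hA : ∀ t ∈ Ioo x y, 0 < w₁ t ^ 2 + 2 * Fint f (v₁ t) := fun t ht => by
    have := hE t ht; unfold En at this; linarith
  have hC : ∀ t ∈ Ioo x y, 0 < w₂ (ρ t) ^ 2 + 2 * Fint f (v₁ t) := fun t ht => by
    have := hA t ht
    have h1 := hs t ht
    have h2 := M.w1neg t ht
    nlinarith
  have key := fun t (ht : t ∈ Ioo x y) => W_slope_le (m := (n : ℝ) - 1) (M.w1neg t ht) (hs t ht)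
    (H.F_nonpos (hβ t ht)) (by linarith [H.one_le]) (Real.sqrt_pos.2 (hA t ht))
    (Real.sqrt_pos.2 (hC t ht)) (Real.sq_sqrt (hA t ht).le) (Real.sq_sqrt (hC t ht).le)
  constructor
  · exact monotoneOn_of_hasDerivAt_nonneg (M.cont_W H S₁ S₂)
      (fun t ht => M.der_W H S₁ S₂ ht (hA t ht) (hC t ht))
      (fun t ht => by linarith [(key t ht).1])
  · intro hF
    exact strictMonoOn_of_hasDerivAt_pos (M.cont_W H S₁ S₂)
      (fun t ht => M.der_W H S₁ S₂ ht (hA t ht) (hC t ht))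
      (fun t ht => by linarith [(key t ht).2 (hF t ht)])

theorem sub_id_strictAnti (M : Matched v₁ w₁ v₂ w₂ ρ x y)
    (hs : ∀ t ∈ Ioo x y, w₂ (ρ t) < w₁ t) :
    StrictAntiOn (fun t => ρ t - t) (Icc x y) := by
  refine strictAntiOn_of_hasDerivAt_neg (M.cont.sub continuousOn_id)
    (fun t ht => (M.der t ht).sub (hasDerivAt_id t)) ?_
  intro t ht
  have hq := M.w2neg t (Ioo_subset_Ico_self ht)
  have : w₁ t / w₂ (ρ t) < 1 := by
    rw [div_lt_one_of_neg hq]; exact hs t ht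
  linarith

/-- Middle region: both arcs in `[-β, β]` and the second one to the left. -/
theorem middle (M : Matched v₁ w₁ v₂ w₂ ρ x y) (H : Nonlin n f b β)
    (S₁ : IsSol n f v₁ w₁) (S₂ : IsSol n f v₂ w₂) (hβ : ∀ t ∈ Ioo x y, |v₁ t| ≤ β)
    (hE : ∀ t ∈ Icc x y, 0 < En f v₁ w₁ t)
    (hρ : ρ x ≤ x) (hs : w₂ (ρ x) < w₁ x)
    (hW : Wv f x (v₁ x) (w₁ x) ≤ Wv f (ρ x) (v₁ x) (w₂ (ρ x))) :
    ∀ t ∈ Icc x y, w₂ (ρ t) < w₁ t ∧ ρ t ≤ t := by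
  have hρle : ∀ t ∈ Ioc x y, (∀ s ∈ Ico x t, w₂ (ρ s) < w₁ s) → ρ t < t := by
    intro t ht h
    have h1 := (M.sub le_rfl ht.2).sub_id_strictAnti (fun s hs => h s (Ioo_subset_Ico_self hs))
      (left_mem_Icc.2 ht.1.le) (right_mem_Icc.2 ht.1.le) ht.1
    simp only at h1
    linarith
  have key := pos_of_no_first_zero (g := fun t => w₁ t - w₂ (ρ t)) (x := x) (y := y)
    ((M.cont_w1 S₁).sub (M.cont_w2 S₂)) (by linarith) ?_
  · intro t ht
    refine ⟨by linarith [key t ht], ?_⟩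
    rcases ht.1.eq_or_lt with h | h
    · rw [← h]; exact hρ
    · exact (hρle t ⟨h, ht.2⟩ fun s hs => by
        linarith [key s ⟨hs.1, hs.2.le.trans ht.2⟩]).le
  intro t ht hpos
  have hpos' : ∀ s ∈ Ico x t, w₂ (ρ s) < w₁ s := fun s hs => by linarith [hpos s hs]
  have hlt := hρle t ht hpos'
  have hWm := ((M.sub le_rfl ht.2).W_mono H S₁ S₂ (fun s hs => hβ s ⟨hs.1, hs.2.trans_le ht.2⟩)
    (fun s hs => hE s ⟨hs.1.le, hs.2.le.trans ht.2⟩)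
    (fun s hs => hpos' s (Ioo_subset_Ico_self hs))).1
    (left_mem_Icc.2 ht.1.le) (right_mem_Icc.2 ht.1.le) ht.1.le
  simp only at hWm
  have htI : t ∈ Icc x y := ⟨ht.1.le, ht.2⟩
  have hρ0 := M.pos t htI
  have hA : 0 < w₁ t ^ 2 + 2 * Fint f (v₁ t) := by
    have := hE t htI; unfold En at this; linarith
  have hWt : t * √(w₁ t ^ 2 + 2 * Fint f (v₁ t)) ≤
      ρ t * √(w₂ (ρ t) ^ 2 + 2 * Fint f (v₁ t)) := by
    unfold Wv at hWm hW; linarith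
  have h1 : √(w₁ t ^ 2 + 2 * Fint f (v₁ t)) < √(w₂ (ρ t) ^ 2 + 2 * Fint f (v₁ t)) := by
    have sA := Real.sqrt_pos.2 hA
    by_contra hc
    have h2 := not_lt.1 hc
    have := mul_le_mul_of_nonneg_left h2 hρ0.le
    nlinarith
  have h2 := (Real.sqrt_lt_sqrt_iff hA.le).1 h1
  have h3 := M.w1le t htI
  have h4 := M.w2le t htI
  nlinarith

/-- Lower region: both arcs below `-β` and the second one to the left. -/
theorem lower (M : Matched v₁ w₁ v₂ w₂ ρ x y) (H : Nonlin n f b β)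
    (S₁ : IsSol n f v₁ w₁) (S₂ : IsSol n f v₂ w₂)
    (hx0 : 0 < x) (hβ : v₁ x ≤ -β)
    (hρ : ρ x ≤ x) (hs : w₂ (ρ x) < w₁ x) (hX : 0 ≤ x * w₁ x - ρ x * w₂ (ρ x))
    (hQ : Qv n f β (ρ x) (-v₁ x) (-w₂ (ρ x)) ≤ Qv n f β x (-v₁ x) (-w₁ x)) :
    ∀ t ∈ Icc x y, w₂ (ρ t) < w₁ t ∧ ρ t ≤ t ∧ 0 ≤ t * w₁ t - ρ t * w₂ (ρ t) ∧
      Qv n f β (ρ t) (-v₁ t) (-w₂ (ρ t)) ≤ Qv n f β t (-v₁ t) (-w₁ t) := by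
  have hlt : ∀ t ∈ Ioc x y, v₁ t < -β := fun t ht =>
    (M.v1_strictAnti S₁ ⟨le_rfl, ht.1.le.trans ht.2⟩ ⟨ht.1.le, ht.2⟩ ht.1).trans_le hβ
  have hfneg : ∀ t ∈ Ioc x y, f (v₁ t) < 0 := fun t ht => by
    have h1 := H.f_pos (s := -v₁ t) (by linarith [hlt t ht, H.b_lt])
    rw [H.odd] at h1; linarith
  have hρle : ∀ t ∈ Icc x y, (∀ s ∈ Ico x t, w₂ (ρ s) < w₁ s) → ρ t ≤ t := by
    intro t ht h
    rcases ht.1.eq_or_lt with h0 | h0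
    · rw [← h0]; exact hρ
    have h1 := (M.sub le_rfl ht.2).sub_id_strictAnti (fun s hs => h s (Ioo_subset_Ico_self hs))
      (left_mem_Icc.2 h0.le) (right_mem_Icc.2 h0.le) h0
    simp only at h1
    linarith
  have hXm : ∀ t ∈ Icc x y, (∀ s ∈ Ico x t, w₂ (ρ s) < w₁ s) →
      x * w₁ x - ρ x * w₂ (ρ x) ≤ t * w₁ t - ρ t * w₂ (ρ t) ∧
      (x < t → x * w₁ x - ρ x * w₂ (ρ x) < t * w₁ t - ρ t * w₂ (ρ t)) := by
    intro t ht h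
    have hm : StrictMonoOn (fun t => t * w₁ t - ρ t * w₂ (ρ t)) (Icc x t) := by
      refine strictMonoOn_of_hasDerivAt_pos
        ((M.cont_X S₁ S₂).mono (Icc_subset_Icc le_rfl ht.2))
        (fun s hs => M.der_X S₁ S₂ (Ioo_subset_Ioo le_rfl ht.2 hs)) ?_
      intro s hs
      have hs' : s ∈ Ioo x y := Ioo_subset_Ioo le_rfl ht.2 hs
      have h1 := hρle s ⟨hs.1.le, hs'.2.le⟩ (fun r hr => h r ⟨hr.1, hr.2.trans hs.2⟩)
      have hq := M.w2neg s (Ioo_subset_Ico_self hs')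
      have h2 : w₁ s / w₂ (ρ s) < 1 := by
        rw [div_lt_one_of_neg hq]; exact h s (Ioo_subset_Ico_self hs)
      have h3 := M.pos s (Ioo_subset_Icc_self hs')
      have h4 := hfneg s ⟨hs'.1, hs'.2.le⟩
      have h5 : ρ s * (w₁ s / w₂ (ρ s)) - s < 0 := by nlinarith
      exact mul_pos_of_neg_of_neg h4 h5
    exact ⟨hm.monotoneOn (left_mem_Icc.2 ht.1) (right_mem_Icc.2 ht.1) ht.1,
      fun h0 => hm (left_mem_Icc.2 ht.1) (right_mem_Icc.2 ht.1) h0⟩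
  have key := pos_of_no_first_zero (g := fun t => w₁ t - w₂ (ρ t)) (x := x) (y := y)
    ((M.cont_w1 S₁).sub (M.cont_w2 S₂)) (by linarith) ?_
  · have key' : ∀ t ∈ Icc x y, w₂ (ρ t) < w₁ t := fun t ht => by linarith [key t ht]
    intro t ht
    have hpre : ∀ s ∈ Ico x t, w₂ (ρ s) < w₁ s := fun s hs => key' s ⟨hs.1, hs.2.le.trans ht.2⟩
    refine ⟨key' t ht, hρle t ht hpre, hX.trans (hXm t ht hpre).1, ?_⟩
    have hm := Qdiff_mono (ρ := ρ) (x := x) (y := y) H (S₁.neg H) (S₂.neg H) M.nonneg M.cont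
      M.pos (fun s hs => by rw [M.val s hs])
      (fun s hs => by rw [neg_div_neg_eq]; exact M.der s hs)
      (fun s hs => neg_ne_zero.2 (M.w2neg s (Ioo_subset_Ico_self hs)).ne)
      (fun s hs => by
        rcases hs.1.eq_or_lt with h | h
        · rw [← h]; linarith [H.b_lt]
        · linarith [H.b_lt, hlt s ⟨h, hs.2⟩])
      (fun s hs => by linarith [hlt s ⟨hs.1, hs.2.le⟩])
      (fun s hs => by
        have h1 := (hXm s ⟨hs.1.le, hs.2.le⟩ fun r hr => key' r ⟨hr.1, hr.2.le.trans hs.2.le⟩).1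
        have h2 := M.w1neg s hs
        nlinarith)
    have := hm (left_mem_Icc.2 (ht.1.trans ht.2)) ht ht.1
    simp only at this
    linarith
  intro t ht hpos
  have hpre : ∀ s ∈ Ico x t, w₂ (ρ s) < w₁ s := fun s hs => by linarith [hpos s hs]
  have htI : t ∈ Icc x y := ⟨ht.1.le, ht.2⟩
  have h1 := (hXm t htI hpre).2 ht.1
  have h2 := hρle t htI hpre
  have h3 := M.w2le t htI
  have h4 : 0 < t := hx0.trans ht.1
  nlinarith

end Matched

namespace Matched

variable {n : ℕ} {f v₁ w₁ v₂ w₂ ρ : ℝ → ℝ} {b β x y : ℝ}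

theorem _root_.Paper.W_of_F_eq_zero {t s p : ℝ} (hF : Fint f s = 0) (hp : p ≤ 0) :
    Wv f t s p = -(t * p) := by
  unfold Wv
  rw [hF, mul_zero, add_zero, Real.sqrt_sq_eq_abs, abs_of_nonpos hp]; ring

theorem _root_.Paper.Q_at_β (H : Nonlin n f b β) (t p : ℝ) :
    Qv n f β t β p = -(t ^ 2 * p ^ 2) := by
  simp [Qv, H.K_β, H.F_β, Nonlin.IK_β]

/-- The comparison state at the end of two matched arcs once the second one is to the left. -/
structure LeftState (n : ℕ) (f : ℝ → ℝ) (β : ℝ) (v₁ w₁ w₂ ρ : ℝ → ℝ) (t : ℝ) : Prop where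
  le : ρ t ≤ t
  W : |v₁ t| ≤ β → Wv f t (v₁ t) (w₁ t) ≤ Wv f (ρ t) (v₁ t) (w₂ (ρ t))
  Q : v₁ t ≤ -β → Qv n f β (ρ t) (-v₁ t) (-w₂ (ρ t)) ≤ Qv n f β t (-v₁ t) (-w₁ t)

theorem leftState_mid (M : Matched v₁ w₁ v₂ w₂ ρ x y) (H : Nonlin n f b β)
    (S₁ : IsSol n f v₁ w₁) (S₂ : IsSol n f v₂ w₂) (hxy : x ≤ y) (hx0 : 0 < x)
    (hβ : |v₁ x| ≤ β) (hE : ∀ t ∈ Icc x y, 0 < En f v₁ w₁ t)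
    (hρ : ρ x ≤ x) (hs : w₂ (ρ x) < w₁ x)
    (hW : Wv f x (v₁ x) (w₁ x) ≤ Wv f (ρ x) (v₁ x) (w₂ (ρ x))) :
    w₂ (ρ y) < w₁ y ∧ LeftState n f β v₁ w₁ w₂ ρ y := by
  have hanti := M.v1_strictAnti S₁
  rw [abs_le] at hβ
  have mid : ∀ z ∈ Icc x y, -β ≤ v₁ z → w₂ (ρ z) < w₁ z ∧ LeftState n f β v₁ w₁ w₂ ρ z ∧
      (v₁ z = -β → 0 ≤ z * w₁ z - ρ z * w₂ (ρ z)) := by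
    intro z hz hzβ
    have hI : ∀ t ∈ Icc x z, |v₁ t| ≤ β := fun t ht => abs_le.2
      ⟨hzβ.trans (hanti.antitoneOn ⟨ht.1, ht.2.trans hz.2⟩ hz ht.2),
        (hanti.antitoneOn (left_mem_Icc.2 hxy) ⟨ht.1, ht.2.trans hz.2⟩ ht.1).trans hβ.2⟩
    have M' := M.sub le_rfl hz.2
    have hE' : ∀ t ∈ Icc x z, 0 < En f v₁ w₁ t := fun t ht => hE t ⟨ht.1, ht.2.trans hz.2⟩
    have h1 := M'.middle H S₁ S₂ (fun t ht => hI t (Ioo_subset_Icc_self ht)) hE' hρ hs hW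
    have h2 := (M'.W_mono H S₁ S₂ (fun t ht => hI t (Ioo_subset_Icc_self ht))
      (fun t ht => hE' t (Ioo_subset_Icc_self ht))
      (fun t ht => (h1 t (Ioo_subset_Icc_self ht)).1)).1
      (left_mem_Icc.2 hz.1) (right_mem_Icc.2 hz.1) hz.1
    simp only at h2
    have hzz : z ∈ Icc x z := right_mem_Icc.2 hz.1
    have hWz : Wv f z (v₁ z) (w₁ z) ≤ Wv f (ρ z) (v₁ z) (w₂ (ρ z)) := by linarith
    have hXz : v₁ z = -β → 0 ≤ z * w₁ z - ρ z * w₂ (ρ z) := by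
      intro e
      have hF : Fint f (v₁ z) = 0 := by rw [e, H.F_neg, H.F_β]
      rw [W_of_F_eq_zero hF (M.w1le z hz), W_of_F_eq_zero hF (M.w2le z hz)] at hWz
      linarith
    refine ⟨(h1 z hzz).1, ⟨(h1 z hzz).2, fun _ => hWz, fun hle => ?_⟩, hXz⟩
    have e : v₁ z = -β := le_antisymm hle hzβ
    have hX := hXz e
    rw [e, neg_neg, Q_at_β H, Q_at_β H]
    have h3 := M.w1le z hz
    have h4 : 0 ≤ z * (-w₁ z) := mul_nonneg (hx0.le.trans hz.1) (by linarith)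
    nlinarith
  rcases le_or_gt (-β) (v₁ y) with h | h
  · exact ⟨(mid y (right_mem_Icc.2 hxy) h).1, (mid y (right_mem_Icc.2 hxy) h).2.1⟩
  · obtain ⟨z, hz, hzv⟩ := intermediate_value_Icc' hxy (M.cont_v1 S₁) ⟨h.le, hβ.1⟩
    obtain ⟨m1, m2, m3⟩ := mid z hz hzv.ge
    have h5 := (M.sub hz.1 le_rfl).lower H S₁ S₂ (hx0.trans_le hz.1) hzv.le m2.le m1
      (m3 hzv) (m2.Q hzv.le) y (right_mem_Icc.2 hz.2)
    refine ⟨h5.1, ⟨h5.2.1, fun h6 => ?_, fun _ => h5.2.2.2⟩⟩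
    rw [abs_le] at h6
    linarith [h6.1]

/-- Comparison of two matched decreasing arcs starting above `β`. -/
theorem branch (M : Matched v₁ w₁ v₂ w₂ ρ x y) (H : Nonlin n f b β)
    (S₁ : IsSol n f v₁ w₁) (S₂ : IsSol n f v₂ w₂) (hxy : x < y)
    (hβ : β < v₁ x) (hE : ∀ t ∈ Icc x y, 0 < En f v₁ w₁ t)
    (hs : w₂ (ρ x) < w₁ x) (hX : 0 < x * w₁ x - ρ x * w₂ (ρ x))
    (hQ : Qv n f β (ρ x) (v₁ x) (w₂ (ρ x)) ≤ Qv n f β x (v₁ x) (w₁ x))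
    (hq : -β ≤ v₁ y → w₂ (ρ y) < 0) :
    w₂ (ρ y) < w₁ y ∧ ((∃ t ∈ Icc x y, ρ t ≤ t) → LeftState n f β v₁ w₁ w₂ ρ y) := by
  have hanti := M.v1_strictAnti S₁
  have hβ0 := H.β_pos
  rcases le_or_gt β (v₁ y) with h | h
  · have hu := M.upper H S₁ S₂ (fun t ht => h.trans_lt
      (hanti ⟨ht.1, ht.2.le⟩ (right_mem_Icc.2 hxy.le) ht.2)) hxy hs hX hQ (hq (by linarith))
    refine ⟨hu.2.2.2.1, fun ⟨t, ht, htρ⟩ => ⟨hu.2.2.2.2 t ht htρ, fun h1 => ?_, fun h1 => ?_⟩⟩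
    · have e : v₁ y = β := le_antisymm (abs_le.1 h1).2 h
      have hF : Fint f (v₁ y) = 0 := by rw [e, H.F_β]
      rw [W_of_F_eq_zero hF (M.w1le y (right_mem_Icc.2 hxy.le)),
        W_of_F_eq_zero hF (M.w2le y (right_mem_Icc.2 hxy.le))]
      linarith [hu.1]
    · linarith
  obtain ⟨z, hz, hzv⟩ := intermediate_value_Icc' hxy.le (M.cont_v1 S₁) ⟨h.le, hβ.le⟩
  have hzx : x < z := by
    rcases hz.1.eq_or_lt with e | e
    · rw [← e] at hzv; linarith
    · exact e
  have hzy : z < y := by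
    rcases hz.2.eq_or_lt with e | e
    · rw [e] at hzv; linarith
    · exact e
  have hu := (M.sub le_rfl hz.2).upper H S₁ S₂ (fun t ht => hzv ▸
      (hanti ⟨ht.1, ht.2.le.trans hz.2⟩ hz ht.2)) hzx hs hX hQ (M.w2neg z ⟨hz.1, hzy⟩)
  have hz0 : 0 < z := M.nonneg.trans_lt hzx
  have Mz := M.sub hz.1 le_rfl
  have hEz : ∀ t ∈ Icc z y, 0 < En f v₁ w₁ t := fun t ht => hE t ⟨hz.1.trans ht.1, ht.2⟩
  rcases le_or_gt (ρ z) z with hρz | hρz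
  · have hF : Fint f (v₁ z) = 0 := by rw [hzv, H.F_β]
    have := Mz.leftState_mid H S₁ S₂ hz.2 hz0 (by rw [hzv, abs_of_pos hβ0]) hEz hρz hu.2.2.2.1
      (by
        rw [W_of_F_eq_zero hF (M.w1le z hz), W_of_F_eq_zero hF (M.w2le z hz)]
        linarith [hu.1])
    exact ⟨this.1, fun _ => this.2⟩
  · by_cases hex : ∃ t ∈ Icc z y, ρ t ≤ t
    · have hcl : IsClosed (Icc z y ∩ (fun t => ρ t - t) ⁻¹' Iic 0) :=
        (Mz.cont.sub continuousOn_id).preimage_isClosed_of_isClosed isClosed_Icc isClosed_Iic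
      have hne : (Icc z y ∩ (fun t => ρ t - t) ⁻¹' Iic 0).Nonempty := by
        obtain ⟨t, ht, h1⟩ := hex
        exact ⟨t, ht, by simpa using h1⟩
      obtain ⟨τ, ⟨hτ, hτρ⟩, hmin⟩ :=
        (isCompact_Icc.of_isClosed_subset hcl inter_subset_left).exists_isLeast hne
      have hτρ' : ρ τ ≤ τ := by simpa using hτρ
      have hzτ : z < τ := by
        rcases hτ.1.eq_or_lt with e | e
        · rw [← e] at hτρ'; linarith
        · exact e
      have hbefore : ∀ t ∈ Ico z τ, t < ρ t := by
        intro t ht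
        by_contra hc
        exact absurd (hmin ⟨⟨ht.1, ht.2.le.trans hτ.2⟩, by simpa using not_lt.1 hc⟩)
          (not_le.2 ht.2)
      have hge : τ ≤ ρ τ := by
        have := nonneg_right_of_Ioo (g := fun t => ρ t - t) hzτ
          (((Mz.cont.sub continuousOn_id) τ hτ).mono (Icc_subset_Icc le_rfl hτ.2))
          (fun t ht => by linarith [hbefore t (Ioo_subset_Ico_self ht)])
        linarith
      have hρτ : ρ τ = τ := le_antisymm hτρ' hge
      have hsl := (Mz.sub le_rfl hτ.2).slope_of_le H S₁ S₂
        (fun t ht => (hbefore t (Ioo_subset_Ico_self ht)).le) hu.2.2.2.1 τ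
        (right_mem_Icc.2 hτ.1)
      have hτ0 : 0 < τ := hz0.trans hzτ
      have hτ' : τ ∈ Icc x y := ⟨hz.1.trans hτ.1, hτ.2⟩
      have hp := M.w1le τ hτ'
      have hτv : v₁ τ < β := hzv ▸ hanti hz hτ' hzτ
      have Mτ := M.sub hτ'.1 le_rfl
      have hsq : w₁ τ ^ 2 < w₂ (ρ τ) ^ 2 := by nlinarith
      rcases le_or_gt (-β) (v₁ τ) with h1 | h1
      · have := Mτ.leftState_mid H S₁ S₂ hτ.2 hτ0 (abs_le.2 ⟨h1, hτv.le⟩)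
          (fun t ht => hE t ⟨hτ'.1.trans ht.1, ht.2⟩) hτρ' hsl (by
            unfold Wv
            conv_rhs => rw [hρτ]
            refine mul_le_mul_of_nonneg_left (Real.sqrt_le_sqrt ?_) hτ0.le
            rw [hρτ] at hsq
            linarith)
        exact ⟨this.1, fun _ => this.2⟩
      · have hK : 0 ≤ Kq f (-v₁ τ) := H.K_nonneg (by linarith)
        have := Mτ.lower H S₁ S₂ hτ0 h1.le hτρ' hsl (by rw [hρτ] at hsl ⊢; nlinarith) (by
          rw [hρτ] at hsl hsq ⊢
          unfold Qv
          have e1 : 0 ≤ Kq f (-v₁ τ) * (τ * (w₁ τ - w₂ τ)) :=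
            mul_nonneg hK (mul_nonneg hτ0.le (by linarith))
          have e2 : 0 ≤ τ ^ 2 * (w₂ τ ^ 2 - w₁ τ ^ 2) :=
            mul_nonneg (by positivity) (by linarith)
          nlinarith) y (right_mem_Icc.2 hτ.2)
        refine ⟨this.1, fun _ => ⟨this.2.1, fun h6 => ?_, fun _ => this.2.2.2⟩⟩
        have : v₁ y ≤ v₁ τ := hanti.antitoneOn hτ' (right_mem_Icc.2 hxy.le) hτ.2
        rw [abs_le] at h6
        linarith [h6.1]
    · push Not at hex
      refine ⟨Mz.slope_of_le H S₁ S₂ (fun t ht => (hex t (Ioo_subset_Icc_self ht)).le)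
        hu.2.2.2.1 y (right_mem_Icc.2 hz.2), fun ⟨t, ht, htρ⟩ => ?_⟩
      rcases le_total t z with h1 | h1
      · exact absurd (hu.2.2.2.2 t ⟨ht.1, h1⟩ htρ) (not_le.2 hρz)
      · exact absurd htρ (not_le.2 (hex t ⟨h1, ht.2⟩))

end Matched

/-- Existence of a matching of two decreasing arcs. -/
theorem exists_matched {n : ℕ} {f v₁ w₁ v₂ w₂ : ℝ → ℝ} {x y p q : ℝ}
    (S₁ : IsSol n f v₁ w₁) (S₂ : IsSol n f v₂ w₂)
    (hx : 0 ≤ x) (hxy : x < y) (hp : 0 ≤ p) (hpq : p < q)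
    (h1 : ∀ t ∈ Ioo x y, w₁ t < 0) (h2 : ∀ t ∈ Ioo p q, w₂ t < 0)
    (htop : v₁ x < v₂ p) (hbot : v₂ q ≤ v₁ y) :
    ∃ ρ : ℝ → ℝ, Matched v₁ w₁ v₂ w₂ ρ x y ∧ (∀ t ∈ Icc x y, ρ t ∈ Ioc p q) ∧
      ∀ t ∈ Ico x y, ρ t < q := by
  have c1 : ContinuousOn v₁ (Icc x y) := S₁.cont.mono fun t ht => hx.trans ht.1
  have c2 : ContinuousOn v₂ (Icc p q) := S₂.cont.mono fun t ht => hp.trans ht.1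
  have a1 : StrictAntiOn v₁ (Icc x y) := strictAntiOn_of_hasDerivAt_neg c1
    (fun t ht => S₁.d1 t (hx.trans_lt ht.1)) h1
  have a2 : StrictAntiOn v₂ (Icc p q) := strictAntiOn_of_hasDerivAt_neg c2
    (fun t ht => S₂.d1 t (hp.trans_lt ht.1)) h2
  have hex : ∀ t, ∃ r, t ∈ Icc x y → r ∈ Icc p q ∧ v₂ r = v₁ t := by
    intro t
    by_cases ht : t ∈ Icc x y
    · obtain ⟨r, hr, hrv⟩ := intermediate_value_Icc' hpq.le c2
        (⟨hbot.trans (a1.antitoneOn ht (right_mem_Icc.2 hxy.le) ht.2),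
          (a1.antitoneOn (left_mem_Icc.2 hxy.le) ht ht.1).trans htop.le⟩ : v₁ t ∈ Icc (v₂ q) (v₂ p))
      exact ⟨r, fun _ => ⟨hr, hrv⟩⟩
    · exact ⟨0, fun h => absurd h ht⟩
  choose ρ hρ using hex
  have hmono : StrictMonoOn ρ (Icc x y) := by
    intro s hs t ht hst
    by_contra hc
    have := a2.antitoneOn (hρ t ht).1 (hρ s hs).1 (not_lt.1 hc)
    rw [(hρ t ht).2, (hρ s hs).2] at this
    exact absurd (a1 hs ht hst) (not_lt.2 this)
  have hgt : ∀ t ∈ Icc x y, p < ρ t := by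
    intro t ht
    rcases (hρ t ht).1.1.eq_or_lt with e | e
    · have := (hρ t ht).2
      rw [← e] at this
      linarith [a1.antitoneOn (left_mem_Icc.2 hxy.le) ht ht.1]
    · exact e
  have hlt : ∀ t ∈ Ico x y, ρ t < q := fun t ht =>
    (hmono (Ico_subset_Icc_self ht) (right_mem_Icc.2 hxy.le) ht.2).trans_le
      (hρ y (right_mem_Icc.2 hxy.le)).1.2
  have hcont : ContinuousOn ρ (Icc x y) := by
    have hemb : Topology.IsEmbedding ((Icc p q).domRestrict v₂) := by
      have : CompactSpace (Icc p q) := isCompact_iff_compactSpace.1 isCompact_Icc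
      exact (Continuous.isClosedEmbedding (continuousOn_iff_continuous_domRestrict.1 c2)
        (injOn_iff_injective.1 a2.injOn)).isEmbedding
    rw [continuousOn_iff_continuous_domRestrict]
    have hcod : Continuous (fun t : Icc x y => (⟨ρ t, (hρ t t.2).1⟩ : Icc p q)) := by
      rw [hemb.continuous_iff]
      have : (Icc p q).domRestrict v₂ ∘ (fun t : Icc x y => (⟨ρ t, (hρ t t.2).1⟩ : Icc p q)) =
          (Icc x y).domRestrict v₁ := by
        funext t
        exact (hρ t t.2).2
      rw [this]
      exact continuousOn_iff_continuous_domRestrict.1 c1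
    exact continuous_subtype_val.comp hcod
  have w2n : ∀ t ∈ Ico x y, w₂ (ρ t) < 0 := fun t ht =>
    h2 _ ⟨hgt t (Ico_subset_Icc_self ht), hlt t ht⟩
  have dw1 : ContinuousOn w₁ (Icc x y) := S₁.dcont.mono fun t ht => hx.trans ht.1
  have dw2 : ContinuousOn (fun t => w₂ (ρ t)) (Icc x y) :=
    S₂.dcont.comp hcont fun t ht => hp.trans (hgt t ht).le
  refine ⟨ρ, ⟨hx, hcont, fun t ht => hp.trans_lt (hgt t ht), fun t ht => (hρ t ht).2, h1, w2n,
    ?_, ?_, ?_⟩, fun t ht => ⟨hgt t ht, (hρ t ht).1.2⟩, hlt⟩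
  · intro t ht
    rcases ht.1.eq_or_lt with e | e
    · have := nonneg_left_of_Ioo (g := fun t => -w₁ t) hxy
        ((dw1 x (left_mem_Icc.2 hxy.le)).neg) fun s hs => by linarith [h1 s hs]
      rw [← e]; linarith
    rcases ht.2.eq_or_lt with e' | e'
    · have := nonneg_right_of_Ioo (g := fun t => -w₁ t) hxy
        ((dw1 y (right_mem_Icc.2 hxy.le)).neg) fun s hs => by linarith [h1 s hs]
      rw [e']; linarith
    · exact (h1 t ⟨e, e'⟩).le
  · intro t ht
    rcases ht.2.eq_or_lt with e' | e'
    · have := nonneg_right_of_Ioo (g := fun t => -w₂ (ρ t)) hxy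
        ((dw2 y (right_mem_Icc.2 hxy.le)).neg) fun s hs => by
          linarith [w2n s (Ioo_subset_Ico_self hs)]
      rw [e']; linarith
    · exact (w2n t ⟨ht.1, e'⟩).le
  · intro t ht
    have ht0 : 0 < t := hx.trans_lt ht.1
    have htI := Ioo_subset_Icc_self ht
    have hcA : ContinuousAt ρ t := hcont.continuousAt (Icc_mem_nhds ht.1 ht.2)
    have hρ0 : 0 < ρ t := hp.trans_lt (hgt t htI)
    have hq := (w2n t (Ioo_subset_Ico_self ht)).ne
    have hd2 := S₂.d1 (ρ t) hρ0
    have hd1 := S₁.d1 t ht0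
    rw [hasDerivAt_iff_tendsto_slope] at hd1 hd2 ⊢
    have hne : ∀ᶠ s in 𝓝[≠] t, ρ s ≠ ρ t := by
      filter_upwards [nhdsWithin_le_nhds (Icc_mem_nhds ht.1 ht.2), self_mem_nhdsWithin]
        with s hs hst
      exact fun e => hst (hmono.injOn hs htI e)
    have hρt : Tendsto ρ (𝓝[≠] t) (𝓝[≠] (ρ t)) :=
      tendsto_nhdsWithin_iff.2 ⟨hcA.tendsto.mono_left nhdsWithin_le_nhds, hne⟩
    have h3 := hd1.div (hd2.comp hρt) hq
    refine h3.congr' ?_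
    filter_upwards [nhdsWithin_le_nhds (Icc_mem_nhds ht.1 ht.2), self_mem_nhdsWithin, hne]
      with s hs hst hs2
    have hv : v₁ s - v₁ t ≠ 0 := sub_ne_zero.2 fun e => hst (a1.injOn hs htI e)
    have hst' : s - t ≠ 0 := sub_ne_zero.2 hst
    have hs2' : ρ s - ρ t ≠ 0 := sub_ne_zero.2 hs2
    simp only [Function.comp, slope_def_field, (hρ s hs).2, (hρ t htI).2, Pi.div_apply]
    field_simp

end Paper

namespace Paper

variable {n : ℕ} {f : ℝ → ℝ} {b β : ℝ} {u : ℝ → ℝ → ℝ} {αs : ℝ}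

theorem Family.isSol (hu : Family n f u) {α : ℝ} (hα : 0 < α) :
    IsSol n f (u α) (deriv (u α)) := by
  obtain ⟨-, h2, h3, h4, h5⟩ := hu.1 α hα
  refine ⟨h3, ?_, h2, fun r hr => (h4 r hr).1.hasDerivAt, fun r hr => ?_⟩
  · exact hu.2.2.comp (f := fun r : ℝ => (α, r)) (by fun_prop) fun r hr => ⟨hα, hr⟩
  · refine (h4 r hr).2.hasDerivAt.congr_deriv ?_
    linarith [h5 r hr]

theorem Family.zero_val (hu : Family n f u) {α : ℝ} (hα : 0 < α) : u α 0 = α := (hu.1 α hα).1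

/-- Local uniformity of an open condition in a parameter and a nonnegative radius. -/
theorem eventually_near {g : ℝ × ℝ → ℝ} (hg : ContinuousOn g (Ioi 0 ×ˢ Ici 0)) (hα : 0 < αs)
    {r₀ : ℝ} (hr₀ : 0 ≤ r₀) {O : Set ℝ} (hO : O ∈ 𝓝 (g (αs, r₀))) :
    ∃ η > 0, ∀ᶠ α in 𝓝 αs, ∀ r, 0 ≤ r → |r - r₀| ≤ η → g (α, r) ∈ O := by
  have h := hg (αs, r₀) ⟨hα, hr₀⟩ hO
  rw [mem_map, nhdsWithin_prod_eq, mem_prod_iff] at h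
  obtain ⟨A, hA, B, hB, hAB⟩ := h
  rw [nhdsWithin_eq_nhds.2 (Ioi_mem_nhds hα)] at hA
  rw [mem_nhdsWithin_iff_exists_mem_nhds_inter] at hB
  obtain ⟨V, hV, hVB⟩ := hB
  obtain ⟨ε, hε, hball⟩ := Metric.mem_nhds_iff.1 hV
  refine ⟨ε / 2, by positivity, ?_⟩
  filter_upwards [hA] with α hα' r hr hrη
  refine hAB ⟨hα', hVB ⟨hball ?_, hr⟩⟩
  rw [Metric.mem_ball, Real.dist_eq]
  linarith

/-- Uniformity of an open condition on compact intervals of radii. -/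
theorem eventually_on_Icc {g : ℝ × ℝ → ℝ} (hg : ContinuousOn g (Ioi 0 ×ˢ Ici 0)) (hα : 0 < αs)
    {A B : ℝ} (hA : 0 ≤ A) (h : ∀ r ∈ Icc A B, 0 < g (αs, r)) :
    ∀ᶠ α in 𝓝 αs, ∀ r ∈ Icc A B, 0 < g (α, r) := by
  have key : ∀ᶠ α in 𝓝 αs, ∀ r ∈ Icc A B, 0 ≤ r → 0 < g (α, r) := by
    refine isCompact_Icc.induction_on (p := fun s => ∀ᶠ α in 𝓝 αs, ∀ r ∈ s, 0 ≤ r → 0 < g (α, r))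
      (by simp) (fun s t hst ht => ?_) (fun s t hs ht => ?_) (fun r hr => ?_)
    · filter_upwards [ht] with α h r hr using h r (hst hr)
    · filter_upwards [hs, ht] with α h1 h2 r hr
      exact hr.elim (h1 r) (h2 r)
    · obtain ⟨η, hη, h1⟩ := eventually_near hg hα (hA.trans hr.1) (Ioi_mem_nhds (h r hr))
      refine ⟨Metric.closedBall r η, nhdsWithin_le_nhds (Metric.closedBall_mem_nhds r hη), ?_⟩
      filter_upwards [h1] with α h2 s hs hs0
      exact h2 s hs0 (by simpa [Real.dist_eq] using hs)
  filter_upwards [key] with α h1 r hr using h1 r hr (hA.trans hr.1)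

/-- Two-sided Gronwall estimate. -/
theorem gronwall_two_sided {y y' : ℝ → ℝ} {l h K : ℝ} (hd : ∀ t ∈ Icc l h, HasDerivAt y (y' t) t)
    (hb : ∀ t ∈ Icc l h, |y' t| ≤ K * y t) (hy : ∀ t ∈ Icc l h, 0 ≤ y t) (hK : 0 ≤ K) :
    ∀ r ∈ Icc l h, ∀ r' ∈ Icc l h, y r' ≤ Real.exp (K * (h - l)) * y r := by
  have hE : ∀ c t : ℝ, HasDerivAt (fun t => Real.exp (c * t)) (Real.exp (c * t) * (c * 1)) t :=
    fun c t => ((hasDerivAt_id t).const_mul c).exp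
  have hc : ContinuousOn y (Icc l h) := fun t ht => (hd t ht).continuousAt.continuousWithinAt
  have hcE : ∀ c : ℝ, ContinuousOn (fun t => y t * Real.exp (c * t)) (Icc l h) := fun c =>
    hc.mul (by fun_prop)
  have m1 : MonotoneOn (fun t => y t * Real.exp (K * t)) (Icc l h) := by
    refine monotoneOn_of_hasDerivAt_nonneg (hcE K)
      (fun t ht => (hd t (Ioo_subset_Icc_self ht)).mul (hE K t)) fun t ht => ?_
    have := (abs_le.1 (hb t (Ioo_subset_Icc_self ht))).1
    have e := Real.exp_pos (K * t)
    nlinarith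
  have m2 : AntitoneOn (fun t => y t * Real.exp (-K * t)) (Icc l h) := by
    refine antitoneOn_of_hasDerivAt_nonpos (hcE (-K))
      (fun t ht => (hd t (Ioo_subset_Icc_self ht)).mul (hE (-K) t)) fun t ht => ?_
    have := (abs_le.1 (hb t (Ioo_subset_Icc_self ht))).2
    have e := Real.exp_pos (-K * t)
    nlinarith
  intro r hr r' hr'
  have aux : ∀ c : ℝ, |c| ≤ K * (h - l) → Real.exp c * y r ≤ Real.exp (K * (h - l)) * y r :=
    fun c hc => mul_le_mul_of_nonneg_right (Real.exp_le_exp.2 (le_of_abs_le hc)) (hy r hr)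
  have hrr : K * |r - r'| ≤ K * (h - l) := by
    refine mul_le_mul_of_nonneg_left (abs_le.2 ⟨?_, ?_⟩) hK <;>
    linarith [hr.1, hr.2, hr'.1, hr'.2]
  rcases le_total r' r with h1 | h1
  · have := m1 hr' hr h1
    simp only at this
    have e : y r' ≤ Real.exp (K * (r - r')) * y r := by
      have e1 : Real.exp (K * (r - r')) = Real.exp (K * r) / Real.exp (K * r') := by
        rw [← Real.exp_sub]; ring_nf
      rw [e1, div_mul_eq_mul_div, le_div_iff₀ (Real.exp_pos _)]
      linarith
    exact e.trans (aux _ (by rw [abs_mul, abs_of_nonneg hK]; exact hrr))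
  · have := m2 hr hr' h1
    simp only at this
    have e : y r' ≤ Real.exp (K * (r' - r)) * y r := by
      have e1 : Real.exp (K * (r' - r)) = Real.exp (-K * r) / Real.exp (-K * r') := by
        rw [← Real.exp_sub]; ring_nf
      rw [e1, div_mul_eq_mul_div, le_div_iff₀ (Real.exp_pos _)]
      linarith
    exact e.trans (aux _ (by rw [abs_mul, abs_of_nonneg hK, abs_sub_comm]; exact hrr))

/-- The squared distance of two solutions in the phase plane. -/
noncomputable def dist2 (v₁ w₁ v₂ w₂ : ℝ → ℝ) (r : ℝ) : ℝ :=
  (v₂ r - v₁ r) ^ 2 + (w₂ r - w₁ r) ^ 2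

theorem dist2_nonneg (v₁ w₁ v₂ w₂ : ℝ → ℝ) (r : ℝ) : 0 ≤ dist2 v₁ w₁ v₂ w₂ r := by
  unfold dist2; positivity

theorem hasDerivAt_dist2 {v₁ w₁ v₂ w₂ : ℝ → ℝ} (S₁ : IsSol n f v₁ w₁) (S₂ : IsSol n f v₂ w₂)
    {r : ℝ} (hr : 0 < r) :
    HasDerivAt (dist2 v₁ w₁ v₂ w₂)
      (2 * (v₂ r - v₁ r) * (w₂ r - w₁ r) - 2 * (((n : ℝ) - 1) / r) * (w₂ r - w₁ r) ^ 2 -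
        2 * (w₂ r - w₁ r) * (f (v₂ r) - f (v₁ r))) r := by
  have h1 := ((S₂.d1 r hr).sub (S₁.d1 r hr)).pow 2
  have h2 := ((S₂.d2 r hr).sub (S₁.d2 r hr)).pow 2
  refine (h1.add h2).congr_deriv ?_
  simp only [Pi.sub_apply, Nat.cast_ofNat]
  ring

theorem dist2_bound_of_lipschitz (H : Nonlin n f b β) {l h K : ℝ} (hl : 0 < l) (hK : 0 ≤ K)
    {v₁ w₁ v₂ w₂ : ℝ → ℝ} (S₁ : IsSol n f v₁ w₁) (S₂ : IsSol n f v₂ w₂)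
    (hf : ∀ r ∈ Icc l h, |f (v₂ r) - f (v₁ r)| ≤ K * |v₂ r - v₁ r|) :
    ∀ r ∈ Icc l h, ∀ r' ∈ Icc l h, dist2 v₁ w₁ v₂ w₂ r' ≤
      Real.exp ((1 + 2 * (((n : ℝ) - 1) / l) + K) * (h - l)) * dist2 v₁ w₁ v₂ w₂ r := by
  have hm := H.one_le
  have hml : 0 ≤ ((n : ℝ) - 1) / l := div_nonneg (by linarith) hl.le
  refine gronwall_two_sided (fun t ht => hasDerivAt_dist2 S₁ S₂ (hl.trans_le ht.1)) ?_
    (fun t _ => dist2_nonneg _ _ _ _ t) (by positivity)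
  intro t ht
  have h0 := hf t ht
  have ht0 := hl.trans_le ht.1
  have h1 : ((n : ℝ) - 1) / t ≤ ((n : ℝ) - 1) / l :=
    div_le_div_of_nonneg_left (by linarith) hl ht.1
  have h2 : 0 ≤ ((n : ℝ) - 1) / t := div_nonneg (by linarith) ht0.le
  unfold dist2
  set D := v₂ t - v₁ t
  set E := w₂ t - w₁ t
  set φ := f (v₂ t) - f (v₁ t)
  have a1 : |2 * D * E| ≤ D ^ 2 + E ^ 2 := by
    rw [abs_le]; constructor <;> nlinarith [sq_nonneg (D - E), sq_nonneg (D + E)]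
  have a2 : |2 * E * φ| ≤ K * (D ^ 2 + E ^ 2) := by
    rw [abs_mul, abs_mul, abs_two]
    have : 2 * |E| * |φ| ≤ 2 * |E| * (K * |D|) := mul_le_mul_of_nonneg_left h0 (by positivity)
    have : 2 * |E| * |D| ≤ D ^ 2 + E ^ 2 := by
      rw [← sq_abs D, ← sq_abs E]; nlinarith [sq_nonneg (|D| - |E|)]
    nlinarith
  have a3 : |2 * (((n : ℝ) - 1) / t) * E ^ 2| ≤ 2 * (((n : ℝ) - 1) / l) * (D ^ 2 + E ^ 2) := by
    rw [abs_of_nonneg (by positivity)]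
    have := mul_le_mul_of_nonneg_right h1 (sq_nonneg E)
    nlinarith [mul_nonneg hml (sq_nonneg D)]
  calc |2 * D * E - 2 * (((n : ℝ) - 1) / t) * E ^ 2 - 2 * E * φ|
      ≤ |2 * D * E| + |2 * (((n : ℝ) - 1) / t) * E ^ 2| + |2 * E * φ| := by
        refine (abs_sub _ _).trans ?_
        gcongr
        exact abs_sub _ _
    _ ≤ _ := by nlinarith

set_option maxHeartbeats 1000000 in
theorem dist2_bound_of_slope (H : Nonlin n f b β) {l h L c B : ℝ} (hl : 0 < l) (hL : 0 ≤ L)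
    (hc : 0 < c) (hB : 0 ≤ B) :
    ∃ K > 0, ∀ v₁ w₁ v₂ w₂ : ℝ → ℝ, IsSol n f v₁ w₁ → IsSol n f v₂ w₂ →
      (∀ r ∈ Icc l h, |Fint f (v₂ r) - Fint f (v₁ r)| ≤ L * |v₂ r - v₁ r|) →
      (∀ r ∈ Icc l h, c ≤ |(w₂ r + w₁ r) / 2|) → (∀ r ∈ Icc l h, |(w₂ r + w₁ r) / 2| ≤ B) →
      ∀ r ∈ Icc l h, ∀ r' ∈ Icc l h, dist2 v₁ w₁ v₂ w₂ r' ≤ K * dist2 v₁ w₁ v₂ w₂ r := by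
  have hm := H.one_le
  have hml : 0 ≤ ((n : ℝ) - 1) / l := div_nonneg (by linarith) hl.le
  set m := ((n : ℝ) - 1) / l with hmdef
  set G := (1 + 2 * L) / c + 4 * m * (1 + L)
  have hG : 0 ≤ G := by positivity
  refine ⟨(1 + 2 * (1 + L ^ 2) / c ^ 2) * Real.exp (G * (h - l)) * (1 + 2 * B ^ 2 + 2 * L ^ 2),
    by positivity, ?_⟩
  intro v₁ w₁ v₂ w₂ S₁ S₂ hF hcP hBP
  set z : ℝ → ℝ := fun r => (v₂ r - v₁ r) ^ 2 + (En f v₂ w₂ r - En f v₁ w₁ r) ^ 2 with hz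
  have hε : ∀ r, En f v₂ w₂ r - En f v₁ w₁ r =
      (w₂ r + w₁ r) / 2 * (w₂ r - w₁ r) + (Fint f (v₂ r) - Fint f (v₁ r)) := by
    intro r; unfold En; ring
  have hg := gronwall_two_sided (y := z) (l := l) (h := h) (K := G)
    (y' := fun r => 2 * (v₂ r - v₁ r) * (w₂ r - w₁ r) +
      2 * (En f v₂ w₂ r - En f v₁ w₁ r) *
        (-(((n : ℝ) - 1) / r * w₂ r ^ 2) - -(((n : ℝ) - 1) / r * w₁ r ^ 2))) ?_ ?_ ?_ hG
  · intro r hr r' hr'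
    have h1 := hg r hr r' hr'
    have hup : z r ≤ (1 + 2 * B ^ 2 + 2 * L ^ 2) * dist2 v₁ w₁ v₂ w₂ r := by
      simp only [hz, dist2, hε]
      have h2 := sq_le_sq' (by
        linarith [abs_nonneg (Fint f (v₂ r) - Fint f (v₁ r)), hF r hr,
          mul_nonneg hL (abs_nonneg (v₂ r - v₁ r))]) (hF r hr)
      rw [sq_abs, mul_pow, sq_abs] at h2
      have h3 := sq_le_sq' (by linarith [abs_nonneg ((w₂ r + w₁ r) / 2)]) (hBP r hr)
      rw [sq_abs] at h3
      set P := (w₂ r + w₁ r) / 2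
      set D := v₂ r - v₁ r
      set E := w₂ r - w₁ r
      set φ := Fint f (v₂ r) - Fint f (v₁ r)
      have : (P * E) ^ 2 ≤ B ^ 2 * E ^ 2 := by
        rw [mul_pow]; exact mul_le_mul_of_nonneg_right h3 (sq_nonneg E)
      nlinarith [sq_nonneg (P * E - φ), mul_nonneg (sq_nonneg B) (sq_nonneg D),
        mul_nonneg (sq_nonneg L) (sq_nonneg E), sq_nonneg D, sq_nonneg E]
    have hlo : dist2 v₁ w₁ v₂ w₂ r' ≤ (1 + 2 * (1 + L ^ 2) / c ^ 2) * z r' := by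
      simp only [hz, dist2]
      have he := hε r'
      have h2 := sq_le_sq' (by
        linarith [abs_nonneg (Fint f (v₂ r') - Fint f (v₁ r')), hF r' hr',
          mul_nonneg hL (abs_nonneg (v₂ r' - v₁ r'))]) (hF r' hr')
      rw [sq_abs, mul_pow, sq_abs] at h2
      have h3 : c ^ 2 ≤ ((w₂ r' + w₁ r') / 2) ^ 2 := by
        rw [← sq_abs ((w₂ r' + w₁ r') / 2)]
        exact pow_le_pow_left₀ hc.le (hcP r' hr') 2
      set P := (w₂ r' + w₁ r') / 2
      set D := v₂ r' - v₁ r'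
      set E := w₂ r' - w₁ r'
      set φ := Fint f (v₂ r') - Fint f (v₁ r')
      set ε := En f v₂ w₂ r' - En f v₁ w₁ r'
      have h4 : c ^ 2 * E ^ 2 ≤ 2 * (ε ^ 2 + L ^ 2 * D ^ 2) := by
        have e1 : P * E = ε - φ := by linarith
        have e2 : P ^ 2 * E ^ 2 = (ε - φ) ^ 2 := by rw [← mul_pow, e1]
        have := mul_le_mul_of_nonneg_right h3 (sq_nonneg E)
        nlinarith [sq_nonneg (ε + φ)]
      have h5 : E ^ 2 ≤ 2 * (1 + L ^ 2) / c ^ 2 * (D ^ 2 + ε ^ 2) := by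
        rw [div_mul_eq_mul_div, le_div_iff₀ (by positivity)]
        nlinarith [mul_nonneg (sq_nonneg L) (sq_nonneg ε), sq_nonneg D]
      nlinarith [sq_nonneg ε]
    calc dist2 v₁ w₁ v₂ w₂ r' ≤ _ := hlo
      _ ≤ (1 + 2 * (1 + L ^ 2) / c ^ 2) * (Real.exp (G * (h - l)) * z r) := by gcongr
      _ ≤ (1 + 2 * (1 + L ^ 2) / c ^ 2) * (Real.exp (G * (h - l)) *
          ((1 + 2 * B ^ 2 + 2 * L ^ 2) * dist2 v₁ w₁ v₂ w₂ r)) := by gcongr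
      _ = _ := by ring
  · intro t ht
    have ht0 := hl.trans_le ht.1
    have h1 := ((S₂.d1 t ht0).sub (S₁.d1 t ht0)).pow 2
    have h2 := ((S₂.hasDerivAt_En H ht0).sub (S₁.hasDerivAt_En H ht0)).pow 2
    refine (h1.add h2).congr_deriv ?_
    simp only [Pi.sub_apply, Nat.cast_ofNat]
    ring
  · intro t ht
    have ht0 := hl.trans_le ht.1
    have h1 : ((n : ℝ) - 1) / t ≤ m := div_le_div_of_nonneg_left (by linarith) hl ht.1
    have h2 : 0 ≤ ((n : ℝ) - 1) / t := div_nonneg (by linarith) ht0.le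
    have he := hε t
    have hFt := hF t ht
    have hct := hcP t ht
    have hcs : (-(((n : ℝ) - 1) / t * w₂ t ^ 2) - -(((n : ℝ) - 1) / t * w₁ t ^ 2)) =
        -(2 * (((n : ℝ) - 1) / t)) * ((w₂ t + w₁ t) / 2 * (w₂ t - w₁ t)) := by ring
    simp only [hz]
    rw [hcs]
    set P := (w₂ t + w₁ t) / 2
    set D := v₂ t - v₁ t
    set E := w₂ t - w₁ t
    set φ := Fint f (v₂ t) - Fint f (v₁ t)
    set ε := En f v₂ w₂ t - En f v₁ w₁ t
    set κ := ((n : ℝ) - 1) / t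
    have e1 : P * E = ε - φ := by linarith
    have a0 : |ε - φ| ≤ |ε| + L * |D| := (abs_sub _ _).trans (by linarith)
    have a1 : |E| ≤ (|ε| + L * |D|) / c := by
      rw [le_div_iff₀ hc]
      have : |P| * |E| ≤ |ε| + L * |D| := by rw [← abs_mul, e1]; exact a0
      nlinarith [abs_nonneg E]
    have s1 := sq_abs D
    have s2 := sq_abs ε
    have hDε : 2 * (|D| * |ε|) ≤ D ^ 2 + ε ^ 2 := by nlinarith [sq_nonneg (|D| - |ε|)]
    rw [e1]
    have b1 : |2 * D * E| ≤ (1 + 2 * L) / c * (D ^ 2 + ε ^ 2) := by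
      rw [abs_mul, abs_mul, abs_two]
      have : 2 * |D| * |E| ≤ 2 * |D| * ((|ε| + L * |D|) / c) :=
        mul_le_mul_of_nonneg_left a1 (by positivity)
      refine this.trans ?_
      rw [mul_div_assoc', div_mul_eq_mul_div, div_le_div_iff_of_pos_right hc]
      nlinarith [mul_nonneg hL (sq_nonneg ε)]
    have b2 : |2 * ε * (-(2 * κ) * (ε - φ))| ≤ 4 * m * (1 + L) * (D ^ 2 + ε ^ 2) := by
      rw [abs_mul, abs_mul, abs_mul, abs_neg, abs_mul, abs_two, abs_of_nonneg h2]
      have q1 : |ε| * |ε - φ| ≤ (1 + L) * (D ^ 2 + ε ^ 2) := by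
        have : |ε| * |ε - φ| ≤ |ε| * (|ε| + L * |D|) :=
          mul_le_mul_of_nonneg_left a0 (abs_nonneg _)
        nlinarith [sq_nonneg D, sq_nonneg ε]
      have q2 : κ * (|ε| * |ε - φ|) ≤ m * ((1 + L) * (D ^ 2 + ε ^ 2)) :=
        mul_le_mul h1 q1 (by positivity) hml
      nlinarith
    refine (abs_add_le _ _).trans ?_
    have : G * (D ^ 2 + ε ^ 2) = (1 + 2 * L) / c * (D ^ 2 + ε ^ 2) +
      4 * m * (1 + L) * (D ^ 2 + ε ^ 2) := by simp only [G]; ring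
    linarith
  · intro t _
    simp only [hz]; positivity

theorem exists_lipschitz_near {g : ℝ → ℝ} {g' s : ℝ} (hg : HasStrictDerivAt g g' s) :
    ∃ K ≥ 0, ∃ ε > 0, ∀ x y, |x - s| ≤ ε → |y - s| ≤ ε → |g y - g x| ≤ K * |y - x| := by
  obtain ⟨K, t, ht, hK⟩ := hg.hasStrictFDerivAt.exists_lipschitzOnWith
  obtain ⟨ε, hε, hball⟩ := Metric.mem_nhds_iff.1 ht
  refine ⟨K, K.2, ε / 2, by positivity, fun x y hx hy => ?_⟩
  have h := hK.dist_le_mul y (hball (by rw [Metric.mem_ball, Real.dist_eq]; linarith))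
    x (hball (by rw [Metric.mem_ball, Real.dist_eq]; linarith))
  simpa [Real.dist_eq] using h

theorem Nonlin.F_lipschitz_near (H : Nonlin n f b β) (s : ℝ) :
    ∃ K ≥ 0, ∃ ε > 0, ∀ x y, |x - s| ≤ ε → |y - s| ≤ ε →
      |Fint f y - Fint f x| ≤ K * |y - x| :=
  exists_lipschitz_near (hasStrictDerivAt_of_hasDerivAt_of_continuousAt
    (Eventually.of_forall H.hasDerivAt_F) H.cont.continuousAt)

theorem Nonlin.f_lipschitz_near_of_pos (H : Nonlin n f b β) {s : ℝ} (hs : 0 < s) :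
    ∃ K ≥ 0, ∃ ε > 0, ∀ x y, |x - s| ≤ ε → |y - s| ≤ ε → |f y - f x| ≤ K * |y - x| := by
  refine exists_lipschitz_near (hasStrictDerivAt_of_hasDerivAt_of_continuousAt
    (f' := deriv f) ?_ (H.h2.2.2.1.continuousAt (Ioi_mem_nhds hs)))
  filter_upwards [Ioi_mem_nhds hs] with x hx using (H.differentiableAt_f hx).hasDerivAt

theorem Nonlin.f_lipschitz_near (H : Nonlin n f b β) {s : ℝ} (hs : s ≠ 0) :
    ∃ K ≥ 0, ∃ ε > 0, ∀ x y, |x - s| ≤ ε → |y - s| ≤ ε → |f y - f x| ≤ K * |y - x| := by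
  rcases hs.lt_or_gt with h | h
  · obtain ⟨K, hK, ε, hε, hl⟩ := H.f_lipschitz_near_of_pos (neg_pos.2 h)
    refine ⟨K, hK, ε, hε, fun x y hx hy => ?_⟩
    have e : ∀ z, |-z - -s| = |z - s| := fun z => by rw [← abs_neg]; congr 1; ring
    have := hl (-x) (-y) (by rw [e]; exact hx) (by rw [e]; exact hy)
    rw [H.odd, H.odd] at this
    rw [abs_sub_comm (f y), abs_sub_comm y]
    convert this using 2 <;> ring_nf
  · exact H.f_lipschitz_near_of_pos h

/-- Two-sided Lipschitz dependence on the initial value, on `[0, R]`. -/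
def BiLip (u : ℝ → ℝ → ℝ) (αs R : ℝ) : Prop :=
  ∃ C > 0, ∀ᶠ p : ℝ × ℝ in 𝓝 (αs, αs), ∀ r ∈ Icc 0 R,
    dist2 (u p.1) (deriv (u p.1)) (u p.2) (deriv (u p.2)) r ≤ C * (p.2 - p.1) ^ 2 ∧
    (p.2 - p.1) ^ 2 ≤ C * dist2 (u p.1) (deriv (u p.1)) (u p.2) (deriv (u p.2)) r

theorem eventually_both {P : ℝ → Prop} (h : ∀ᶠ α in 𝓝 αs, P α) :
    ∀ᶠ p : ℝ × ℝ in 𝓝 (αs, αs), P p.1 ∧ P p.2 :=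
  (continuous_fst.tendsto (αs, αs) |>.eventually h).and
    (continuous_snd.tendsto (αs, αs) |>.eventually h)

theorem continuousOn_dist2 {v₁ w₁ v₂ w₂ : ℝ → ℝ} (S₁ : IsSol n f v₁ w₁) (S₂ : IsSol n f v₂ w₂) :
    ContinuousOn (dist2 v₁ w₁ v₂ w₂) (Ici 0) :=
  ((S₂.cont.sub S₁.cont).pow 2).add ((S₂.dcont.sub S₁.dcont).pow 2)

theorem biLip_near_zero (H : Nonlin n f b β) (hu : Family n f u) (hα : 0 < αs) :
    ∃ η > 0, BiLip u αs η := by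
  obtain ⟨K, hK, ε, hε, hl⟩ := H.f_lipschitz_near hα.ne'
  obtain ⟨η₁, hη₁, h1⟩ := eventually_near hu.2.1 hα le_rfl
    (O := Metric.closedBall αs ε) (by
      simp only [hu.zero_val hα]; exact Metric.closedBall_mem_nhds _ hε)
  have hm := H.one_le
  set C := Real.exp (1 + K)
  have hC : 0 < C := Real.exp_pos _
  set η := min η₁ (min 1 (1 / (2 * C)))
  have hη : 0 < η := by positivity
  have hηa : η ≤ η₁ := min_le_left _ _
  have hηb : η ≤ 1 := (min_le_right _ _).trans (min_le_left _ _)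
  have hηc : η ≤ 1 / (2 * C) := (min_le_right _ _).trans (min_le_right _ _)
  refine ⟨η, hη, max C 2, by positivity, ?_⟩
  filter_upwards [eventually_both h1, eventually_both (Ioi_mem_nhds hα)] with p hp hp0 r hr
  have S₁ := hu.isSol hp0.1
  have S₂ := hu.isSol hp0.2
  set v₁ := u p.1
  set v₂ := u p.2
  set w₁ := deriv (u p.1)
  set w₂ := deriv (u p.2)
  have hI : Icc 0 η ⊆ Ici (0 : ℝ) := fun t ht => ht.1
  have hE : ∀ t : ℝ, HasDerivAt (fun t => Real.exp (-(1 + K) * t))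
      (Real.exp (-(1 + K) * t) * (-(1 + K) * 1)) t :=
    fun t => ((hasDerivAt_id t).const_mul _).exp
  have m1 : AntitoneOn (fun t => dist2 v₁ w₁ v₂ w₂ t * Real.exp (-(1 + K) * t)) (Icc 0 η) := by
    refine antitoneOn_of_hasDerivAt_nonpos
      (((continuousOn_dist2 S₁ S₂).mono hI).mul (by fun_prop))
      (fun t ht => (hasDerivAt_dist2 S₁ S₂ ht.1).mul (hE t)) fun t ht => ?_
    have htη : |t - 0| ≤ η₁ := by rw [sub_zero, abs_of_pos ht.1]; linarith [ht.2]
    have a1 := hp.1 t ht.1.le htη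
    have a2 := hp.2 t ht.1.le htη
    simp only [Metric.mem_closedBall, Real.dist_eq] at a1 a2
    have hL := hl _ _ a1 a2
    have h2 : 0 ≤ ((n : ℝ) - 1) / t := div_nonneg (by linarith) ht.1.le
    change |f (v₂ t) - f (v₁ t)| ≤ K * |v₂ t - v₁ t| at hL
    unfold dist2
    set D := v₂ t - v₁ t
    set E := w₂ t - w₁ t
    set φ := f (v₂ t) - f (v₁ t)
    have b1 : -(2 * E * φ) ≤ K * (D ^ 2 + E ^ 2) := by
      have c1 : -(2 * E * φ) ≤ 2 * |E| * |φ| := by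
        have := neg_abs_le (E * φ)
        rw [abs_mul] at this; linarith
      have c2 : 2 * |E| * |φ| ≤ 2 * |E| * (K * |D|) := mul_le_mul_of_nonneg_left hL (by positivity)
      have c3 : 2 * |E| * |D| ≤ D ^ 2 + E ^ 2 := by
        rw [← sq_abs D, ← sq_abs E]; nlinarith [sq_nonneg (|D| - |E|)]
      nlinarith
    have b2 : 2 * D * E ≤ D ^ 2 + E ^ 2 := by nlinarith [sq_nonneg (D - E)]
    have b3 : 0 ≤ 2 * (((n : ℝ) - 1) / t) * E ^ 2 := by positivity
    have e := Real.exp_pos (-(1 + K) * t)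
    nlinarith
  have h0 : dist2 v₁ w₁ v₂ w₂ 0 = (p.2 - p.1) ^ 2 := by
    simp only [dist2, S₁.d_zero, S₂.d_zero, v₁, v₂, hu.zero_val hp0.1, hu.zero_val hp0.2]; ring
  have up : ∀ t ∈ Icc 0 η, dist2 v₁ w₁ v₂ w₂ t ≤ C * (p.2 - p.1) ^ 2 := by
    intro t ht
    have := m1 ⟨le_rfl, hη.le⟩ ht ht.1
    simp only [mul_zero, Real.exp_zero, mul_one, h0] at this
    have e1 : Real.exp (-(1 + K) * t) * Real.exp ((1 + K) * t) = 1 := by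
      rw [← Real.exp_add, Real.exp_eq_one_iff]; ring
    have e2 : Real.exp ((1 + K) * t) ≤ C := Real.exp_le_exp.2 (by nlinarith [ht.2])
    have e3 := Real.exp_pos ((1 + K) * t)
    calc dist2 v₁ w₁ v₂ w₂ t = dist2 v₁ w₁ v₂ w₂ t * Real.exp (-(1 + K) * t) *
          Real.exp ((1 + K) * t) := by rw [mul_assoc, e1, mul_one]
      _ ≤ (p.2 - p.1) ^ 2 * Real.exp ((1 + K) * t) := by gcongr
      _ ≤ C * (p.2 - p.1) ^ 2 := by nlinarith [sq_nonneg (p.2 - p.1)]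
  have m2 : MonotoneOn (fun t => (v₂ t - v₁ t) ^ 2 + C * (p.2 - p.1) ^ 2 * t) (Icc 0 η) := by
    refine monotoneOn_of_hasDerivAt_nonneg
      ((((S₂.cont.sub S₁.cont).pow 2).mono hI).add (by fun_prop))
      (fun t ht => (((S₂.d1 t ht.1).sub (S₁.d1 t ht.1)).pow 2).add
        ((hasDerivAt_id t).const_mul _)) fun t ht => ?_
    have := up t (Ioo_subset_Icc_self ht)
    unfold dist2 at this
    simp only [Pi.sub_apply, Nat.cast_ofNat, Nat.add_one_sub_one, pow_one]
    nlinarith [sq_nonneg (v₂ t - v₁ t + (w₂ t - w₁ t))]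
  constructor
  · exact (up r hr).trans (mul_le_mul_of_nonneg_right (le_max_left _ _) (sq_nonneg _))
  · have h3 := m2 ⟨le_rfl, hη.le⟩ hr hr.1
    simp only [v₁, v₂, hu.zero_val hp0.1, hu.zero_val hp0.2] at h3
    have h4 : C * r ≤ 1 / 2 := by
      have := hr.2.trans hηc
      rw [le_div_iff₀ (by positivity)] at this; linarith
    have h5 : (p.2 - p.1) ^ 2 ≤ 2 * dist2 v₁ w₁ v₂ w₂ r := by
      unfold dist2; nlinarith [sq_nonneg (p.2 - p.1), sq_nonneg (w₂ r - w₁ r)]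
    exact h5.trans (mul_le_mul_of_nonneg_right (le_max_right _ _) (dist2_nonneg _ _ _ _ _))

theorem dist2_comparable_near (H : Nonlin n f b β) (hu : Family n f u) (hα : 0 < αs) {r₀ : ℝ}
    (hr₀ : 0 < r₀) (hne : u αs r₀ ≠ 0 ∨ deriv (u αs) r₀ ≠ 0) :
    ∃ η > 0, ∃ K > 0, ∀ᶠ p : ℝ × ℝ in 𝓝 (αs, αs),
      ∀ r ∈ Icc (r₀ - η) (r₀ + η), ∀ r' ∈ Icc (r₀ - η) (r₀ + η),
      dist2 (u p.1) (deriv (u p.1)) (u p.2) (deriv (u p.2)) r' ≤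
        K * dist2 (u p.1) (deriv (u p.1)) (u p.2) (deriv (u p.2)) r := by
  by_cases h0 : u αs r₀ = 0
  · have hw : deriv (u αs) r₀ ≠ 0 := hne.resolve_left (not_not.2 h0)
    set a := |deriv (u αs) r₀|
    have ha : 0 < a := abs_pos.2 hw
    obtain ⟨L, hL, ε, hε, hl⟩ := H.F_lipschitz_near (u αs r₀)
    obtain ⟨η₁, hη₁, h1⟩ := eventually_near hu.2.1 hα hr₀.le
      (O := Metric.closedBall (u αs r₀) ε) (Metric.closedBall_mem_nhds _ hε)
    obtain ⟨η₂, hη₂, h2⟩ := eventually_near hu.2.2 hα hr₀.le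
      (O := Metric.closedBall (deriv (u αs) r₀) (a / 2)) (Metric.closedBall_mem_nhds _ (by positivity))
    set η := min η₁ (min η₂ (r₀ / 2))
    have hη : 0 < η := by positivity
    have hηa : η ≤ η₁ := min_le_left _ _
    have hηb : η ≤ η₂ := (min_le_right _ _).trans (min_le_left _ _)
    have hηc : η ≤ r₀ / 2 := (min_le_right _ _).trans (min_le_right _ _)
    obtain ⟨K, hK, hbd⟩ := dist2_bound_of_slope H (l := r₀ - η) (h := r₀ + η) (L := L) (c := a / 2)
      (B := 3 * a / 2) (by linarith) hL (by positivity) (by positivity)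
    refine ⟨η, hη, K, hK, ?_⟩
    filter_upwards [eventually_both h1, eventually_both h2,
      eventually_both (Ioi_mem_nhds hα)] with p hp hp' hp0
    have key : ∀ r ∈ Icc (r₀ - η) (r₀ + η), 0 ≤ r ∧ |r - r₀| ≤ η := fun r hr =>
      ⟨by linarith [hr.1], abs_le.2 ⟨by linarith [hr.1], by linarith [hr.2]⟩⟩
    refine hbd _ _ _ _ (hu.isSol hp0.1) (hu.isSol hp0.2) (fun r hr => ?_) (fun r hr => ?_)
      (fun r hr => ?_)
    · obtain ⟨k1, k2⟩ := key r hr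
      have a1 := hp.1 r k1 (k2.trans hηa)
      have a2 := hp.2 r k1 (k2.trans hηa)
      simp only [Metric.mem_closedBall, Real.dist_eq] at a1 a2
      exact hl _ _ a1 a2
    all_goals
      obtain ⟨k1, k2⟩ := key r hr
      have a1 := hp'.1 r k1 (k2.trans hηb)
      have a2 := hp'.2 r k1 (k2.trans hηb)
      simp only [Metric.mem_closedBall, Real.dist_eq] at a1 a2
      have b1 := abs_add_le (deriv (u p.2) r - deriv (u αs) r₀) (deriv (u p.1) r - deriv (u αs) r₀)
      set s := deriv (u p.2) r + deriv (u p.1) r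
      rw [show deriv (u p.2) r - deriv (u αs) r₀ + (deriv (u p.1) r - deriv (u αs) r₀) =
        s - 2 * deriv (u αs) r₀ by simp only [s]; ring] at b1
      have b2 : |2 * deriv (u αs) r₀| = 2 * a := by rw [abs_mul, abs_two]
      rw [abs_div, abs_two]
    · have := abs_sub_abs_le_abs_sub (2 * deriv (u αs) r₀) s
      rw [abs_sub_comm, b2] at this
      linarith
    · have := abs_sub_abs_le_abs_sub s (2 * deriv (u αs) r₀)
      rw [b2] at this
      linarith
  · obtain ⟨K, hK, ε, hε, hl⟩ := H.f_lipschitz_near h0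
    obtain ⟨η₁, hη₁, h1⟩ := eventually_near hu.2.1 hα hr₀.le
      (O := Metric.closedBall (u αs r₀) ε) (Metric.closedBall_mem_nhds _ hε)
    set η := min η₁ (r₀ / 2)
    have hη : 0 < η := by positivity
    have hηa : η ≤ η₁ := min_le_left _ _
    have hηc : η ≤ r₀ / 2 := min_le_right _ _
    refine ⟨η, hη, Real.exp ((1 + 2 * (((n : ℝ) - 1) / (r₀ - η)) + K) * (r₀ + η - (r₀ - η))),
      Real.exp_pos _, ?_⟩
    filter_upwards [eventually_both h1, eventually_both (Ioi_mem_nhds hα)] with p hp hp0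
    refine dist2_bound_of_lipschitz H (by linarith) hK (hu.isSol hp0.1) (hu.isSol hp0.2)
      fun r hr => ?_
    have k1 : 0 ≤ r := by linarith [hr.1]
    have k2 : |r - r₀| ≤ η₁ := abs_le.2 ⟨by linarith [hr.1], by linarith [hr.2]⟩
    have a1 := hp.1 r k1 k2
    have a2 := hp.2 r k1 k2
    simp only [Metric.mem_closedBall, Real.dist_eq] at a1 a2
    exact hl _ _ a1 a2

theorem BiLip.mono {R R' : ℝ} (h : BiLip u αs R) (hR : R' ≤ R) : BiLip u αs R' := by
  obtain ⟨C, hC, h⟩ := h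
  refine ⟨C, hC, ?_⟩
  filter_upwards [h] with p hp r hr using hp r ⟨hr.1, hr.2.trans hR⟩

theorem biLip (H : Nonlin n f b β) (hu : Family n f u) (hα : 0 < αs) {R : ℝ}
    (hne : ∀ r, 0 < r → r ≤ R → u αs r ≠ 0 ∨ deriv (u αs) r ≠ 0) : BiLip u αs R := by
  obtain ⟨η₀, hη₀, h0⟩ := biLip_near_zero H hu hα
  rcases le_total R η₀ with hR | hR
  · exact h0.mono hR
  set S := {x | x ∈ Icc η₀ R ∧ BiLip u αs x}
  have hS : η₀ ∈ S := ⟨⟨le_rfl, hR⟩, h0⟩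
  have hbdd : BddAbove S := ⟨R, fun x hx => hx.1.2⟩
  have hs1 : η₀ ≤ sSup S := le_csSup hbdd hS
  have hs2 : sSup S ≤ R := csSup_le ⟨_, hS⟩ fun x hx => hx.1.2
  set s := sSup S
  obtain ⟨η, hη, K, hK, hloc⟩ := dist2_comparable_near H hu hα (hη₀.trans_le hs1)
    (hne s (hη₀.trans_le hs1) hs2)
  obtain ⟨x, hx, hxs⟩ := exists_lt_of_lt_csSup ⟨_, hS⟩ (show s - η < sSup S by linarith)
  have hxs' : x ≤ s := le_csSup hbdd hx
  have key : BiLip u αs (s + η) := by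
    obtain ⟨C, hC, hCx⟩ := hx.2
    refine ⟨C * max K 1, by positivity, ?_⟩
    filter_upwards [hloc, hCx] with p hp hp' r hr
    have hx0 : x ∈ Icc 0 x := ⟨hη₀.le.trans hx.1.1, le_rfl⟩
    have hd := dist2_nonneg (u p.1) (deriv (u p.1)) (u p.2) (deriv (u p.2)) r
    have hm1 : 1 ≤ max K 1 := le_max_right _ _
    rcases le_total r x with h | h
    · obtain ⟨q1, q2⟩ := hp' r ⟨hr.1, h⟩
      constructor
      · refine q1.trans (mul_le_mul_of_nonneg_right ?_ (sq_nonneg _)); nlinarith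
      · refine q2.trans (mul_le_mul_of_nonneg_right ?_ hd); nlinarith
    · obtain ⟨q1, q2⟩ := hp' x hx0
      have i1 : x ∈ Icc (s - η) (s + η) := ⟨hxs.le, by linarith⟩
      have i2 : r ∈ Icc (s - η) (s + η) := ⟨by linarith, hr.2⟩
      have e1 := hp x i1 r i2
      have e2 := hp r i2 x i1
      have hK1 : K ≤ max K 1 := le_max_left _ _
      constructor
      · calc _ ≤ _ := e1
          _ ≤ K * (C * (p.2 - p.1) ^ 2) := by gcongr
          _ ≤ max K 1 * (C * (p.2 - p.1) ^ 2) := by gcongr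
          _ = _ := by ring
      · calc _ ≤ _ := q2
          _ ≤ C * (K * dist2 (u p.1) (deriv (u p.1)) (u p.2) (deriv (u p.2)) r) := by gcongr
          _ ≤ C * (max K 1 * dist2 (u p.1) (deriv (u p.1)) (u p.2) (deriv (u p.2)) r) := by gcongr
          _ = _ := by ring
  rcases hs2.eq_or_lt with h | h
  · exact key.mono (by linarith)
  · exfalso
    have hm : min (s + η) R ∈ S :=
      ⟨⟨le_min (by linarith) hR, min_le_right _ _⟩, key.mono (min_le_left _ _)⟩
    have := le_csSup hbdd hm
    have h3 : s < min (s + η) R := lt_min (by linarith) h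
    linarith

/-- The solution, reflected so that it decreases after its `i`-th critical point. -/
noncomputable def vb (u : ℝ → ℝ → ℝ) (i : ℕ) (α r : ℝ) : ℝ := (-1 : ℝ) ^ i * u α r

/-- The derivative of the reflected solution. -/
noncomputable def wb (u : ℝ → ℝ → ℝ) (i : ℕ) (α r : ℝ) : ℝ := (-1 : ℝ) ^ i * deriv (u α) r

theorem vb_succ (i : ℕ) (α r : ℝ) : vb u (i + 1) α r = -vb u i α r := by
  unfold vb; rw [pow_succ]; ring

theorem wb_succ (i : ℕ) (α r : ℝ) : wb u (i + 1) α r = -wb u i α r := by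
  unfold wb; rw [pow_succ]; ring

theorem vb_eq_zero {i : ℕ} {α r : ℝ} : vb u i α r = 0 ↔ u α r = 0 := by
  simp [vb]

theorem wb_eq_zero {i : ℕ} {α r : ℝ} : wb u i α r = 0 ↔ deriv (u α) r = 0 := by
  simp [wb]

theorem isSol_vb (H : Nonlin n f b β) (hu : Family n f u) {α : ℝ} (hα : 0 < α) (i : ℕ) :
    IsSol n f (vb u i α) (wb u i α) := by
  induction i with
  | zero =>
    have e1 : vb u 0 α = u α := by funext r; simp [vb]
    have e2 : wb u 0 α = deriv (u α) := by funext r; simp [wb]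
    rw [e1, e2]; exact hu.isSol hα
  | succ i ih =>
    have e1 : vb u (i + 1) α = fun r => -vb u i α r := funext (vb_succ i α)
    have e2 : wb u (i + 1) α = fun r => -wb u i α r := funext (wb_succ i α)
    rw [e1, e2]; exact ih.neg H

theorem continuousOn_vb (hu : Family n f u) (i : ℕ) :
    ContinuousOn (fun p : ℝ × ℝ => vb u i p.1 p.2) (Ioi 0 ×ˢ Ici 0) :=
  continuousOn_const.mul hu.2.1

theorem continuousOn_wb (hu : Family n f u) (i : ℕ) :
    ContinuousOn (fun p : ℝ × ℝ => wb u i p.1 p.2) (Ioi 0 ×ˢ Ici 0) :=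
  continuousOn_const.mul hu.2.2

theorem En_vb (H : Nonlin n f b β) (i : ℕ) (α : ℝ) :
    En f (vb u i α) (wb u i α) = En f (u α) (deriv (u α)) := by
  funext r
  unfold En vb wb
  rcases neg_one_pow_eq_or ℝ i with h | h
  · simp [h]
  · simp [h, H.F_neg]

theorem dist2_vb (i : ℕ) (α₁ α₂ r : ℝ) :
    dist2 (vb u i α₁) (wb u i α₁) (vb u i α₂) (wb u i α₂) r =
      dist2 (u α₁) (deriv (u α₁)) (u α₂) (deriv (u α₂)) r := by
  unfold dist2 vb wb
  rcases neg_one_pow_eq_or ℝ i with h | h <;> rw [h] <;> ring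

theorem first_zero {g : ℝ → ℝ} {Z : ℝ} (hg : ContinuousOn g (Ici Z)) (hZ : g Z < 0)
    (hr : ∃ r, Z < r ∧ 0 ≤ g r) :
    Z < sInf {r | Z < r ∧ g r = 0} ∧ g (sInf {r | Z < r ∧ g r = 0}) = 0 ∧
      ∀ r ∈ Ico Z (sInf {r | Z < r ∧ g r = 0}), g r < 0 := by
  obtain ⟨r₁, hr₁, h1⟩ := hr
  have ivt : ∀ r, Z < r → 0 ≤ g r → ∃ s, Z < s ∧ s ≤ r ∧ g s = 0 := by
    intro r hr h
    obtain ⟨s, hs, hs0⟩ := intermediate_value_Icc hr.le (hg.mono Icc_subset_Ici_self)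
      (show (0 : ℝ) ∈ Icc (g Z) (g r) from ⟨hZ.le, h⟩)
    refine ⟨s, hs.1.lt_of_ne ?_, hs.2, hs0⟩
    rintro rfl
    linarith
  set A := {r | Z < r ∧ g r = 0}
  obtain ⟨s₁, hs₁, -, hs₁'⟩ := ivt r₁ hr₁ h1
  have hA : A.Nonempty := ⟨s₁, hs₁, hs₁'⟩
  have hbd : BddBelow A := ⟨Z, fun r hr => hr.1.le⟩
  have hA' : A = Icc Z s₁ ∩ g ⁻¹' {0} ∪ A ∩ Ioi s₁ := by
    ext x
    simp only [A, mem_union, mem_inter_iff, mem_ofPred_eq, mem_Icc, mem_preimage,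
      mem_singleton_iff, mem_Ioi]
    constructor
    · rintro ⟨h1, h2⟩
      rcases le_or_gt x s₁ with h | h
      · exact Or.inl ⟨⟨h1.le, h⟩, h2⟩
      · exact Or.inr ⟨⟨h1, h2⟩, h⟩
    · rintro (⟨⟨h1, h2⟩, h3⟩ | ⟨h1, h2⟩)
      · refine ⟨h1.lt_of_ne ?_, h3⟩
        rintro rfl; linarith
      · exact h1
  have hcl : IsCompact (Icc Z s₁ ∩ g ⁻¹' {0}) :=
    isCompact_Icc.of_isClosed_subset ((hg.mono Icc_subset_Ici_self).preimage_isClosed_of_isClosed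
      isClosed_Icc isClosed_singleton) inter_subset_left
  obtain ⟨t, ⟨ht, ht0⟩, hmin⟩ := hcl.exists_isLeast ⟨s₁, ⟨hs₁.le, le_rfl⟩, hs₁'⟩
  have htA : t ∈ A := by rw [hA']; exact Or.inl ⟨ht, ht0⟩
  have hlow : ∀ x ∈ A, t ≤ x := by
    intro x hx
    rw [hA'] at hx
    rcases hx with hx | hx
    · exact hmin hx
    · exact ht.2.trans (le_of_lt hx.2)
  have hinf : sInf A = t := le_antisymm (csInf_le hbd htA) (le_csInf hA hlow)
  rw [hinf]
  refine ⟨htA.1, htA.2, fun r hr => ?_⟩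
  by_contra hc
  push Not at hc
  have hZr : Z < r := hr.1.lt_of_ne (by rintro rfl; linarith)
  obtain ⟨s, hs, hsr, hs0⟩ := ivt r hZr hc
  exact absurd (hlow s ⟨hs, hs0⟩) (not_le.2 (hsr.trans_lt hr.2))

theorem IsSol.tendsto_of_decreasing {v w : ℝ → ℝ} (S : IsSol n f v w) (H : Nonlin n f b β) {T : ℝ}
    (hT : 0 ≤ T) (hv : ∀ r, T < r → 0 < v r) (hw : ∀ r, T < r → w r < 0) :
    (∃ L ≥ 0, Tendsto v atTop (𝓝 L)) ∧ Tendsto w atTop (𝓝 0) := by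
  have hvA : AntitoneOn v (Ioi T) := by
    refine antitoneOn_of_deriv_nonpos (convex_Ioi T) (S.cont.mono fun r hr => (hT.trans_lt hr).le)
      ?_ ?_
    · rw [interior_Ioi]
      exact fun r hr => (S.d1 r (hT.trans_lt hr)).differentiableAt.differentiableWithinAt
    · rw [interior_Ioi]
      intro r hr
      rw [(S.d1 r (hT.trans_lt hr)).deriv]
      exact (hw r hr).le
  set g : ℝ → ℝ := fun r => v (max r (T + 1))
  set e : ℝ → ℝ := fun r => En f v w (max r (T + 1))
  have hmax : ∀ r : ℝ, T < max r (T + 1) := fun r => lt_max_of_lt_right (by linarith)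
  have hg : Antitone g := fun x y hxy => hvA (hmax x) (hmax y) (max_le_max_right _ hxy)
  have he : Antitone e := fun x y hxy =>
    S.En_antitoneOn H (hT.trans (hmax x).le) (hT.trans (hmax y).le) (max_le_max_right _ hxy)
  have hg0 : ∀ r, g r ∈ Icc 0 (v (T + 1)) := fun r =>
    ⟨(hv _ (hmax r)).le, hvA (by simp) (hmax r) (le_max_right _ _)⟩
  have tg := tendsto_atTop_ciInf hg ⟨0, by rintro _ ⟨r, rfl⟩; exact (hg0 r).1⟩
  obtain ⟨m, hm⟩ := (isCompact_Icc (a := 0) (b := v (T + 1))).bddBelow_image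
    H.continuous_F.continuousOn
  have te := tendsto_atTop_ciInf he ⟨m, by
    rintro _ ⟨r, rfl⟩
    have := hm ⟨_, hg0 r, rfl⟩
    simp only [e, En]
    have h2 : m ≤ Fint f (v (max r (T + 1))) := this
    nlinarith [sq_nonneg (w (max r (T + 1)))]⟩
  set L := ⨅ i, g i
  set eL := ⨅ i, e i
  have ev : ∀ᶠ r in atTop, max r (T + 1) = r := by
    filter_upwards [eventually_ge_atTop (T + 1)] with r hr using max_eq_left hr
  have tv : Tendsto v atTop (𝓝 L) := tg.congr' (by filter_upwards [ev] with r hr; simp only [g, hr])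
  have tE : Tendsto (En f v w) atTop (𝓝 eL) :=
    te.congr' (by filter_upwards [ev] with r hr; simp only [e, hr])
  have tw2 : Tendsto (fun r => w r ^ 2) atTop (𝓝 (2 * (eL - Fint f L))) := by
    refine ((tE.sub ((H.continuous_F.tendsto L).comp tv)).const_mul 2).congr fun r => ?_
    simp only [En, Function.comp]; ring
  have hL : 0 ≤ L := ge_of_tendsto' tg fun r => (hg0 r).1
  refine ⟨⟨L, hL, tv⟩, ?_⟩
  have hc : 2 * (eL - Fint f L) = 0 := by
    refine le_antisymm ?_ (ge_of_tendsto' tw2 fun r => sq_nonneg _)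
    by_contra hc
    push Not at hc
    set c := 2 * (eL - Fint f L)
    obtain ⟨R, hR⟩ := eventually_atTop.1 (tw2.eventually (lt_mem_nhds (half_lt_self hc)))
    set R' := max R (T + 1)
    have hR' : T < R' := hmax R
    set m := √(c / 2)
    have hm0 : 0 < m := Real.sqrt_pos.2 (by linarith)
    have hwm : ∀ r, R' ≤ r → w r ≤ -m := by
      intro r hr
      have h1 := hR r ((le_max_left _ _).trans hr)
      have h2 := hw r (hR'.trans_le hr)
      have h3 : m ≤ |w r| := by
        rw [← Real.sqrt_sq_eq_abs]; exact Real.sqrt_le_sqrt h1.le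
      rw [abs_of_neg h2] at h3; linarith
    set q := R' + v R' / m + 1
    have hvR := hv R' hR'
    have hq : R' ≤ q := by
      have : 0 ≤ v R' / m := by positivity
      simp only [q]; linarith
    have hmono : AntitoneOn (fun t => v t + m * t) (Icc R' q) := by
      refine antitoneOn_of_hasDerivAt_nonpos
        ((S.cont.mono fun t ht => (hT.trans_lt (hR'.trans_le ht.1)).le).add (by fun_prop))
        (fun t ht => (S.d1 t (hT.trans_lt (hR'.trans ht.1))).add ((hasDerivAt_id t).const_mul m))
        fun t ht => ?_
      have := hwm t ht.1.le
      linarith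
    have h1 := hmono ⟨le_rfl, hq⟩ ⟨hq, le_rfl⟩ hq
    simp only [q] at h1
    have h2 := hv q (hR'.trans_le hq)
    simp only [q] at h2
    have h3 : m * (R' + v R' / m + 1) = m * R' + v R' + m := by field_simp
    linarith
  rw [hc] at tw2
  have := (Real.continuous_sqrt.tendsto 0).comp tw2
  simp only [Real.sqrt_zero] at this
  rw [tendsto_zero_iff_abs_tendsto_zero]
  exact this.congr fun r => by simp [Function.comp, Real.sqrt_sq_eq_abs]

/-- Description of the solution between its `i`-th and `(i+1)`-st critical points. -/
structure Seg (u : ℝ → ℝ → ℝ) (i : ℕ) (α : ℝ) : Prop where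
  T_lt_Z : Tk u i α < Zk u (i + 1) α
  Z_lt_T : Zk u (i + 1) α < Tk u (i + 1) α
  slope : ∀ r ∈ Ioo (Tk u i α) (Tk u (i + 1) α), wb u i α r < 0
  zero : u α (Zk u (i + 1) α) = 0
  crit : deriv (u α) (Tk u (i + 1) α) = 0

/-- The solution has the expected shape up to its `i`-th critical point. -/
def Good (u : ℝ → ℝ → ℝ) (i : ℕ) (α : ℝ) : Prop := ∀ j < i, Seg u j α

theorem Tk_zero (α : ℝ) : Tk u 0 α = 0 := rfl
theorem Zk_succ (i : ℕ) (α : ℝ) :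
    Zk u (i + 1) α = sSup (ZsetAux u (i + 1) (Tk u i α) α) := rfl
theorem Tk_succ (i : ℕ) (α : ℝ) :
    Tk u (i + 1) α = sInf {r | Zk u (i + 1) α < r ∧ deriv (u α) r = 0} := rfl
theorem ZsetK_succ (i : ℕ) (α : ℝ) :
    ZsetK u (i + 1) α = ZsetAux u (i + 1) (Tk u i α) α := rfl

theorem Good.mono {i j : ℕ} {α : ℝ} (h : Good u i α) (hj : j ≤ i) : Good u j α :=
  fun m hm => h m (hm.trans_le hj)

theorem Good.succ {i : ℕ} {α : ℝ} (h : Good u i α) (hs : Seg u i α) : Good u (i + 1) α := by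
  intro j hj
  rcases (Nat.lt_succ_iff.1 hj).eq_or_lt with rfl | h'
  · exact hs
  · exact h j h'

theorem Good.T_nonneg {i : ℕ} {α : ℝ} (h : Good u i α) : 0 ≤ Tk u i α := by
  induction i with
  | zero => exact le_rfl
  | succ i ih =>
    have s := h i i.lt_succ_self
    linarith [ih (h.mono i.le_succ), s.T_lt_Z, s.Z_lt_T]

theorem Good.crit {i : ℕ} {α : ℝ} (h : Good u i α) (hu : Family n f u) (hα : 0 < α) :
    deriv (u α) (Tk u i α) = 0 := by
  cases i with
  | zero => exact (hu.isSol hα).d_zero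
  | succ i => exact (h i i.lt_succ_self).crit

theorem IsSol.strictAntiOn {v w : ℝ → ℝ} (S : IsSol n f v w) {x y : ℝ} (hx : 0 ≤ x)
    (hw : ∀ r ∈ Ioo x y, w r < 0) : StrictAntiOn v (Icc x y) :=
  strictAntiOn_of_hasDerivAt_neg (S.cont.mono fun _ ht => hx.trans ht.1)
    (fun _ ht => S.d1 _ (hx.trans_lt ht.1)) hw

theorem Seg.v_anti {i : ℕ} {α : ℝ} (s : Seg u i α) (h : Good u i α) (H : Nonlin n f b β)
    (hu : Family n f u) (hα : 0 < α) :
    StrictAntiOn (vb u i α) (Icc (Tk u i α) (Tk u (i + 1) α)) :=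
  (isSol_vb H hu hα i).strictAntiOn h.T_nonneg s.slope

theorem Good.top_pos {i : ℕ} {α : ℝ} (h : Good u i α) (H : Nonlin n f b β) (hu : Family n f u)
    (hα : 0 < α) : 0 < vb u i α (Tk u i α) := by
  cases i with
  | zero => simpa [vb, Tk_zero, hu.zero_val hα] using hα
  | succ i =>
    have s := h i i.lt_succ_self
    have := s.v_anti (h.mono i.le_succ) H hu hα ⟨s.T_lt_Z.le, s.Z_lt_T.le⟩
      ⟨(s.T_lt_Z.trans s.Z_lt_T).le, le_rfl⟩ s.Z_lt_T
    rw [vb_eq_zero.2 s.zero] at this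
    rw [vb_succ]; linarith

theorem mem_ZsetAux_iff {i : ℕ} {T α r : ℝ} :
    r ∈ ZsetAux u (i + 1) T α ↔ T < r ∧ ∀ s ∈ Ioo T r, 0 < vb u i α s ∧ wb u i α s < 0 := by
  unfold ZsetAux
  rw [mem_ofPred_eq]
  refine and_congr_right fun _ => forall₂_congr fun s _ => ?_
  have e1 := vb_succ (u := u) i α s
  have e2 := wb_succ (u := u) i α s
  unfold vb wb at *
  rw [e1, e2, neg_lt_zero, neg_pos]

theorem ZsetAux_eq_Ioc {i : ℕ} {T ζ α : ℝ} (h0 : T < ζ) (hz : vb u i α ζ = 0)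
    (hv : ∀ s ∈ Ioo T ζ, 0 < vb u i α s) (hw : ∀ s ∈ Ioo T ζ, wb u i α s < 0) :
    ZsetAux u (i + 1) T α = Ioc T ζ := by
  ext r
  rw [mem_ZsetAux_iff]
  refine and_congr_right fun hr => ⟨fun h => ?_, fun h s hs => ?_⟩
  · by_contra hc
    have := (h ζ ⟨h0, not_le.1 hc⟩).1
    linarith
  · exact ⟨hv s ⟨hs.1, hs.2.trans_le h⟩, hw s ⟨hs.1, hs.2.trans_le h⟩⟩

theorem Good.build {i : ℕ} {α ζ τ : ℝ} (h : Good u i α) (H : Nonlin n f b β)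
    (hu : Family n f u) (hα : 0 < α) (h1 : Tk u i α < ζ) (h2 : ζ < τ)
    (hw : ∀ r ∈ Ioo (Tk u i α) τ, wb u i α r < 0) (hz : u α ζ = 0) (hτ : deriv (u α) τ = 0) :
    Zk u (i + 1) α = ζ ∧ Tk u (i + 1) α = τ ∧ Seg u i α := by
  have hva := (isSol_vb H hu hα i).strictAntiOn h.T_nonneg hw
  have hvz : vb u i α ζ = 0 := vb_eq_zero.2 hz
  have hset := ZsetAux_eq_Ioc (u := u) (i := i) h1 hvz (fun s hs => by
    rw [← hvz]
    exact hva ⟨hs.1.le, (hs.2.trans h2).le⟩ ⟨h1.le, h2.le⟩ hs.2)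
    (fun s hs => hw s ⟨hs.1, hs.2.trans h2⟩)
  have eZ : Zk u (i + 1) α = ζ := by rw [Zk_succ, hset, csSup_Ioc h1]
  have eT : Tk u (i + 1) α = τ := by
    rw [Tk_succ, eZ]
    refine le_antisymm (csInf_le ⟨ζ, fun r hr => hr.1.le⟩ ⟨h2, hτ⟩)
      (le_csInf ⟨τ, h2, hτ⟩ fun r hr => ?_)
    by_contra hc
    have := hw r ⟨h1.trans hr.1, not_le.1 hc⟩
    rw [wb_eq_zero.2 hr.2] at this
    exact lt_irrefl _ this
  exact ⟨eZ, eT, by rw [eZ]; exact h1, by rw [eZ, eT]; exact h2, by rw [eT]; exact hw,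
    by rw [eZ]; exact hz, by rw [eT]; exact hτ⟩

/-- On the last branch, before `Z`, the solution is positive and decreasing. -/
theorem ZsetK_props {i : ℕ} {α s r : ℝ} (hr : r ∈ ZsetK u (i + 1) α)
    (hs : s ∈ Ioo (Tk u i α) r) : 0 < vb u i α s ∧ wb u i α s < 0 :=
  (mem_ZsetAux_iff.1 hr).2 s hs

theorem ZsetK_props_of_lt_Z {i : ℕ} {α s : ℝ} (hne : (ZsetK u (i + 1) α).Nonempty)
    (h1 : Tk u i α < s) (h2 : s < Zk u (i + 1) α) : 0 < vb u i α s ∧ wb u i α s < 0 := by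
  obtain ⟨r, hr, hsr⟩ := exists_lt_of_lt_csSup hne h2
  exact ZsetK_props hr ⟨h1, hsr⟩

theorem ZsetK_props_of_unbounded {i : ℕ} {α s : ℝ} (hb : ¬BddAbove (ZsetK u (i + 1) α))
    (h1 : Tk u i α < s) : 0 < vb u i α s ∧ wb u i α s < 0 := by
  rw [not_bddAbove_iff] at hb
  obtain ⟨r, hr, hsr⟩ := hb s
  exact ZsetK_props hr ⟨h1, hsr⟩

theorem ZsetK_nonempty_of_uAtZ {i : ℕ} {α : ℝ} (hu : Family n f u) (hα : 0 < α)
    (h : uAtZ u (i + 1) α = 0) : (ZsetK u (i + 1) α).Nonempty := by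
  by_contra hc
  rw [not_nonempty_iff_eq_empty] at hc
  have hz : Zk u (i + 1) α = 0 := by
    rw [Zk_succ, ← ZsetK_succ, hc, Real.sSup_empty]
  unfold uAtZ at h
  rw [hc, if_pos bddAbove_empty, hz, hu.zero_val hα] at h
  exact hα.ne' h

theorem ZsetK_lt_Z {i : ℕ} {α : ℝ} (hne : (ZsetK u (i + 1) α).Nonempty)
    (hb : BddAbove (ZsetK u (i + 1) α)) : Tk u i α < Zk u (i + 1) α := by
  obtain ⟨r, hr⟩ := hne
  exact (mem_ZsetAux_iff.1 hr).1.trans_le (le_csSup hb hr)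

theorem limUnder_wb_zero {i : ℕ} {α : ℝ} (h : Good u i α) (H : Nonlin n f b β)
    (hu : Family n f u) (hα : 0 < α) (hb : ¬BddAbove (ZsetK u (i + 1) α)) :
    (∃ L ≥ 0, Tendsto (vb u i α) atTop (𝓝 L)) ∧ Tendsto (wb u i α) atTop (𝓝 0) :=
  (isSol_vb H hu hα i).tendsto_of_decreasing H h.T_nonneg
    (fun _ hr => (ZsetK_props_of_unbounded hb hr).1)
    (fun _ hr => (ZsetK_props_of_unbounded hb hr).2)

theorem tendsto_of_vb {i : ℕ} {α L : ℝ} (h : Tendsto (vb u i α) atTop (𝓝 L)) :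
    Tendsto (u α) atTop (𝓝 ((-1) ^ i * L)) := by
  refine (h.const_mul ((-1) ^ i)).congr fun r => ?_
  unfold vb; rw [← mul_assoc, ← mul_pow]; simp

theorem tendsto_of_wb {i : ℕ} {α L : ℝ} (h : Tendsto (wb u i α) atTop (𝓝 L)) :
    Tendsto (deriv (u α)) atTop (𝓝 ((-1) ^ i * L)) := by
  refine (h.const_mul ((-1) ^ i)).congr fun r => ?_
  unfold wb; rw [← mul_assoc, ← mul_pow]; simp

theorem bddAbove_of_duAtZ {i : ℕ} {α : ℝ} (h : Good u i α) (H : Nonlin n f b β)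
    (hu : Family n f u) (hα : 0 < α) (hd : duAtZ u (i + 1) α ≠ 0) :
    BddAbove (ZsetK u (i + 1) α) := by
  by_contra hb
  apply hd
  unfold duAtZ
  rw [if_neg hb]
  simpa using (tendsto_of_wb (limUnder_wb_zero h H hu hα hb).2).limUnder_eq

theorem Nk_pos {i : ℕ} {α : ℝ} (h : α ∈ Nk u i) : 0 < α := by
  induction i using Nat.twoStepInduction with
  | zero => exact h
  | one => exact h.1
  | more i _ ih => exact ih h.1

theorem Nk_succ_iff {i : ℕ} {α : ℝ} : α ∈ Nk u (i + 1) ↔ α ∈ Nk u i ∧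
    (i ≠ 0 → ¬Ftil u (i + 1) α) ∧ uAtZ u (i + 1) α = 0 ∧ (-1) ^ i * duAtZ u (i + 1) α < 0 := by
  cases i with
  | zero => simp [Nk]
  | succ i =>
    have e : (-1 : ℝ) ^ (i + 2) = -(-1) ^ (i + 1) := by rw [pow_succ]; ring
    simp only [Nk, mem_ofPred_eq, e, neg_mul, neg_pos, ne_eq, Nat.add_one_ne_zero,
      not_false_eq_true, forall_const]

theorem Gk_succ_iff {i : ℕ} {α : ℝ} : α ∈ Gk u (i + 1) ↔ α ∈ Nk u i ∧
    (i ≠ 0 → ¬Ftil u (i + 1) α) ∧ uAtZ u (i + 1) α = 0 ∧ duAtZ u (i + 1) α = 0 := by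
  cases i with
  | zero => simp [Nk, Gk]
  | succ i =>
    simp only [Gk, mem_ofPred_eq, ne_eq, Nat.add_one_ne_zero, not_false_eq_true, forall_const]

theorem seg_of_mem {i : ℕ} {α : ℝ} (h : Good u i α) (H : Nonlin n f b β) (hu : Family n f u)
    (hN : α ∈ Nk u (i + 1)) (hF : ¬Ftil u (i + 2) α) : Seg u i α := by
  have hα := Nk_pos hN
  obtain ⟨-, -, hu0, hdu⟩ := Nk_succ_iff.1 hN
  have hd : duAtZ u (i + 1) α ≠ 0 := by intro h0; rw [h0, mul_zero] at hdu; exact lt_irrefl _ hdu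
  have hb := bddAbove_of_duAtZ h H hu hα hd
  have hne := ZsetK_nonempty_of_uAtZ hu hα hu0
  have hTZ := ZsetK_lt_Z hne hb
  unfold uAtZ at hu0
  unfold duAtZ at hdu
  rw [if_pos hb] at hu0 hdu
  have hZ0 : 0 ≤ Zk u (i + 1) α := h.T_nonneg.trans hTZ.le
  have hex : ∃ r, Zk u (i + 1) α < r ∧ 0 ≤ wb u i α r := by
    unfold Ftil at hF
    push Not at hF
    obtain ⟨r, hr, h0⟩ := hF
    refine ⟨r, hr, ?_⟩
    have e := (wb_succ (u := u) (i + 1) α r).trans (congrArg Neg.neg (wb_succ (u := u) i α r))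
    rw [neg_neg] at e
    rw [← e]; exact h0
  obtain ⟨f1, f2, f3⟩ := first_zero
    ((isSol_vb H hu hα i).dcont.mono (Ici_subset_Ici.2 hZ0)) hdu hex
  have e : {r | Zk u (i + 1) α < r ∧ wb u i α r = 0} =
      {r | Zk u (i + 1) α < r ∧ deriv (u α) r = 0} := by
    ext r; simp only [mem_ofPred_eq, wb_eq_zero]
  rw [e, ← Tk_succ] at f1 f2 f3
  refine ⟨hTZ, f1, fun r hr => ?_, hu0, wb_eq_zero.1 f2⟩
  rcases lt_or_ge r (Zk u (i + 1) α) with h' | h'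
  · exact (ZsetK_props_of_lt_Z hne hr.1 h').2
  · exact f3 r ⟨h', hr.2⟩

theorem good_of_mem (H : Nonlin n f b β) (hu : Family n f u) {i : ℕ} {α : ℝ} (hN : α ∈ Nk u i)
    (hF : i ≠ 0 → ¬Ftil u (i + 1) α) : Good u i α := by
  induction i with
  | zero => exact fun j hj => absurd hj (Nat.not_lt_zero j)
  | succ i ih =>
    obtain ⟨h1, h2, -⟩ := Nk_succ_iff.1 hN
    have g := ih h1 h2
    exact g.succ (seg_of_mem g H hu hN (hF i.succ_ne_zero))

theorem Good.mem (H : Nonlin n f b β) (hu : Family n f u) {i : ℕ} {α : ℝ} (h : Good u i α)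
    (hα : 0 < α) : α ∈ Nk u i ∧ (i ≠ 0 → ¬Ftil u (i + 1) α) := by
  induction i with
  | zero => exact ⟨hα, fun h => absurd rfl h⟩
  | succ i ih =>
    have g := h.mono i.le_succ
    have s := h i i.lt_succ_self
    obtain ⟨h1, h2⟩ := ih g
    have hva := s.v_anti g H hu hα
    have hvz : vb u i α (Zk u (i + 1) α) = 0 := vb_eq_zero.2 s.zero
    have hset := ZsetAux_eq_Ioc (u := u) (i := i) s.T_lt_Z hvz (fun r hr => by
      rw [← hvz]
      exact hva ⟨hr.1.le, (hr.2.trans s.Z_lt_T).le⟩ ⟨s.T_lt_Z.le, s.Z_lt_T.le⟩ hr.2)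
      (fun r hr => s.slope r ⟨hr.1, hr.2.trans s.Z_lt_T⟩)
    have hb : BddAbove (ZsetK u (i + 1) α) := by rw [ZsetK_succ, hset]; exact bddAbove_Ioc
    refine ⟨Nk_succ_iff.2 ⟨h1, h2, ?_, ?_⟩, fun _ hF => ?_⟩
    · unfold uAtZ; rw [if_pos hb]; exact s.zero
    · unfold duAtZ; rw [if_pos hb]; exact s.slope _ ⟨s.T_lt_Z, s.Z_lt_T⟩
    · have := hF (Tk u (i + 1) α) s.Z_lt_T
      rw [s.crit, mul_zero] at this
      exact lt_irrefl _ this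

/-- Uniform concavity of nearby solutions around a maximum above `β`. -/
theorem zone (H : Nonlin n f b β) (hu : Family n f u) (hα : 0 < αs) (i : ℕ) {T : ℝ} (hT : 0 ≤ T)
    (hv : β < vb u i αs T) (hw : wb u i αs T = 0) :
    ∃ β' > β, ∃ κ > 0, ∃ η > 0, ∀ᶠ α in 𝓝 αs, ∀ r, 0 < r → |r - T| ≤ η →
      β' < vb u i α r ∧ -(((n : ℝ) - 1) / r * wb u i α r) - f (vb u i α r) ≤ -κ := by
  have hm := H.one_le
  set v₀ := vb u i αs T
  have hf0 : 0 < f v₀ := H.f_pos (H.b_lt.trans hv)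
  have hn : (0 : ℝ) < n := by linarith
  set θ := f v₀ / (4 * n) with hθdef
  have hθ : 0 < θ := by positivity
  have hθn : θ * (4 * n) = f v₀ := by rw [hθdef]; field_simp
  refine ⟨(β + v₀) / 2, by linarith, f v₀ / (2 * n), by positivity, ?_⟩
  have hO : Ioi ((β + v₀) / 2) ∩ f ⁻¹' Ioo (f v₀ - θ) (f v₀ + θ) ∈ 𝓝 v₀ :=
    inter_mem (Ioi_mem_nhds (by linarith))
      (H.cont.continuousAt (Ioo_mem_nhds (by linarith) (by linarith)))
  obtain ⟨η₁, hη₁, h1⟩ := eventually_near (continuousOn_vb hu i) hα hT hO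
  have hκ : f v₀ / (2 * n) = 2 * θ := by rw [hθdef]; field_simp; norm_num
  rcases hT.eq_or_lt with rfl | hT
  · refine ⟨η₁, hη₁, ?_⟩
    filter_upwards [h1, Ioi_mem_nhds hα] with α h hα' r hr hrη
    have S := isSol_vb H hu hα' i
    have hrη' : r ≤ η₁ := by rw [sub_zero, abs_of_pos hr] at hrη; exact hrη
    obtain ⟨a1, a2, a3⟩ := h r hr.le hrη
    refine ⟨a1, ?_⟩
    set M := f v₀ + θ
    have hmono : MonotoneOn (fun t => t ^ (n - 1) * wb u i α t + M / n * t ^ n) (Icc 0 r) := by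
      refine monotoneOn_of_hasDerivAt_nonneg
        (((by fun_prop : ContinuousOn (fun t : ℝ => t ^ (n - 1)) (Icc 0 r)).mul
          (S.dcont.mono fun t ht => ht.1)).add (by fun_prop))
        (fun t ht => ((hasDerivAt_pow (n - 1) t).mul (S.d2 t ht.1)).add
          ((hasDerivAt_pow n t).const_mul (M / n))) fun t ht => ?_
      have hft := (h t ht.1.le (by rw [sub_zero, abs_of_pos ht.1]; linarith [ht.2])).2.2
      have ht0 := ht.1
      obtain ⟨m, rfl⟩ : ∃ m, n = m + 2 := ⟨n - 2, by have := H.two_le; omega⟩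
      have e : ((m + 2 - 1 : ℕ) : ℝ) * t ^ (m + 2 - 1 - 1) * wb u i α t + t ^ (m + 2 - 1) *
          (-((((m + 2 : ℕ) : ℝ) - 1) / t * wb u i α t) - f (vb u i α t)) +
          M / ((m + 2 : ℕ) : ℝ) * (((m + 2 : ℕ) : ℝ) * t ^ (m + 2 - 1)) =
          t ^ (m + 1) * (M - f (vb u i α t)) := by
        have : ((m + 2 : ℕ) : ℝ) ≠ 0 := by positivity
        simp only [Nat.add_one_sub_one, show m + 2 - 1 = m + 1 from rfl]
        push_cast
        push_cast at this
        field_simp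
        ring
      rw [e]
      have : 0 ≤ M - f (vb u i α t) := by have : f (vb u i α t) < M := hft; linarith
      positivity
    have h0 := hmono ⟨le_rfl, hr.le⟩ ⟨hr.le, le_rfl⟩ hr.le
    simp only [S.d_zero, mul_zero] at h0
    have hn0 : n ≠ 0 := by have := H.two_le; omega
    rw [zero_pow hn0, mul_zero, add_zero] at h0
    have e : r ^ n = r ^ (n - 1) * r := by rw [← pow_succ]; congr 1; omega
    rw [e] at h0
    have hp : 0 < r ^ (n - 1) := pow_pos hr _
    have h2 : -wb u i α r ≤ M / n * r := by
      have : 0 ≤ r ^ (n - 1) * (wb u i α r + M / n * r) := by linarith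
      have := nonneg_of_mul_nonneg_right this hp
      linarith
    have h3 : -(((n : ℝ) - 1) / r * wb u i α r) ≤ ((n : ℝ) - 1) / n * M := by
      have : ((n : ℝ) - 1) / r * -wb u i α r ≤ ((n : ℝ) - 1) / r * (M / n * r) :=
        mul_le_mul_of_nonneg_left h2 (div_nonneg (by linarith) hr.le)
      have e2 : ((n : ℝ) - 1) / r * (M / n * r) = ((n : ℝ) - 1) / n * M := by field_simp
      linarith
    have h4 : ((n : ℝ) - 1) / n * M = M - M / n := by field_simp
    have h5 : M / n = 4 * θ + θ / n := by
      simp only [M]; rw [← hθn]; field_simp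
    have h6 : 0 < θ / n := by positivity
    rw [hκ]
    linarith
  · set ε := θ * T / (2 * (n - 1)) with hε
    have hε0 : 0 < ε := by
      have : (0 : ℝ) < n - 1 := by linarith
      positivity
    obtain ⟨η₂, hη₂, h2⟩ := eventually_near (continuousOn_wb hu i) hα hT.le
      (O := Ioo (-ε) ε) (by simp only [hw]; exact Ioo_mem_nhds (by linarith) hε0)
    refine ⟨min η₁ (min η₂ (T / 2)), by positivity, ?_⟩
    filter_upwards [h1, h2] with α h h' r hr hrη
    obtain ⟨a1, a2, a3⟩ := h r hr.le (hrη.trans (min_le_left _ _))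
    obtain ⟨c1, -⟩ := h' r hr.le (hrη.trans ((min_le_right _ _).trans (min_le_left _ _)))
    have hr2 : T / 2 ≤ r := by
      have := (abs_le.1 (hrη.trans ((min_le_right _ _).trans (min_le_right _ _)))).1
      linarith
    refine ⟨a1, ?_⟩
    have h3 : ((n : ℝ) - 1) / r ≤ ((n : ℝ) - 1) / (T / 2) :=
      div_le_div_of_nonneg_left (by linarith) (by positivity) hr2
    have h4 : 0 ≤ ((n : ℝ) - 1) / r := div_nonneg (by linarith) hr.le
    have h5 : -(((n : ℝ) - 1) / r * wb u i α r) ≤ θ := by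
      have e : ((n : ℝ) - 1) / (T / 2) * ε = θ := by
        have : (n : ℝ) - 1 ≠ 0 := by linarith
        rw [hε]; field_simp
      have q1 : ((n : ℝ) - 1) / r * -wb u i α r ≤ ((n : ℝ) - 1) / r * ε :=
        mul_le_mul_of_nonneg_left (by linarith) h4
      have q2 := mul_le_mul_of_nonneg_right h3 hε0.le
      linarith
    have h6 : 4 * θ * 2 ≤ f v₀ := by nlinarith
    rw [hκ]
    linarith

/-- In a concavity zone, the slope is strictly decreasing. -/
theorem IsSol.slope_strictAntiOn {v w : ℝ → ℝ} (S : IsSol n f v w) {x y κ : ℝ} (hκ : 0 < κ)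
    (hx : 0 ≤ x) (h : ∀ r ∈ Ioo x y, -(((n : ℝ) - 1) / r * w r) - f (v r) ≤ -κ) :
    StrictAntiOn w (Icc x y) :=
  strictAntiOn_of_hasDerivAt_neg (S.dcont.mono fun _ ht => hx.trans ht.1)
    (fun t ht => S.d2 t (hx.trans_lt ht.1)) fun t ht => (h t ht).trans_lt (by linarith)

theorem Good.top_gt {i : ℕ} {α : ℝ} (h : Good u i α) (H : Nonlin n f b β) (hu : Family n f u)
    (hα : 0 < α) (hE : 0 < En f (u α) (deriv (u α)) (Tk u i α)) : β < vb u i α (Tk u i α) := by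
  rw [← En_vb H i] at hE
  unfold En at hE
  rw [wb_eq_zero.2 (h.crit hu hα)] at hE
  have := H.abs_gt_of_F_pos (s := vb u i α (Tk u i α)) (by linarith)
  rwa [abs_of_pos (h.top_pos H hu hα)] at this

theorem good_perturb_succ (H : Nonlin n f b β) (hu : Family n f u) (hα : 0 < αs) {i : ℕ}
    (hg : Good u (i + 1) αs) (hv : β < vb u i αs (Tk u i αs))
    (hv' : β < vb u (i + 1) αs (Tk u (i + 1) αs))
    (hev : ∀ᶠ α in 𝓝 αs, Good u i α) (hT : Tendsto (Tk u i) (𝓝 αs) (𝓝 (Tk u i αs))) :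
    (∀ᶠ α in 𝓝 αs, Good u (i + 1) α) ∧
      Tendsto (Tk u (i + 1)) (𝓝 αs) (𝓝 (Tk u (i + 1) αs)) := by
  have g := hg.mono i.le_succ
  have s := hg i i.lt_succ_self
  have hT0 := g.T_nonneg
  have hTZ := s.T_lt_Z
  have hZT := s.Z_lt_T
  set T := Tk u i αs
  set Z := Zk u (i + 1) αs
  set T' := Tk u (i + 1) αs
  obtain ⟨_, _, κ₁, hκ₁, η₁, hη₁, z1⟩ := zone H hu hα i hT0 hv (wb_eq_zero.2 (g.crit hu hα))
  obtain ⟨_, _, κ₂, hκ₂, η₂, hη₂, z2⟩ := zone H hu hα (i + 1) (hT0.trans (hTZ.trans hZT).le) hv'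
    (wb_eq_zero.2 s.crit)
  have S := isSol_vb H hu hα i
  have hva := s.v_anti g H hu hα
  have key : ∀ η > 0, η ≤ η₂ → η < T' - Z → η < Z - T → η ≤ η₁ →
      ∀ᶠ α in 𝓝 αs, Good u (i + 1) α ∧ |Tk u (i + 1) α - T'| < η := by
    intro η hη e1 e2 e3 e4
    have hTT : T + η < T' - η := by linarith
    -- slopes of the reference solution
    have c1 : ∀ r ∈ Icc (T + η / 2) (T' - η / 2), 0 < -wb u i αs r := fun r hr =>
      neg_pos.2 (s.slope r ⟨by linarith [hr.1], by linarith [hr.2]⟩)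
    have c2 : wb u i αs (T' + η / 2) > 0 := by
      have z := z2.self_of_nhds
      have := (isSol_vb H hu hα (i + 1)).slope_strictAntiOn (x := T') (y := T' + η / 2) hκ₂
        (by linarith) (fun r hr => (z r (by linarith [hr.1])
          (abs_le.2 ⟨by linarith [hr.1], by linarith [hr.2]⟩)).2)
        ⟨le_rfl, by linarith⟩ ⟨by linarith, le_rfl⟩ (by linarith)
      rw [wb_eq_zero.2 s.crit, wb_succ] at this
      linarith
    have c3 : vb u i αs (T' - η / 2) < 0 := by
      rw [← vb_eq_zero (i := i) |>.2 s.zero]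
      exact hva ⟨by linarith, by linarith⟩ ⟨by linarith, by linarith⟩ (by linarith)
    have d1 := eventually_on_Icc (g := fun p => -wb u i p.1 p.2) (continuousOn_wb hu i).neg hα
      (by linarith) c1
    have d2 := eventually_on_Icc (g := fun p => wb u i p.1 p.2) (A := T' + η / 2) (B := T' + η / 2)
      (continuousOn_wb hu i) hα (by linarith) (by
        intro r hr
        obtain rfl : r = T' + η / 2 := le_antisymm hr.2 hr.1
        exact c2)
    have d3 := eventually_on_Icc (g := fun p => -vb u i p.1 p.2) (A := T' - η / 2) (B := T' - η / 2)
      (continuousOn_vb hu i).neg hα (by linarith) (by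
        intro r hr
        obtain rfl : r = T' - η / 2 := le_antisymm hr.2 hr.1
        exact neg_pos.2 c3)
    have d4 : ∀ᶠ α in 𝓝 αs, |Tk u i α - T| < η / 2 := by
      have := hT (Metric.ball_mem_nhds T (half_pos hη))
      filter_upwards [this] with α h
      simpa [Real.dist_eq] using h
    filter_upwards [d1, d2, d3, d4, z1, z2, hev, Ioi_mem_nhds hα] with α d1 d2 d3 d4 z1 z2 ga hα'
    have Sα := isSol_vb H hu hα' i
    have hT0' := ga.T_nonneg
    rw [abs_lt] at d4
    have d2' := d2 _ ⟨le_rfl, le_rfl⟩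
    have d3' := d3 _ ⟨le_rfl, le_rfl⟩
    -- the critical point
    obtain ⟨τ, hτ, hτ0⟩ := intermediate_value_Icc (show T' - η / 2 ≤ T' + η / 2 by linarith)
      (Sα.dcont.mono fun t ht => (show (0 : ℝ) ≤ t by linarith [ht.1]))
      (show (0 : ℝ) ∈ Icc _ _ from ⟨by
        have := d1 (T' - η / 2) ⟨by linarith, le_rfl⟩; linarith, d2'.le⟩)
    have hτ1 : T' - η / 2 < τ := hτ.1.lt_of_ne (by
      rintro rfl
      have := d1 (T' - η / 2) ⟨by linarith, le_rfl⟩; linarith)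
    have hsl : ∀ r ∈ Ioo (Tk u i α) τ, wb u i α r < 0 := by
      intro r hr
      rcases le_or_gt r (T + η / 2) with h | h
      · have := Sα.slope_strictAntiOn (x := Tk u i α) (y := r) hκ₁ hT0'
          (fun q hq => (z1 q (by linarith [hq.1])
            (abs_le.2 ⟨by linarith [hq.1], by linarith [hq.2]⟩)).2)
          ⟨le_rfl, hr.1.le⟩ ⟨hr.1.le, le_rfl⟩ hr.1
        rwa [wb_eq_zero.2 (ga.crit hu hα')] at this
      rcases le_or_gt r (T' - η / 2) with h' | h'
      · have := d1 r ⟨h.le, h'⟩; linarith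
      · have := (isSol_vb H hu hα' (i + 1)).slope_strictAntiOn (x := r) (y := τ) hκ₂
          (by linarith) (fun q hq => (z2 q (by linarith [hq.1])
            (abs_le.2 ⟨by linarith [hq.1], by linarith [hq.2, hτ.2]⟩)).2)
          ⟨le_rfl, hr.2.le⟩ ⟨hr.2.le, le_rfl⟩ hr.2
        rw [wb_succ, wb_succ, hτ0] at this
        linarith
    -- the zero
    obtain ⟨ζ, hζ, hζ0⟩ := intermediate_value_Icc' (f := vb u i α)
      (show Tk u i α ≤ T' - η / 2 by linarith)
      (Sα.cont.mono fun t ht => hT0'.trans ht.1)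
      (show (0 : ℝ) ∈ Icc _ _ from ⟨by linarith, (ga.top_pos H hu hα').le⟩)
    have hζ1 : Tk u i α < ζ := hζ.1.lt_of_ne (by
      rintro rfl
      have := ga.top_pos H hu hα'; linarith)
    obtain ⟨-, b2, b3⟩ := ga.build H hu hα' hζ1 (hζ.2.trans_lt hτ1) hsl (vb_eq_zero.1 hζ0)
      (wb_eq_zero.1 hτ0)
    refine ⟨ga.succ b3, ?_⟩
    rw [b2, abs_lt]
    constructor <;> linarith [hτ.2]
  set η₀ := min (min η₁ η₂) (min ((T' - Z) / 2) ((Z - T) / 2))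
  have hη₀ : 0 < η₀ := by
    have : 0 < T' - Z := by linarith
    have : 0 < Z - T := by linarith
    positivity
  have q1 : η₀ ≤ η₁ := (min_le_left _ _).trans (min_le_left _ _)
  have q2 : η₀ ≤ η₂ := (min_le_left _ _).trans (min_le_right _ _)
  have q3 : η₀ ≤ (T' - Z) / 2 := (min_le_right _ _).trans (min_le_left _ _)
  have q4 : η₀ ≤ (Z - T) / 2 := (min_le_right _ _).trans (min_le_right _ _)
  have base : ∀ ε > 0, ∀ᶠ α in 𝓝 αs, Good u (i + 1) α ∧ |Tk u (i + 1) α - T'| < min ε η₀ := by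
    intro ε hε
    have q0 : min ε η₀ ≤ η₀ := min_le_right _ _
    exact key (min ε η₀) (by positivity) (by linarith) (by linarith) (by linarith) (by linarith)
  refine ⟨(base 1 one_pos).mono fun α h => h.1, Metric.tendsto_nhds.2 fun ε hε => ?_⟩
  filter_upwards [base ε hε] with α h
  rw [Real.dist_eq]
  exact h.2.trans_le (min_le_left _ _)

theorem good_perturb (H : Nonlin n f b β) (hu : Family n f u) (hα : 0 < αs) {i : ℕ}
    (hg : Good u i αs) (hv : ∀ j ≤ i, β < vb u j αs (Tk u j αs)) :
    (∀ᶠ α in 𝓝 αs, Good u i α) ∧ Tendsto (Tk u i) (𝓝 αs) (𝓝 (Tk u i αs)) := by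
  induction i with
  | zero =>
    refine ⟨Eventually.of_forall fun α j hj => absurd hj (Nat.not_lt_zero j), ?_⟩
    have : Tk u 0 = fun _ => 0 := rfl
    rw [this]; exact tendsto_const_nhds
  | succ i ih =>
    obtain ⟨h1, h2⟩ := ih (hg.mono i.le_succ) fun j hj => hv j (hj.trans i.le_succ)
    exact good_perturb_succ H hu hα hg (hv i i.le_succ) (hv _ le_rfl) h1 h2

theorem mul_le_sub_of_le_hasDerivAt {g g' : ℝ → ℝ} {x y m : ℝ} (hxy : x ≤ y)
    (hc : ContinuousOn g (Icc x y)) (hd : ∀ t ∈ Ioo x y, HasDerivAt g (g' t) t)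
    (h : ∀ t ∈ Ioo x y, m ≤ g' t) : m * (y - x) ≤ g y - g x := by
  have := monotoneOn_of_hasDerivAt_nonneg (g := fun t => g t - m * t)
    (hc.sub (by fun_prop)) (fun t ht => (hd t ht).sub ((hasDerivAt_id t).const_mul m))
    (fun t ht => by linarith [h t ht]) (left_mem_Icc.2 hxy) (right_mem_Icc.2 hxy) hxy
  simp only at this
  linarith

/-- Two-sided first order bounds on the difference of nearby solutions. -/
theorem BiLip.bounds {R : ℝ} (h : BiLip u αs R) (i : ℕ) :
    ∃ C > 0, ∀ᶠ p : ℝ × ℝ in 𝓝 (αs, αs), p.1 < p.2 → ∀ r ∈ Icc 0 R,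
      |vb u i p.2 r - vb u i p.1 r| ≤ C * (p.2 - p.1) ∧
      |wb u i p.2 r - wb u i p.1 r| ≤ C * (p.2 - p.1) ∧
      p.2 - p.1 ≤ C * (|vb u i p.2 r - vb u i p.1 r| + |wb u i p.2 r - wb u i p.1 r|) := by
  obtain ⟨C, hC, h⟩ := h
  refine ⟨√C, Real.sqrt_pos.2 hC, ?_⟩
  filter_upwards [h] with p hp hlt r hr
  have hΔ : 0 < p.2 - p.1 := sub_pos.2 hlt
  obtain ⟨h1, h2⟩ := hp r hr
  rw [← dist2_vb i] at h1 h2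
  unfold dist2 at h1 h2
  have hs := Real.sq_sqrt hC.le
  have hs0 := Real.sqrt_pos.2 hC
  set A := vb u i p.2 r - vb u i p.1 r
  set B := wb u i p.2 r - wb u i p.1 r
  refine ⟨abs_le_of_sq_le_sq (by rw [mul_pow, hs]; nlinarith [sq_nonneg B]) (by positivity),
    abs_le_of_sq_le_sq (by rw [mul_pow, hs]; nlinarith [sq_nonneg A]) (by positivity), ?_⟩
  refine le_of_sq_le_sq ?_ (by positivity)
  rw [mul_pow, hs]
  refine h2.trans (mul_le_mul_of_nonneg_left ?_ hC.le)
  nlinarith [sq_abs A, sq_abs B, mul_nonneg (abs_nonneg A) (abs_nonneg B)]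

/-- `Q` decreases along a solution staying above `β`. -/
theorem IsSol.Q_le {v w : ℝ → ℝ} (S : IsSol n f v w) (H : Nonlin n f b β) {x y : ℝ} (hx : 0 ≤ x)
    (hxy : x ≤ y) (hv : ∀ r ∈ Icc x y, β ≤ v r) (hv' : ∀ r ∈ Ioo x y, β < v r) :
    Qv n f β y (v y) (w y) ≤ Qv n f β x (v x) (w x) := by
  have hsub : Icc x y ⊆ Ici 0 := fun t ht => hx.trans ht.1
  have hmap : MapsTo v (Icc x y) (Ioi b) := fun t ht => H.b_lt.trans_le (hv t ht)
  have cK : ContinuousOn (fun t => Kq f (v t)) (Icc x y) :=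
    H.K_continuousOn.comp (S.cont.mono hsub) hmap
  have cI : ContinuousOn (fun t => IK f β (v t)) (Icc x y) :=
    ContinuousOn.comp (t := Ioi b)
      (fun s hs => (H.hasDerivAt_IK hs).continuousAt.continuousWithinAt) (S.cont.mono hsub) hmap
  have cF : ContinuousOn (fun t => Fint f (v t)) (Icc x y) :=
    H.continuous_F.comp_continuousOn (S.cont.mono hsub)
  have cw := S.dcont.mono hsub
  have hcont : ContinuousOn (fun r => Qv n f β r (v r) (w r)) (Icc x y) := by
    unfold Qv; fun_prop
  refine antitoneOn_of_hasDerivAt_nonpos hcont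
    (fun t ht => S.hasDerivAt_Q H (hx.trans_lt ht.1) (H.b_lt.trans (hv' t ht)))
    (fun t ht => ?_) (left_mem_Icc.2 hxy) (right_mem_Icc.2 hxy) hxy
  have h1 := H.K_deriv_ge (hv' t ht)
  have h2 : 0 < t := hx.trans_lt ht.1
  have h3 : 0 ≤ t * w t ^ 2 := by positivity
  nlinarith

/-- Comparison of two nearby solutions at the beginning of their `i`-th monotone arcs. -/
def TopInv (n : ℕ) (f : ℝ → ℝ) (β : ℝ) (u : ℝ → ℝ → ℝ) (αs : ℝ) (i : ℕ) : Prop :=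
  ∃ c > 0, ∀ᶠ p : ℝ × ℝ in 𝓝 (αs, αs), p.1 < p.2 →
    c * (p.2 - p.1) ≤ vb u i p.2 (Tk u i p.1) - vb u i p.1 (Tk u i p.1) ∧
    ∀ r, Tk u i p.2 < r → (∀ s ∈ Ioo (Tk u i p.2) r, wb u i p.2 s < 0) →
      vb u i p.2 r = vb u i p.1 (Tk u i p.1) →
      Qv n f β r (vb u i p.1 (Tk u i p.1)) (wb u i p.2 r) ≤
        Qv n f β (Tk u i p.1) (vb u i p.1 (Tk u i p.1)) (wb u i p.1 (Tk u i p.1))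

theorem Nonlin.IK_le (H : Nonlin n f b β) {s t : ℝ} (hs : β ≤ s) (hst : s ≤ t) :
    IK f β s ≤ IK f β t :=
  monotoneOn_of_hasDerivAt_nonneg (x := s) (y := t) (g := IK f β)
    (fun _ hr => (H.hasDerivAt_IK (H.b_lt.trans_le
      (hs.trans hr.1))).continuousAt.continuousWithinAt)
    (fun _ hr => H.hasDerivAt_IK (H.b_lt.trans_le (hs.trans hr.1.le)))
    (fun _ hr => H.K_nonneg (hs.trans hr.1.le))
    (left_mem_Icc.2 hst) (right_mem_Icc.2 hst) hst

theorem topInv_zero (H : Nonlin n f b β) (hu : Family n f u) (hα : β < αs) :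
    TopInv n f β u αs 0 := by
  refine ⟨1, one_pos, ?_⟩
  filter_upwards [eventually_both (Ioi_mem_nhds hα)] with p hp hlt
  have h1 : β < p.1 := hp.1
  have p1 : 0 < p.1 := H.β_pos.trans h1
  have p2 : 0 < p.2 := p1.trans hlt
  have e1 : vb u 0 p.1 0 = p.1 := by simp [vb, hu.zero_val p1]
  have e2 : vb u 0 p.2 0 = p.2 := by simp [vb, hu.zero_val p2]
  have S₁ := isSol_vb H hu p1 0
  have S₂ := isSol_vb H hu p2 0
  simp only [Tk_zero, e1, e2, one_mul, le_refl, true_and]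
  intro r hr hs hv
  have ha := S₂.strictAntiOn le_rfl hs
  have hge : ∀ t ∈ Icc 0 r, β < vb u 0 p.2 t := fun t ht =>
    h1.trans_le (hv ▸ ha.antitoneOn ht (right_mem_Icc.2 hr.le) ht.2)
  have := S₂.Q_le H le_rfl hr.le (fun t ht => (hge t ht).le)
    (fun t ht => hge t (Ioo_subset_Icc_self ht))
  rw [hv] at this
  refine this.trans ?_
  have hm : (2 : ℝ) ≤ n := by exact_mod_cast H.two_le
  have hI := H.IK_le h1.le hlt.le
  simp only [Qv, e2, S₁.d_zero, S₂.d_zero]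
  have : 0 ≤ ((n : ℝ) - 2) * (IK f β p.2 - IK f β p.1) := mul_nonneg (by linarith) (by linarith)
  linarith

theorem eventually_at {g : ℝ × ℝ → ℝ} (hg : ContinuousOn g (Ioi 0 ×ˢ Ici 0)) (hα : 0 < αs)
    {r₀ : ℝ} (hr₀ : 0 ≤ r₀) {O : Set ℝ} (hO : O ∈ 𝓝 (g (αs, r₀))) :
    ∀ᶠ α in 𝓝 αs, g (α, r₀) ∈ O := by
  obtain ⟨η, hη, h⟩ := eventually_near hg hα hr₀ hO
  filter_upwards [h] with α h
  exact h r₀ hr₀ (by simpa using hη.le)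

set_option maxHeartbeats 800000 in
/-- Shortly after a maximum, the larger solution is steeper by a first order amount, at equal
values, as long as it is to the right. -/
theorem TopInv.excess {i : ℕ} (hT : TopInv n f β u αs i) (H : Nonlin n f b β)
    (hu : Family n f u) (hα : 0 < αs) (hg : ∀ᶠ α in 𝓝 αs, Good u i α)
    (htend : Tendsto (Tk u i) (𝓝 αs) (𝓝 (Tk u i αs)))
    (hv : β < vb u i αs (Tk u i αs)) {R : ℝ} (hR : Tk u i αs < R) (hB : BiLip u αs R) :
    ∃ c₁ > 0, ∃ t₀, Tk u i αs < t₀ ∧ t₀ < R ∧ ∀ᶠ p : ℝ × ℝ in 𝓝 (αs, αs), p.1 < p.2 →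
      ∀ r, t₀ < r → (∀ s ∈ Ioo (Tk u i p.2) r, wb u i p.2 s < 0) →
        vb u i p.2 r = vb u i p.1 t₀ →
        c₁ * (p.2 - p.1) ≤ wb u i p.2 r ^ 2 - wb u i p.1 t₀ ^ 2 := by
  have hgs := hg.self_of_nhds
  have hT0 := hgs.T_nonneg
  have hcrit : wb u i αs (Tk u i αs) = 0 := wb_eq_zero.2 (hgs.crit hu hα)
  set T := Tk u i αs with hTdef
  obtain ⟨β', -, κ, hκ, η, hη, hz⟩ := zone H hu hα i hT0 hv hcrit
  obtain ⟨c, hc, hT⟩ := hT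
  obtain ⟨C, hC, hb⟩ := hB.bounds i
  obtain ⟨η₂, hη₂, hw⟩ := eventually_near (continuousOn_wb hu i) hα hT0
    (O := Ioo (-(κ * c / (4 * C))) (κ * c / (4 * C)))
    (by
      simp only [hcrit]
      exact Ioo_mem_nhds (neg_lt_zero.2 (by positivity)) (by positivity))
  set θ := κ * c / (4 * C) with hθdef
  have hθ : θ * (4 * C) = κ * c := by rw [hθdef]; field_simp
  set η' := min (min (η / 2) η₂) (min ((R - T) / 2) (c / (4 * C))) with hη'def
  have hRT : 0 < R - T := sub_pos.2 hR
  have hη' : 0 < η' := by positivity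
  have q1 : η' ≤ η / 2 := (min_le_left _ _).trans (min_le_left _ _)
  have q2 : η' ≤ η₂ := (min_le_left _ _).trans (min_le_right _ _)
  have q3 : η' ≤ (R - T) / 2 := (min_le_right _ _).trans (min_le_left _ _)
  have q4 : η' ≤ c / (4 * C) := (min_le_right _ _).trans (min_le_right _ _)
  rw [le_div_iff₀ (by positivity)] at q4
  refine ⟨κ * c / 2, by positivity, T + η', by linarith, by linarith, ?_⟩
  have Ss := isSol_vb H hu hα i
  have hlt : vb u i αs (T + η) < vb u i αs (T + η') := by
    have h1 : StrictAntiOn (wb u i αs) (Icc T (T + η)) :=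
      Ss.slope_strictAntiOn hκ hT0 fun r hr => (hz.self_of_nhds r (hT0.trans_lt hr.1)
        (abs_le.2 ⟨by linarith [hr.1], by linarith [hr.2]⟩)).2
    have h2 : ∀ r ∈ Ioo T (T + η), wb u i αs r < 0 := fun r hr => by
      have := h1 ⟨le_rfl, by linarith⟩ ⟨hr.1.le, hr.2.le⟩ hr.1
      rwa [hcrit] at this
    exact Ss.strictAntiOn hT0 h2 ⟨by linarith, by linarith⟩ ⟨by linarith, le_rfl⟩ (by linarith)
  obtain ⟨m, hm1, hm2⟩ := exists_between hlt
  have e1 := eventually_at (continuousOn_vb hu i) hα (r₀ := T + η) (by linarith)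
    (O := Iio m) (Iio_mem_nhds hm1)
  have e2 := eventually_at (continuousOn_vb hu i) hα (r₀ := T + η') (by linarith)
    (O := Ioi m) (Ioi_mem_nhds hm2)
  have e3 := htend (Metric.ball_mem_nhds T hη')
  filter_upwards [hT, hb, eventually_both hz, eventually_both hw, eventually_both e1,
    eventually_both e2, eventually_both e3, eventually_both hg,
    eventually_both (Ioi_mem_nhds hα)] with p hT hb hz hw e1 e2 e3 hg hp0 hlt r hr hs hrv
  have hΔ : 0 < p.2 - p.1 := sub_pos.2 hlt
  have hb := hb hlt
  have S₁ := isSol_vb H hu hp0.1 i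
  have S₂ := isSol_vb H hu hp0.2 i
  have t1 : |Tk u i p.1 - T| < η' := e3.1
  have t2 : |Tk u i p.2 - T| < η' := e3.2
  rw [abs_lt] at t1 t2
  have n1 := hg.1.T_nonneg
  have n2 := hg.2.T_nonneg
  have d0 := (hT hlt).1
  set t₀ := T + η' with ht₀
  have hrη : r ≤ T + η := by
    by_contra hc
    rw [not_le] at hc
    have a := S₂.strictAntiOn n2 hs ⟨by linarith, hc.le⟩ ⟨by linarith, le_rfl⟩ hc
    have a1 : vb u i p.2 (T + η) < m := e1.2
    have a2 : m < vb u i p.1 t₀ := e2.1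
    linarith
  have hD : c / 2 * (p.2 - p.1) ≤ vb u i p.2 t₀ - vb u i p.1 t₀ := by
    have := mul_le_sub_of_le_hasDerivAt (g := fun t => vb u i p.2 t - vb u i p.1 t)
      (x := Tk u i p.1) (y := t₀) (m := -(C * (p.2 - p.1))) (by linarith)
      ((S₂.cont.sub S₁.cont).mono fun t ht => n1.trans ht.1)
      (fun t ht => (S₂.d1 t (n1.trans_lt ht.1)).sub (S₁.d1 t (n1.trans_lt ht.1)))
      (fun t ht => (abs_le.1 (hb t ⟨n1.trans ht.1.le, by linarith [ht.2]⟩).2.1).1)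
    have h3 : C * (p.2 - p.1) * (t₀ - Tk u i p.1) ≤ c / 2 * (p.2 - p.1) := by
      have : t₀ - Tk u i p.1 ≤ 2 * η' := by linarith
      nlinarith [mul_le_mul_of_nonneg_left this (mul_pos hC hΔ).le]
    linarith
  have hmono := monotoneOn_of_hasDerivAt_nonneg (x := t₀) (y := r)
    (g := fun t => wb u i p.2 t ^ 2 / 2 + κ * vb u i p.2 t)
    (g' := fun t => wb u i p.2 t * (-(((n : ℝ) - 1) / t * wb u i p.2 t) - f (vb u i p.2 t) + κ))
    ((((S₂.dcont.pow 2).div_const 2).add (S₂.cont.const_mul κ)).mono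
      fun t ht => (by linarith [ht.1] : (0 : ℝ) ≤ t))
    (fun t ht => by
      have ht0 : 0 < t := by linarith [ht.1]
      refine ((((S₂.d2 t ht0).pow 2).div_const 2).add ((S₂.d1 t ht0).const_mul κ)).congr_deriv ?_
      simp
      ring)
    (fun t ht => by
      have h1 := hs t ⟨by linarith [ht.1], ht.2⟩
      have h2 := (hz.2 t (by linarith [ht.1])
        (abs_le.2 ⟨by linarith [ht.1], by linarith [ht.2]⟩)).2
      nlinarith)
    (left_mem_Icc.2 hr.le) (right_mem_Icc.2 hr.le) hr.le
  simp only [hrv] at hmono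
  have hw1 : wb u i p.1 t₀ ∈ Ioo (-θ) θ := hw.1 t₀ (by linarith)
    (abs_le.2 ⟨by linarith, by linarith⟩)
  have hw2 : wb u i p.2 t₀ ∈ Ioo (-θ) θ := hw.2 t₀ (by linarith)
    (abs_le.2 ⟨by linarith, by linarith⟩)
  have hD' := (hb t₀ ⟨by linarith, by linarith⟩).2.1
  have hsq : -(C * (p.2 - p.1) * (2 * θ)) ≤ wb u i p.2 t₀ ^ 2 - wb u i p.1 t₀ ^ 2 := by
    have h1 : |wb u i p.2 t₀ + wb u i p.1 t₀| ≤ 2 * θ :=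
      abs_le.2 ⟨by linarith [hw1.1, hw2.1], by linarith [hw1.2, hw2.2]⟩
    have h2 := mul_le_mul hD' h1 (abs_nonneg _) (by positivity)
    rw [← abs_mul] at h2
    have h3 := (abs_le.1 h2).1
    have e : wb u i p.2 t₀ ^ 2 - wb u i p.1 t₀ ^ 2 =
      (wb u i p.2 t₀ - wb u i p.1 t₀) * (wb u i p.2 t₀ + wb u i p.1 t₀) := by ring
    rw [e]; exact h3
  have h4 := mul_le_mul_of_nonneg_left hD hκ.le
  have h5 : C * (p.2 - p.1) * (2 * θ) = κ * c / 2 * (p.2 - p.1) := by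
    rw [← hθ]; ring
  linarith

/-- Energy is positive up to an extremum above `β` in absolute value. -/
theorem Good.En_pos {i : ℕ} {α : ℝ} (h : Good u i α) (H : Nonlin n f b β) (hu : Family n f u)
    (hα : 0 < α) (hv : β < vb u i α (Tk u i α)) (j : ℕ) {t : ℝ} (ht : t ∈ Icc 0 (Tk u i α)) :
    0 < En f (vb u j α) (wb u j α) t := by
  rw [En_vb H j, ← En_vb H i]
  have h1 := (isSol_vb H hu hα i).En_antitoneOn H ht.1 (ht.1.trans ht.2) ht.2
  refine lt_of_lt_of_le ?_ h1
  have h2 : wb u i α (Tk u i α) = 0 := wb_eq_zero.2 (h.crit hu hα)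
  unfold En
  rw [h2]
  have := H.F_pos hv
  linarith

/-- Matching of two complete monotone arcs. -/
theorem arc_match {i : ℕ} {α₁ α₂ : ℝ} (H : Nonlin n f b β) (hu : Family n f u)
    (hα₁ : 0 < α₁) (hα₂ : 0 < α₂) (g₁ : Good u (i + 1) α₁) (g₂ : Good u (i + 1) α₂)
    (htop : vb u i α₁ (Tk u i α₁) < vb u i α₂ (Tk u i α₂))
    (hβ : β < vb u i α₁ (Tk u i α₁))
    (hβ₁ : β < vb u (i + 1) α₁ (Tk u (i + 1) α₁)) (hβ₂ : β < vb u (i + 1) α₂ (Tk u (i + 1) α₂))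
    (hQ : ∀ r, Tk u i α₂ < r → (∀ s ∈ Ioo (Tk u i α₂) r, wb u i α₂ s < 0) →
      vb u i α₂ r = vb u i α₁ (Tk u i α₁) →
      Qv n f β r (vb u i α₁ (Tk u i α₁)) (wb u i α₂ r) ≤
        Qv n f β (Tk u i α₁) (vb u i α₁ (Tk u i α₁)) (wb u i α₁ (Tk u i α₁))) :
    ∃ ρ, Matched (vb u i α₁) (wb u i α₁) (vb u i α₂) (wb u i α₂) ρ (Tk u i α₁) (Tk u (i + 1) α₁) ∧
      (∀ t ∈ Icc (Tk u i α₁) (Tk u (i + 1) α₁), ρ t ∈ Ioo (Tk u i α₂) (Tk u (i + 1) α₂)) ∧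
      (∀ t ∈ Ioo (Tk u i α₁) (Tk u (i + 1) α₁), wb u i α₂ (ρ t) < wb u i α₁ t) ∧
      ((∃ t ∈ Icc (Tk u i α₁) (Tk u (i + 1) α₁), ρ t ≤ t) →
        Matched.LeftState n f β (vb u i α₁) (wb u i α₁) (wb u i α₂) ρ (Tk u (i + 1) α₁)) := by
  have S₁ := isSol_vb H hu hα₁ i
  have S₂ := isSol_vb H hu hα₂ i
  have s₁ := g₁ i i.lt_succ_self
  have s₂ := g₂ i i.lt_succ_self
  have h₁ := g₁.mono i.le_succ
  have h₂ := g₂.mono i.le_succ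
  have n₁ := h₁.T_nonneg
  have n₂ := h₂.T_nonneg
  have l₁ := s₁.T_lt_Z.trans s₁.Z_lt_T
  have l₂ := s₂.T_lt_Z.trans s₂.Z_lt_T
  have hE : ∀ t ∈ Icc (Tk u i α₁) (Tk u (i + 1) α₁), 0 < En f (vb u i α₁) (wb u i α₁) t :=
    fun t ht => g₁.En_pos H hu hα₁ hβ₁ i ⟨n₁.trans ht.1, ht.2⟩
  have c₁ : wb u i α₁ (Tk u i α₁) = 0 := wb_eq_zero.2 (h₁.crit hu hα₁)
  have c₂ : wb u i α₂ (Tk u (i + 1) α₂) = 0 := wb_eq_zero.2 (g₂.crit hu hα₂)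
  have hβ0 := H.β_pos
  rw [vb_succ] at hβ₁ hβ₂
  have key : ∀ y, Tk u i α₁ < y → y ≤ Tk u (i + 1) α₁ → vb u i α₁ y < -β →
      vb u i α₂ (Tk u (i + 1) α₂) ≤ vb u i α₁ y →
      ∃ ρ, Matched (vb u i α₁) (wb u i α₁) (vb u i α₂) (wb u i α₂) ρ (Tk u i α₁) y ∧
        (∀ t ∈ Icc (Tk u i α₁) y, ρ t ∈ Ioc (Tk u i α₂) (Tk u (i + 1) α₂)) ∧
        (∀ t ∈ Ico (Tk u i α₁) y, ρ t < Tk u (i + 1) α₂) ∧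
        (∀ t ∈ Ioc (Tk u i α₁) y, wb u i α₂ (ρ t) < wb u i α₁ t) ∧
        ((∃ t ∈ Icc (Tk u i α₁) y, ρ t ≤ t) →
          Matched.LeftState n f β (vb u i α₁) (wb u i α₁) (wb u i α₂) ρ y) := by
    intro y hy hy' hyβ hbot
    obtain ⟨ρ, M, m1, m2⟩ := exists_matched S₁ S₂ n₁ hy n₂ l₂
      (fun t ht => s₁.slope t ⟨ht.1, ht.2.trans_le hy'⟩) s₂.slope htop hbot
    have hx := left_mem_Icc.2 hy.le
    have hw0 : wb u i α₂ (ρ (Tk u i α₁)) < wb u i α₁ (Tk u i α₁) := by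
      rw [c₁]; exact M.w2neg _ ⟨le_rfl, hy⟩
    have hX : 0 < Tk u i α₁ * wb u i α₁ (Tk u i α₁) - ρ (Tk u i α₁) * wb u i α₂ (ρ (Tk u i α₁)) := by
      rw [c₁] at hw0 ⊢
      nlinarith [mul_pos (M.pos _ hx) (neg_pos.2 hw0)]
    have hQ0 := hQ (ρ (Tk u i α₁)) (m1 _ hx).1
      (fun s hs => s₂.slope s ⟨hs.1, hs.2.trans_le (m1 _ hx).2⟩) (M.val _ hx)
    have hbr := fun z (hz : z ∈ Ioc (Tk u i α₁) y) (hq : -β ≤ vb u i α₁ z → wb u i α₂ (ρ z) < 0) =>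
      (M.sub le_rfl hz.2).branch H S₁ S₂ hz.1 hβ
        (fun t ht => hE t ⟨ht.1, ht.2.trans (hz.2.trans hy')⟩) hw0 hX hQ0 hq
    refine ⟨ρ, M, m1, m2, fun t ht => ?_, (hbr y ⟨hy, le_rfl⟩ fun h => absurd h (not_le.2 hyβ)).2⟩
    rcases ht.2.eq_or_lt with rfl | h
    · exact (hbr t ⟨hy, le_rfl⟩ fun h => absurd h (not_le.2 hyβ)).1
    · exact (hbr t ht fun _ => M.w2neg t ⟨ht.1.le, h⟩).1
  rcases le_or_gt (vb u i α₂ (Tk u (i + 1) α₂)) (vb u i α₁ (Tk u (i + 1) α₁)) with h | h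
  · obtain ⟨ρ, M, m1, m2, m3, m4⟩ := key _ l₁ le_rfl (by linarith) h
    refine ⟨ρ, M, fun t ht => ⟨(m1 t ht).1, (m1 t ht).2.lt_of_ne fun e => ?_⟩,
      fun t ht => m3 t (Ioo_subset_Ioc_self ht), m4⟩
    rcases ht.2.eq_or_lt with rfl | h'
    · have := m3 _ ⟨l₁, le_rfl⟩
      rw [e, c₂] at this
      exact absurd (M.w1le _ ht) (not_le.2 this)
    · exact (m2 t ⟨ht.1, h'⟩).ne e
  · obtain ⟨y, hy, hyv⟩ := intermediate_value_Icc' l₁.le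
      (S₁.cont.mono fun t ht => n₁.trans ht.1)
      (show vb u i α₂ (Tk u (i + 1) α₂) ∈ Icc _ _ from ⟨h.le, by linarith⟩)
    have hy1 : Tk u i α₁ < y := hy.1.lt_of_ne (by rintro rfl; linarith)
    obtain ⟨ρ, M, m1, -, m3, -⟩ := key y hy1 hy.2 (by linarith) hyv.ge
    have hyy := right_mem_Icc.2 hy1.le
    have e : ρ y = Tk u (i + 1) α₂ := (s₂.v_anti h₂ H hu hα₂).injOn
      ⟨(m1 y hyy).1.le, (m1 y hyy).2⟩ ⟨l₂.le, le_rfl⟩ ((M.val y hyy).trans hyv)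
    have := m3 y ⟨hy1, le_rfl⟩
    rw [e, c₂] at this
    exact absurd (M.w1le y hyy) (not_le.2 this)

theorem eventually_top_gt (hu : Family n f u) (hα : 0 < αs) {i : ℕ}
    (hg : ∀ᶠ α in 𝓝 αs, Good u i α) (htend : Tendsto (Tk u i) (𝓝 αs) (𝓝 (Tk u i αs)))
    (hv : β < vb u i αs (Tk u i αs)) : ∀ᶠ α in 𝓝 αs, β < vb u i α (Tk u i α) := by
  obtain ⟨η, hη, h⟩ := eventually_near (continuousOn_vb hu i) hα hg.self_of_nhds.T_nonneg
    (O := Ioi β) (Ioi_mem_nhds hv)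
  filter_upwards [h, hg, htend (Metric.closedBall_mem_nhds _ hη)] with α h1 h2 h3
  exact h1 _ h2.T_nonneg h3

theorem TopInv.top_lt {i : ℕ} (hT : TopInv n f β u αs i) (H : Nonlin n f b β)
    (hu : Family n f u) (hα : 0 < αs) (hg : ∀ᶠ α in 𝓝 αs, Good u i α)
    (htend : Tendsto (Tk u i) (𝓝 αs) (𝓝 (Tk u i αs)))
    (hv : β < vb u i αs (Tk u i αs)) : ∀ᶠ p : ℝ × ℝ in 𝓝 (αs, αs), p.1 < p.2 →
      vb u i p.1 (Tk u i p.1) < vb u i p.2 (Tk u i p.2) := by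
  have hgs := hg.self_of_nhds
  obtain ⟨β', -, κ, hκ, η, hη, hz⟩ := zone H hu hα i hgs.T_nonneg hv
    (wb_eq_zero.2 (hgs.crit hu hα))
  obtain ⟨c, hc, hT⟩ := hT
  filter_upwards [hT, eventually_both hz, eventually_both hg,
    eventually_both (htend (Metric.closedBall_mem_nhds _ hη)),
    eventually_both (Ioi_mem_nhds hα)] with p hT hz hg ht hp0 hlt
  have h1 := (hT hlt).1
  have h2 : 0 < c * (p.2 - p.1) := mul_pos hc (sub_pos.2 hlt)
  have t1 : |Tk u i p.1 - Tk u i αs| ≤ η := ht.1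
  have t2 : |Tk u i p.2 - Tk u i αs| ≤ η := ht.2
  rw [abs_le] at t1 t2
  have S₂ := isSol_vb H hu hp0.2 i
  have hc2 : wb u i p.2 (Tk u i p.2) = 0 := wb_eq_zero.2 (hg.2.crit hu hp0.2)
  have n1 := hg.1.T_nonneg
  have n2 := hg.2.T_nonneg
  have : vb u i p.2 (Tk u i p.1) ≤ vb u i p.2 (Tk u i p.2) := by
    rcases le_total (Tk u i p.1) (Tk u i p.2) with h | h
    · have hs := S₂.slope_strictAntiOn (x := Tk u i p.1) (y := Tk u i p.2) hκ n1
        fun r hr => (hz.2 r (n1.trans_lt hr.1)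
          (abs_le.2 ⟨by linarith [hr.1], by linarith [hr.2]⟩)).2
      refine (strictMonoOn_of_hasDerivAt_pos (S₂.cont.mono fun t ht => n1.trans ht.1)
        (fun t ht => S₂.d1 t (n1.trans_lt ht.1)) fun t ht => ?_).monotoneOn
        (left_mem_Icc.2 h) (right_mem_Icc.2 h) h
      have := hs (Ioo_subset_Icc_self ht) (right_mem_Icc.2 h) ht.2
      rwa [hc2] at this
    · have hs := S₂.slope_strictAntiOn (x := Tk u i p.2) (y := Tk u i p.1) hκ n2
        fun r hr => (hz.2 r (n2.trans_lt hr.1)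
          (abs_le.2 ⟨by linarith [hr.1], by linarith [hr.2]⟩)).2
      refine (S₂.strictAntiOn n2 fun t ht => ?_).antitoneOn
        (left_mem_Icc.2 h) (right_mem_Icc.2 h) h
      have := hs (left_mem_Icc.2 h) (Ioo_subset_Icc_self ht) ht.1
      rwa [hc2] at this
  linarith

set_option maxHeartbeats 800000 in
/-- Two nearby solutions intersect along each complete monotone arc, before its end. -/
theorem TopInv.arc_intersect {i : ℕ} (hT : TopInv n f β u αs i) (H : Nonlin n f b β)
    (hu : Family n f u) (hα : 0 < αs) (hg : ∀ᶠ α in 𝓝 αs, Good u (i + 1) α)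
    (htend : Tendsto (Tk u i) (𝓝 αs) (𝓝 (Tk u i αs)))
    (htend' : Tendsto (Tk u (i + 1)) (𝓝 αs) (𝓝 (Tk u (i + 1) αs)))
    (hv : β < vb u i αs (Tk u i αs)) (hv' : β < vb u (i + 1) αs (Tk u (i + 1) αs))
    (hB : BiLip u αs (Tk u (i + 1) αs)) :
    ∃ η₀ > 0, ∀ η, 0 < η → η ≤ η₀ → ∀ᶠ p : ℝ × ℝ in 𝓝 (αs, αs), p.1 < p.2 → ∀ ρ,
      Matched (vb u i p.1) (wb u i p.1) (vb u i p.2) (wb u i p.2) ρ (Tk u i p.1)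
        (Tk u (i + 1) p.1) →
      (∀ t ∈ Icc (Tk u i p.1) (Tk u (i + 1) p.1), ρ t ∈ Ioo (Tk u i p.2) (Tk u (i + 1) p.2)) →
      ∃ t ∈ Icc (Tk u i p.1) (Tk u (i + 1) αs - η), ρ t ≤ t := by
  have hgs := hg.self_of_nhds
  have ss := hgs i i.lt_succ_self
  have hT0 := (hgs.mono i.le_succ).T_nonneg
  have hTT := ss.T_lt_Z.trans ss.Z_lt_T
  have hcrit : wb u i αs (Tk u (i + 1) αs) = 0 := wb_eq_zero.2 (hgs.crit hu hα)
  obtain ⟨c₁, hc₁, t₀, ht₀, ht₀', hex⟩ := hT.excess H hu hα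
    (hg.mono fun α h => h.mono i.le_succ) htend hv
    (show Tk u i αs < (Tk u i αs + Tk u (i + 1) αs) / 2 by linarith) (hB.mono (by linarith))
  obtain ⟨C, hC, hb⟩ := hB.bounds i
  set T := Tk u i αs
  set T' := Tk u (i + 1) αs
  have ht₀0 : 0 < t₀ := hT0.trans_lt ht₀
  have hT'0 : 0 < T' := hT0.trans_lt hTT
  set θ := t₀ ^ (n - 1) * c₁ / (4 * C * T' ^ (n - 1)) with hθdef
  have hθ0 : 0 < θ := by positivity
  have hθ : θ * (4 * C * T' ^ (n - 1)) = t₀ ^ (n - 1) * c₁ := by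
    rw [hθdef]; field_simp
  obtain ⟨η₁, hη₁, hw⟩ := eventually_near (continuousOn_wb hu i) hα hT'0.le
    (O := Ioo (-θ) θ) (by
      simp only [hcrit]
      exact Ioo_mem_nhds (neg_lt_zero.2 hθ0) hθ0)
  obtain ⟨η₂, hη₂, hvn⟩ := eventually_near (continuousOn_vb hu (i + 1)) hα hT'0.le
    (O := Ioi β) (Ioi_mem_nhds hv')
  have hgap : 0 < T' - t₀ := by linarith
  refine ⟨min (min η₁ η₂) ((T' - t₀) / 2), by positivity, fun η hη hη0 => ?_⟩
  have q1 : η ≤ η₁ := hη0.trans ((min_le_left _ _).trans (min_le_left _ _))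
  have q2 : η ≤ η₂ := hη0.trans ((min_le_left _ _).trans (min_le_right _ _))
  have q3 : η ≤ (T' - t₀) / 2 := hη0.trans (min_le_right _ _)
  filter_upwards [hex, hb, eventually_both hw, eventually_both hvn, eventually_both hg,
    eventually_both (htend (Iio_mem_nhds ht₀)),
    eventually_both (htend' (Ioi_mem_nhds (show T' - η < T' by linarith))),
    eventually_both (Ioi_mem_nhds hα)] with p hex hb hw hvn hg e1 e2 hp0 hlt ρ M hρ
  have hΔ : 0 < p.2 - p.1 := sub_pos.2 hlt
  by_contra hc
  push Not at hc
  have a1 : Tk u i p.1 < t₀ := e1.1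
  have a2 : Tk u i p.2 < t₀ := e1.2
  have b1 : T' - η < Tk u (i + 1) p.1 := e2.1
  have b2 : T' - η < Tk u (i + 1) p.2 := e2.2
  set tb := T' - η with htb
  have htb0 : t₀ < tb := by linarith
  have S₂ := isSol_vb H hu hp0.2 i
  have S₁ := isSol_vb H hu hp0.1 i
  have g2 := hg.2.mono i.le_succ
  have s2 := hg.2 i i.lt_succ_self
  have n2 := g2.T_nonneg
  have hI0 : t₀ ∈ Icc (Tk u i p.1) (Tk u (i + 1) p.1) := ⟨a1.le, by linarith⟩
  have hIb : tb ∈ Icc (Tk u i p.1) (Tk u (i + 1) p.1) := ⟨by linarith, b1.le⟩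
  have h0 := hex hlt (ρ t₀) (hc t₀ ⟨a1.le, htb0.le⟩)
    (fun s hs => s2.slope s ⟨hs.1, hs.2.trans (hρ t₀ hI0).2⟩) (M.val t₀ hI0)
  have hm := (M.sub a1.le b1.le).slope_mono H S₁ S₂
    (fun t ht => (hc t ⟨by linarith [ht.1], ht.2.le⟩).le)
    (left_mem_Icc.2 htb0.le) (right_mem_Icc.2 htb0.le) htb0.le
  simp only at hm
  have hcb := hc tb ⟨hIb.1, le_rfl⟩
  have hE := S₂.En_antitoneOn H (show (0 : ℝ) ≤ tb by linarith)
    (show (0 : ℝ) ≤ ρ tb by linarith) hcb.le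
  unfold En at hE
  rw [M.val tb hIb] at hE
  have hvle : vb u i p.1 tb ≤ vb u i p.2 tb := by
    rw [← M.val tb hIb]
    exact (s2.v_anti g2 H hu hp0.2).antitoneOn ⟨by linarith, b2.le⟩
      ⟨(hρ tb hIb).1.le, (hρ tb hIb).2.le⟩ hcb.le
  have hvn2 : β < vb u (i + 1) p.2 tb := hvn.2 tb (by linarith)
    (by rw [htb]; simpa [abs_of_pos hη] using q2)
  rw [vb_succ] at hvn2
  have hF : Fint f (vb u i p.2 tb) ≤ Fint f (vb u i p.1 tb) := by
    rw [← H.F_neg, ← H.F_neg (vb u i p.1 tb)]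
    have := H.b_lt
    exact H.F_strictMonoOn.monotoneOn (show b ≤ _ by linarith) (show b ≤ _ by linarith)
      (by linarith)
  have hrη : |tb - T'| ≤ η₁ := by rw [htb]; simpa [abs_of_pos hη] using q1
  have hw1 : wb u i p.1 tb ∈ Ioo (-θ) θ := hw.1 tb (by linarith) hrη
  have hw2 : wb u i p.2 tb ∈ Ioo (-θ) θ := hw.2 tb (by linarith) hrη
  have hsq : wb u i p.2 tb ^ 2 - wb u i p.1 tb ^ 2 ≤ C * (p.2 - p.1) * (2 * θ) := by
    have h1 : |wb u i p.2 tb + wb u i p.1 tb| ≤ 2 * θ :=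
      abs_le.2 ⟨by linarith [hw1.1, hw2.1], by linarith [hw1.2, hw2.2]⟩
    have h2 := mul_le_mul (hb hlt tb ⟨by linarith, by linarith⟩).2.1 h1 (abs_nonneg _)
      (by positivity)
    rw [← abs_mul] at h2
    have e : wb u i p.2 tb ^ 2 - wb u i p.1 tb ^ 2 =
      (wb u i p.2 tb - wb u i p.1 tb) * (wb u i p.2 tb + wb u i p.1 tb) := by ring
    rw [e]; exact (abs_le.1 h2).2
  have h5 : t₀ ^ (n - 1) * (c₁ * (p.2 - p.1)) ≤ tb ^ (n - 1) * (C * (p.2 - p.1) * (2 * θ)) :=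
    (mul_le_mul_of_nonneg_left h0 (by positivity)).trans (hm.trans
      (mul_le_mul_of_nonneg_left (by linarith) (pow_nonneg (by linarith) _)))
  have h6 : tb ^ (n - 1) ≤ T' ^ (n - 1) := pow_le_pow_left₀ (by linarith) (by linarith) _
  have h7 : tb ^ (n - 1) * (C * (p.2 - p.1) * (2 * θ)) ≤
      T' ^ (n - 1) * (C * (p.2 - p.1) * (2 * θ)) :=
    mul_le_mul_of_nonneg_right h6 (by positivity)
  have h8 : T' ^ (n - 1) * (C * (p.2 - p.1) * (2 * θ)) =
      t₀ ^ (n - 1) * (c₁ * (p.2 - p.1)) / 2 := by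
    rw [← mul_assoc (t₀ ^ (n - 1)), ← hθ]; ring
  have h9 : 0 < t₀ ^ (n - 1) * (c₁ * (p.2 - p.1)) := by positivity
  linarith

theorem Nonlin.IK_lipschitz_near (H : Nonlin n f b β) {s : ℝ} (hs : b < s) :
    ∃ K > 0, ∃ ε > 0, ∀ x y, |x - s| ≤ ε → |y - s| ≤ ε → |IK f β y - IK f β x| ≤ K * |y - x| := by
  have hnear : ∀ᶠ t in 𝓝 s, b < t ∧ |Kq f t| < |Kq f s| + 1 :=
    (eventually_gt_nhds hs).and
      ((H.hasDerivAt_K hs).continuousAt.abs (Iio_mem_nhds (by simp)))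
  obtain ⟨ε, hε, h⟩ := Metric.nhds_basis_closedBall.eventually_iff.1 hnear
  refine ⟨|Kq f s| + 1, by positivity, ε, hε, fun x y hx hy => ?_⟩
  exact (convex_closedBall s ε).norm_image_sub_le_of_norm_hasDerivWithin_le
    (fun t ht => (H.hasDerivAt_IK (h ht).1).hasDerivWithinAt) (fun t ht => (h ht).2.le)
    (show x ∈ Metric.closedBall s ε from hx) hy

set_option maxHeartbeats 800000 in
/-- A first order negative slope difference at equal radii forces, through the functional `Q`, a
first order difference of values. -/
theorem Q_gap (H : Nonlin n f b β) {s₀ T₀ c : ℝ} (hs : β < s₀) (hT : 0 < T₀) (hc : 0 < c) :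
    ∃ c' > 0, ∃ ε > 0, ∀ T s₁ s₂ p Δ, |T - T₀| ≤ ε → |s₁ - s₀| ≤ ε → |s₂ - s₀| ≤ ε → |p| ≤ ε →
      p ≤ -(c * Δ) → Qv n f β T s₂ p ≤ Qv n f β T s₁ 0 → 0 < Δ → c' * Δ ≤ |s₂ - s₁| := by
  obtain ⟨L₁, hL₁, ε₁, hε₁, h1⟩ := H.F_lipschitz_near s₀
  obtain ⟨L₂, hL₂, ε₂, hε₂, h2⟩ := H.IK_lipschitz_near (H.b_lt.trans hs)
  have hK0 := H.K_pos hs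
  set K₀ := Kq f s₀ / 2 with hK₀
  obtain ⟨ε₃, hε₃, h3⟩ := Metric.nhds_basis_closedBall.eventually_iff.1
    ((H.hasDerivAt_K (H.b_lt.trans hs)).continuousAt (Ioi_mem_nhds (show K₀ < Kq f s₀ by linarith)))
  have hn : (2 : ℝ) ≤ n := by exact_mod_cast H.two_le
  set L := 8 * T₀ ^ 2 * L₁ + 4 * (n : ℝ) * L₂ with hL
  have hLp : 0 < L := by positivity
  have hK₀p : 0 < K₀ := by linarith
  set ε := min (min (min ε₁ ε₂) ε₃) (min (T₀ / 2) (K₀ / T₀))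
  have q1 : ε ≤ ε₁ := (min_le_left _ _).trans ((min_le_left _ _).trans (min_le_left _ _))
  have q2 : ε ≤ ε₂ := (min_le_left _ _).trans ((min_le_left _ _).trans (min_le_right _ _))
  have q3 : ε ≤ ε₃ := (min_le_left _ _).trans (min_le_right _ _)
  have q4 : ε ≤ T₀ / 2 := (min_le_right _ _).trans (min_le_left _ _)
  have q5 : ε ≤ K₀ / T₀ := (min_le_right _ _).trans (min_le_right _ _)
  rw [le_div_iff₀ hT] at q5
  refine ⟨T₀ * c * K₀ / L, by positivity, ε, by positivity, ?_⟩
  intro T s₁ s₂ p Δ hT1 hs1 hs2 hp hpc hQ hΔ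
  have hT2 := abs_le.1 (hT1.trans q4)
  have hF := h1 s₁ s₂ (hs1.trans q1) (hs2.trans q1)
  have hI := h2 s₁ s₂ (hs1.trans q2) (hs2.trans q2)
  have hK : K₀ < Kq f s₂ := h3 (show s₂ ∈ Metric.closedBall s₀ ε₃ from hs2.trans q3)
  have hp' := abs_le.1 hp
  have hTp : 0 < T := by linarith
  have hcΔ := mul_pos hc hΔ
  unfold Qv at hQ
  have e1 : T * p * (4 * Kq f s₂ + T * p) ≤ T * p * (2 * K₀) := by
    have : 2 * K₀ ≤ 4 * Kq f s₂ + T * p := by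
      have : -(2 * K₀) ≤ T * p := by
        have h4 : T * -p ≤ 2 * T₀ * ε :=
          mul_le_mul (by linarith) (by linarith) (by linarith) (by linarith)
        linarith
      linarith
    exact mul_le_mul_of_nonpos_left this (mul_nonpos_of_nonneg_of_nonpos hTp.le (by linarith))
  have e2 : T * p * (2 * K₀) ≤ -(T₀ * c * K₀ * Δ) := by
    have h4 : T₀ / 2 * (c * Δ) ≤ T * -p :=
      mul_le_mul (by linarith) (by linarith) hcΔ.le hTp.le
    have h5 := mul_le_mul_of_nonneg_right h4 (show 0 ≤ 2 * K₀ by linarith)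
    linarith
  set A := |s₂ - s₁|
  have hA : 0 ≤ A := abs_nonneg _
  have e3 : 2 * T ^ 2 * (Fint f s₂ - Fint f s₁) ≤ 8 * T₀ ^ 2 * L₁ * A := by
    have : T ^ 2 ≤ 4 * T₀ ^ 2 := by
      have h := pow_le_pow_left₀ hTp.le (show T ≤ 2 * T₀ by linarith) 2
      linarith
    have h4 := (abs_le.1 hF).2
    have h5 : 0 ≤ L₁ * A := by positivity
    have h6 := mul_le_mul_of_nonneg_left h4 (sq_nonneg T)
    have h7 := mul_le_mul_of_nonneg_right this h5
    linarith
  have e4 : 4 * ((n : ℝ) - 2) * (IK f β s₂ - IK f β s₁) ≤ 4 * (n : ℝ) * L₂ * A := by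
    have h4 := (abs_le.1 hI).2
    have h5 : 0 ≤ L₂ * A := by positivity
    have h6 := mul_le_mul_of_nonneg_left h4 (show 0 ≤ 4 * ((n : ℝ) - 2) by linarith)
    linarith
  have e5 : T₀ * c * K₀ * Δ ≤ L * A := by
    rw [hL]
    linarith
  rw [div_mul_eq_mul_div, div_le_iff₀ hLp]
  linarith

theorem Good.biLip_T {i : ℕ} (hgs : Good u i αs) (H : Nonlin n f b β) (hu : Family n f u)
    (hα : 0 < αs) (hv : β < vb u i αs (Tk u i αs)) {R : ℝ}
    (hR : ∀ r, Tk u i αs < r → r ≤ R → 0 < vb u i αs r) : BiLip u αs R := by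
  refine biLip H hu hα fun r hr hrR => ?_
  rcases le_or_gt r (Tk u i αs) with h | h
  · by_contra hc
    push Not at hc
    have := hgs.En_pos H hu hα hv 0 (t := r) ⟨hr.le, h⟩
    rw [En, vb_eq_zero.2 hc.1, wb_eq_zero.2 hc.2, H.F_zero] at this
    norm_num at this
  · exact Or.inl fun h0 => (hR r h hrR).ne' (vb_eq_zero.2 h0)

set_option maxHeartbeats 1600000 in
/-- The ordering of nearby solutions at an extremum propagates to the next extremum. -/
theorem TopInv.succ {i : ℕ} (hT : TopInv n f β u αs i) (H : Nonlin n f b β)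
    (hu : Family n f u) (hα : 0 < αs) (hgs : Good u (i + 1) αs)
    (hv : ∀ j ≤ i + 1, β < vb u j αs (Tk u j αs)) : TopInv n f β u αs (i + 1) := by
  obtain ⟨hg0, htend⟩ := good_perturb H hu hα (hgs.mono i.le_succ) fun j hj => hv j (by omega)
  obtain ⟨hg, htend'⟩ := good_perturb H hu hα hgs hv
  have hvi := hv i (by omega)
  have hvi' := hv (i + 1) le_rfl
  have ss := hgs i i.lt_succ_self
  have hT'0 : 0 < Tk u (i + 1) αs :=
    (hgs.mono i.le_succ).T_nonneg.trans_lt (ss.T_lt_Z.trans ss.Z_lt_T)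
  have hcrit : wb u (i + 1) αs (Tk u (i + 1) αs) = 0 := wb_eq_zero.2 (hgs.crit hu hα)
  have hβ0 := H.β_pos
  obtain ⟨β', hβ', κ, hκ, ηz, hηz, hz⟩ := zone H hu hα (i + 1) hT'0.le hvi' hcrit
  have hB : BiLip u αs (Tk u (i + 1) αs + ηz) := hgs.biLip_T H hu hα hvi' fun r hr hrR => by
    have := (hz.self_of_nhds r (hT'0.trans hr) (abs_le.2 ⟨by linarith, by linarith⟩)).1
    linarith
  obtain ⟨η₀, hη₀, hmeet⟩ := hT.arc_intersect H hu hα hg htend htend' hvi hvi'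
    (hB.mono (by linarith))
  obtain ⟨C, hC, hb⟩ := hB.bounds (i + 1)
  have hn1 := H.one_le
  set T' := Tk u (i + 1) αs with hT'
  set s₀ := vb u (i + 1) αs T' with hs₀
  set c₂ := 1 / (2 * C) with hc₂
  have hc₂p : 0 < c₂ := by positivity
  have hc₂e : C * c₂ = 1 / 2 := by rw [hc₂]; field_simp
  obtain ⟨c₀, hc₀, ε, hε, hgap⟩ := Q_gap H hvi' hT'0 hc₂p
  obtain ⟨Kf, hKf, εf, hεf, hfl⟩ := H.f_lipschitz_near (s := s₀) (by linarith)
  set C₃ := (((n : ℝ) - 1) / (T' / 2) + Kf) * C with hC₃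
  have hC₃p : 0 < C₃ := by
    have : 0 < ((n : ℝ) - 1) / (T' / 2) := by
      apply div_pos <;> linarith
    positivity
  set c := min c₀ c₂ with hc
  have hcp : 0 < c := lt_min hc₀ hc₂p
  obtain ⟨ηv, hηv, hV⟩ := eventually_near (continuousOn_vb hu (i + 1)) hα hT'0.le
    (O := Metric.closedBall s₀ (min ε εf)) (Metric.closedBall_mem_nhds _ (lt_min hε hεf))
  obtain ⟨ηw, hηw, hW⟩ := eventually_near (continuousOn_wb hu (i + 1)) hα hT'0.le
    (O := Metric.closedBall 0 ε) (by
      simp only [hcrit]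
      exact Metric.closedBall_mem_nhds _ hε)
  obtain ⟨η, hη, q0, qz, qv, qw, qT, qε, qc, qc'⟩ : ∃ η > 0, η ≤ η₀ ∧ η ≤ ηz ∧ η ≤ ηv ∧ η ≤ ηw ∧
      η ≤ T' / 2 ∧ η ≤ ε ∧ η ≤ c / (4 * C) ∧ η ≤ c₂ / (4 * C₃) := by
    refine ⟨min η₀ (min ηz (min ηv (min ηw (min (T' / 2) (min ε (min (c / (4 * C))
      (c₂ / (4 * C₃)))))))), by positivity, ?_, ?_, ?_, ?_, ?_, ?_, ?_, ?_⟩ <;>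
    simp
  rw [le_div_iff₀ (by positivity)] at qc qc'
  have htg := eventually_top_gt hu hα hg0 htend hvi
  have htg' := eventually_top_gt hu hα hg htend' hvi'
  have hlt' := hT.top_lt H hu hα hg0 htend hvi
  obtain ⟨cT, -, hTc⟩ := hT
  refine ⟨min c (c₂ * η / 4), by positivity, ?_⟩
  filter_upwards [hTc, hmeet η hη q0, hlt', eventually_both htg, eventually_both htg',
    eventually_both hg, hb, eventually_both hz, eventually_both hV, eventually_both hW,
    eventually_both (htend' (Metric.closedBall_mem_nhds _ (half_pos hη))),
    eventually_both (Ioi_mem_nhds hα)]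
    with p hTc hmeet hlt' htg htg' hg hb hz hV hW ht hp0 hlt
  obtain ⟨ρ, M, hρ, hsl, hL⟩ := arc_match H hu hp0.1 hp0.2 hg.1 hg.2 (hlt' hlt) htg.1 htg'.1 htg'.2
    (hTc hlt).2
  obtain ⟨t, htm, hρt⟩ := hmeet hlt ρ M hρ
  have r1 : |Tk u (i + 1) p.1 - T'| ≤ η / 2 := ht.1
  have r2 : |Tk u (i + 1) p.2 - T'| ≤ η / 2 := ht.2
  rw [abs_le] at r1 r2
  have hΔ : 0 < p.2 - p.1 := sub_pos.2 hlt
  set Δ := p.2 - p.1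
  have S₁ := isSol_vb H hu hp0.1 (i + 1)
  have S₂ := isSol_vb H hu hp0.2 (i + 1)
  have g2 := hg.2.mono i.le_succ
  have s2 := hg.2 i i.lt_succ_self
  have n2 := g2.T_nonneg
  have hw1 : wb u (i + 1) p.1 (Tk u (i + 1) p.1) = 0 := wb_eq_zero.2 (hg.1.crit hu hp0.1)
  set T₁ := Tk u (i + 1) p.1
  set T₂ := Tk u (i + 1) p.2
  set tb := T' - η with htb
  have hT1I : T₁ ∈ Icc (Tk u i p.1) T₁ := ⟨by linarith [htm.1, htm.2], le_rfl⟩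
  have htbI : tb ∈ Icc (Tk u i p.1) T₁ := ⟨htm.1.trans htm.2, by linarith⟩
  have ls := hL ⟨t, ⟨htm.1, by linarith [htm.2]⟩, hρt⟩
  have hanti := (s2.v_anti g2 H hu hp0.2).antitoneOn
  have hρtb : ρ tb ≤ tb := by
    have := (M.sub_id_strictAnti hsl).antitoneOn ⟨htm.1, by linarith [htm.2]⟩ htbI htm.2
    linarith
  have hD0 : vb u (i + 1) p.1 tb ≤ vb u (i + 1) p.2 tb := by
    have h := hanti ⟨(hρ tb htbI).1.le, (hρ tb htbI).2.le⟩
      ⟨(hρ tb htbI).1.le.trans hρtb, by linarith⟩ hρtb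
    rw [M.val tb htbI] at h
    rw [vb_succ, vb_succ]; linarith
  have hval : vb u (i + 1) p.2 (ρ T₁) = vb u (i + 1) p.1 T₁ := by
    rw [vb_succ, vb_succ, M.val T₁ hT1I]
  have hβ1 : β < vb u (i + 1) p.1 T₁ := htg'.1
  have hQe : Qv n f β (ρ T₁) (vb u (i + 1) p.1 T₁) (wb u (i + 1) p.2 (ρ T₁)) ≤
      Qv n f β T₁ (vb u (i + 1) p.1 T₁) (wb u (i + 1) p.1 T₁) := by
    rw [vb_succ, wb_succ, wb_succ]
    refine ls.Q ?_
    rw [vb_succ] at hβ1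
    linarith
  have hρp : 0 ≤ ρ T₁ := n2.trans (hρ T₁ hT1I).1.le
  have hup : ∀ s ∈ Icc (ρ T₁) T₂, β < vb u (i + 1) p.2 s := fun s hs => by
    have h := hanti ⟨(hρ T₁ hT1I).1.le, (hρ T₁ hT1I).2.le⟩
      ⟨(hρ T₁ hT1I).1.le.trans hs.1, hs.2⟩ hs.1
    rw [vb_succ] at hval ⊢
    linarith
  have hQr : ∀ r, ρ T₁ ≤ r → (∀ s ∈ Icc T₂ r, β < vb u (i + 1) p.2 s) →
      Qv n f β r (vb u (i + 1) p.2 r) (wb u (i + 1) p.2 r) ≤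
      Qv n f β T₁ (vb u (i + 1) p.1 T₁) (wb u (i + 1) p.1 T₁) := fun r hr h => by
    have hall : ∀ s ∈ Icc (ρ T₁) r, β < vb u (i + 1) p.2 s := fun s hs => by
      rcases le_total s T₂ with h' | h'
      · exact hup s ⟨hs.1, h'⟩
      · exact h s ⟨h', hs.2⟩
    have := S₂.Q_le H hρp hr (fun s hs => (hall s hs).le)
      fun s hs => hall s (Ioo_subset_Icc_self hs)
    rw [hval] at this
    exact this.trans hQe
  have hT2ρ : ρ T₁ < T₂ := (hρ T₁ hT1I).2
  refine ⟨?_, fun r hr hw hvr => ?_⟩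
  swap
  · have := hQr r (hT2ρ.le.trans hr.le) fun s hs => by
      have h := (S₂.strictAntiOn (hρp.trans hT2ρ.le) hw).antitoneOn hs (right_mem_Icc.2 hr.le) hs.2
      linarith
    rwa [hvr] at this
  have hIcc : ∀ r ∈ Icc tb T₁, 0 < r ∧ r ∈ Icc 0 (T' + ηz) ∧ |r - T'| ≤ η := fun r hr =>
    ⟨by linarith [hr.1], ⟨by linarith [hr.1], by linarith [hr.2]⟩,
      abs_le.2 ⟨by linarith [hr.1], by linarith [hr.2]⟩⟩
  have htb0 : 0 < tb := by linarith
  have htbT : tb ≤ T₁ := by linarith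
  have hT1b : T₁ ∈ Icc tb T₁ := right_mem_Icc.2 htbT
  set D := fun r => vb u (i + 1) p.2 r - vb u (i + 1) p.1 r with hD
  set D' := fun r => wb u (i + 1) p.2 r - wb u (i + 1) p.1 r with hD'
  have hDc : ContinuousOn D (Icc tb T₁) :=
    (S₂.cont.sub S₁.cont).mono fun r hr => htb0.le.trans hr.1
  have hD'c : ContinuousOn D' (Icc tb T₁) :=
    (S₂.dcont.sub S₁.dcont).mono fun r hr => htb0.le.trans hr.1
  have hDd : ∀ r ∈ Ioo tb T₁, HasDerivAt D (D' r) r := fun r hr =>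
    (S₂.d1 r (htb0.trans hr.1)).sub (S₁.d1 r (htb0.trans hr.1))
  have hDb : D T₁ ≥ -(c * Δ / 2) := by
    have h := mul_le_sub_of_le_hasDerivAt htbT hDc hDd (m := -(C * Δ)) fun r hr =>
      (abs_le.1 (hb hlt r (hIcc r (Ioo_subset_Icc_self hr)).2.1).2.1).1
    have h1 : C * Δ * (T₁ - tb) ≤ C * Δ * (2 * η) :=
      mul_le_mul_of_nonneg_left (by linarith) (by positivity)
    have h2 : η * (4 * C) * Δ ≤ c * Δ := mul_le_mul_of_nonneg_right qc hΔ.le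
    have h3 : 0 ≤ D tb := sub_nonneg.2 hD0
    linarith
  have hcΔ : 0 < c * Δ := mul_pos hcp hΔ
  change min c (c₂ * η / 4) * Δ ≤ D T₁
  rcases le_or_gt (c * Δ) |D T₁| with hcase | hcase
  · have h1 : min c (c₂ * η / 4) * Δ ≤ c * Δ :=
      mul_le_mul_of_nonneg_right (min_le_left _ _) hΔ.le
    rcases le_total 0 (D T₁) with h0 | h0
    · rw [abs_of_nonneg h0] at hcase; linarith
    · rw [abs_of_nonpos h0] at hcase; linarith
  have hb3 := (hb hlt T₁ (hIcc T₁ hT1b).2.1).2.2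
  have hpD : D' T₁ = wb u (i + 1) p.2 T₁ := by simp only [hD', hw1, sub_zero]
  have hslope : c₂ * Δ < |D' T₁| := by
    have h1 : C * |D T₁| < C * (c₂ * Δ) := mul_lt_mul_of_pos_left
      (hcase.trans_le (mul_le_mul_of_nonneg_right (min_le_right _ _) hΔ.le)) hC
    have h2 : C * (c₂ * Δ) = Δ / 2 := by rw [← mul_assoc, hc₂e]; ring
    have h3 : Δ ≤ C * |D T₁| + C * |D' T₁| := by rw [← mul_add]; exact hb3
    exact lt_of_mul_lt_mul_left (a := C) (by linarith) hC.le
  have hVI : ∀ q, (q = p.1 ∨ q = p.2) → ∀ r ∈ Icc tb T₁,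
      |vb u (i + 1) q r - s₀| ≤ min ε εf := by
    rintro q (rfl | rfl) r hr
    · exact hV.1 r (hIcc r hr).1.le ((hIcc r hr).2.2.trans qv)
    · exact hV.2 r (hIcc r hr).1.le ((hIcc r hr).2.2.trans qv)
  have hpos : c₂ * Δ < D' T₁ := by
    rcases le_total 0 (D' T₁) with h0 | h0
    · rwa [abs_of_nonneg h0] at hslope
    exfalso
    rw [abs_of_nonpos h0] at hslope
    have hQ := hQr T₁ ls.le fun s hs => hβ'.trans (hz.2 s (by linarith [hs.1])
      (abs_le.2 ⟨by linarith [hs.1], by linarith [hs.2]⟩)).1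
    rw [hw1, ← hpD] at hQ
    have hwε : |D' T₁| ≤ ε := by
      have := hW.2 T₁ (hIcc T₁ hT1b).1.le ((hIcc T₁ hT1b).2.2.trans qw)
      rw [hpD]
      simpa using this
    have := hgap T₁ _ _ _ Δ ((hIcc T₁ hT1b).2.2.trans qε)
      ((hVI p.1 (Or.inl rfl) T₁ hT1b).trans (min_le_left _ _))
      ((hVI p.2 (Or.inr rfl) T₁ hT1b).trans (min_le_left _ _)) hwε (by linarith) hQ hΔ
    have h2 : c * Δ ≤ c₀ * Δ := mul_le_mul_of_nonneg_right (min_le_left _ _) hΔ.le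
    exact absurd (hcase.trans_le h2) (not_lt.2 this)
  have hlow : ∀ r ∈ Icc tb T₁, c₂ * Δ / 2 ≤ D' r := fun r hr => by
    have hsub : ∀ s ∈ Ioo r T₁, s ∈ Icc tb T₁ := fun s hs => ⟨hr.1.trans hs.1.le, hs.2.le⟩
    have h := mul_le_sub_of_le_hasDerivAt hr.2 (hD'c.mono (Icc_subset_Icc_left hr.1)).neg
      (fun s hs => ((S₂.d2 s (hIcc s (hsub s hs)).1).sub
        (S₁.d2 s (hIcc s (hsub s hs)).1)).neg) (m := -(C₃ * Δ)) fun s hs => by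
      have hs' := hsub s hs
      have hb' := hb hlt s (hIcc s hs').2.1
      have hs0 := (hIcc s hs').1
      have h1 : |f (vb u (i + 1) p.2 s) - f (vb u (i + 1) p.1 s)| ≤ Kf * (C * Δ) :=
        (hfl _ _ ((hVI p.1 (Or.inl rfl) s hs').trans (min_le_right _ _))
          ((hVI p.2 (Or.inr rfl) s hs').trans (min_le_right _ _))).trans
          (mul_le_mul_of_nonneg_left hb'.1 hKf)
      have h2 : |((n : ℝ) - 1) / s * (wb u (i + 1) p.2 s - wb u (i + 1) p.1 s)| ≤
          ((n : ℝ) - 1) / (T' / 2) * (C * Δ) := by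
        rw [abs_mul, abs_of_nonneg (div_nonneg (by linarith) hs0.le)]
        refine mul_le_mul (div_le_div_of_nonneg_left (by linarith) (by linarith) ?_) hb'.2.1
          (abs_nonneg _) (div_nonneg (by linarith) (by linarith))
        linarith [hs'.1]
      have h3 : C₃ * Δ = ((n : ℝ) - 1) / (T' / 2) * (C * Δ) + Kf * (C * Δ) := by
        rw [hC₃]; ring
      have h4 := (abs_le.1 h1).1
      have h5 := (abs_le.1 h2).1
      rw [h3]
      linarith
    have h1 : C₃ * Δ * (T₁ - r) ≤ C₃ * Δ * (2 * η) :=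
      mul_le_mul_of_nonneg_left (by linarith [hr.1]) (by positivity)
    have h2 : η * (4 * C₃) * Δ ≤ c₂ * Δ := mul_le_mul_of_nonneg_right qc' hΔ.le
    simp only [Pi.neg_apply] at h
    linarith
  have h := mul_le_sub_of_le_hasDerivAt htbT hDc hDd (m := c₂ * Δ / 2) fun r hr =>
    hlow r (Ioo_subset_Icc_self hr)
  have h3 : 0 ≤ D tb := sub_nonneg.2 hD0
  have h4 : c₂ * Δ / 2 * (η / 2) ≤ c₂ * Δ / 2 * (T₁ - tb) :=
    mul_le_mul_of_nonneg_left (by linarith) (by positivity)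
  have h5 : min c (c₂ * η / 4) * Δ ≤ c₂ * η / 4 * Δ :=
    mul_le_mul_of_nonneg_right (min_le_right _ _) hΔ.le
  linarith

theorem topInv_of_good (H : Nonlin n f b β) (hu : Family n f u) (hα : 0 < αs) {i : ℕ}
    (hgs : Good u i αs) (hv : ∀ j ≤ i, β < vb u j αs (Tk u j αs)) : TopInv n f β u αs i := by
  induction i with
  | zero =>
    refine topInv_zero H hu ?_
    have := hv 0 le_rfl
    rwa [vb, pow_zero, one_mul, Tk_zero, Family.zero_val hu hα] at this
  | succ i ih =>
    exact (ih (hgs.mono i.le_succ) fun j hj => hv j (by omega)).succ H hu hα hgs hv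

/-- The radii strictly below `Z_{i+1} α`. -/
def Before (u : ℝ → ℝ → ℝ) (i : ℕ) (α t : ℝ) : Prop := ∃ r ∈ ZsetK u (i + 1) α, t < r

theorem Before.props {i : ℕ} {α t : ℝ} (h : Before u i α t) (hT : Tk u i α < t) :
    0 < vb u i α t ∧ wb u i α t < 0 := by
  obtain ⟨r, hr, htr⟩ := h
  exact ZsetK_props hr ⟨hT, htr⟩

theorem Before.of_le {i : ℕ} {α s t : ℝ} (h : Before u i α t) (hs : s ≤ t) :
    Before u i α s := by
  obtain ⟨r, hr, htr⟩ := h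
  exact ⟨r, hr, hs.trans_lt htr⟩

theorem Before.lt_Z {i : ℕ} {α t : ℝ} (h : Before u i α t)
    (hb : BddAbove (ZsetK u (i + 1) α)) : t < Zk u (i + 1) α := by
  obtain ⟨r, hr, htr⟩ := h
  exact htr.trans_le (le_csSup hb hr)

theorem before_of_lt_Z {i : ℕ} {α t : ℝ} (hne : (ZsetK u (i + 1) α).Nonempty)
    (h : t < Zk u (i + 1) α) : Before u i α t := exists_lt_of_lt_csSup hne h

theorem before_of_unbounded {i : ℕ} {α : ℝ} (hb : ¬BddAbove (ZsetK u (i + 1) α)) (t : ℝ) :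
    Before u i α t := by
  rw [not_bddAbove_iff] at hb
  exact hb t

/-- The branch after the `i`-th extremum decreases to zero. -/
structure Landing (u : ℝ → ℝ → ℝ) (i : ℕ) (α : ℝ) : Prop where
  pos : 0 < α
  good : Good u i α
  zero : uAtZ u (i + 1) α = 0

theorem landing_of_mem (H : Nonlin n f b β) (hu : Family n f u) {i : ℕ} {α : ℝ}
    (h : α ∈ Gk u (i + 1) ∪ Nk u (i + 1)) : Landing u i α := by
  rcases h with h | h
  · obtain ⟨h1, h2, h3, -⟩ := Gk_succ_iff.1 h
    exact ⟨Nk_pos h1, good_of_mem H hu h1 h2, h3⟩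
  · obtain ⟨h1, h2, h3, -⟩ := Nk_succ_iff.1 h
    exact ⟨Nk_pos h1, good_of_mem H hu h1 h2, h3⟩

theorem Landing.nonempty {i : ℕ} {α : ℝ} (h : Landing u i α) (hu : Family n f u) :
    (ZsetK u (i + 1) α).Nonempty := ZsetK_nonempty_of_uAtZ hu h.pos h.zero

theorem Landing.v_Z {i : ℕ} {α : ℝ} (h : Landing u i α)
    (hb : BddAbove (ZsetK u (i + 1) α)) : vb u i α (Zk u (i + 1) α) = 0 := by
  have := h.zero
  unfold uAtZ at this
  rw [if_pos hb] at this
  exact vb_eq_zero.2 this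

theorem Landing.tendsto {i : ℕ} {α : ℝ} (h : Landing u i α) (H : Nonlin n f b β)
    (hu : Family n f u) (hb : ¬BddAbove (ZsetK u (i + 1) α)) :
    Tendsto (vb u i α) atTop (𝓝 0) ∧ Tendsto (wb u i α) atTop (𝓝 0) := by
  obtain ⟨⟨L, -, hL⟩, hw⟩ := limUnder_wb_zero h.good H hu h.pos hb
  refine ⟨?_, hw⟩
  have h0 := h.zero
  unfold uAtZ at h0
  rw [if_neg hb, (tendsto_of_vb hL).limUnder_eq] at h0
  have : L = 0 := by simpa using h0
  rwa [this] at hL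

theorem Landing.T_before {i : ℕ} {α : ℝ} (h : Landing u i α) (hu : Family n f u) :
    Before u i α (Tk u i α) := by
  obtain ⟨r, hr⟩ := h.nonempty hu
  exact ⟨r, hr, (mem_ZsetAux_iff.1 hr).1⟩

theorem Before.exists_gt {i : ℕ} {α t : ℝ} (ht : Before u i α t) :
    ∃ s, Before u i α s ∧ t < s := by
  obtain ⟨r, hr, htr⟩ := ht
  exact ⟨(t + r) / 2, ⟨r, hr, by linarith⟩, by linarith⟩

/-- The branch takes arbitrarily small values. -/
theorem Landing.exists_small {i : ℕ} {α : ℝ} (h : Landing u i α) (H : Nonlin n f b β)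
    (hu : Family n f u) {ε t : ℝ} (hε : 0 < ε) (ht : Before u i α t) :
    ∃ y, Before u i α y ∧ t < y ∧ Tk u i α < y ∧ vb u i α y < ε := by
  by_cases hb : BddAbove (ZsetK u (i + 1) α)
  · have hTZ := (h.T_before hu).lt_Z hb
    have htZ := ht.lt_Z hb
    have hZ0 := h.good.T_nonneg.trans_lt hTZ
    have hc := ((isSol_vb H hu h.pos i).cont.continuousAt (Ici_mem_nhds hZ0))
    have h1 : ∀ᶠ y in 𝓝[<] (Zk u (i + 1) α), vb u i α y < ε :=
      nhdsWithin_le_nhds (hc (Iio_mem_nhds (by rw [h.v_Z hb]; exact hε)))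
    obtain ⟨y, hy, h2⟩ := (h1.and (Ioo_mem_nhdsLT (max_lt hTZ htZ))).exists
    exact ⟨y, before_of_lt_Z (h.nonempty hu) h2.2, (le_max_right _ _).trans_lt h2.1,
      (le_max_left _ _).trans_lt h2.1, hy⟩
  · obtain ⟨y, hy, h1, h2⟩ := (((h.tendsto H hu hb).1.eventually_lt_const hε).and
      ((eventually_gt_atTop t).and (eventually_gt_atTop (Tk u i α)))).exists
    exact ⟨y, before_of_unbounded hb y, h1, h2, hy⟩

theorem Landing.En_nonneg {i : ℕ} {α : ℝ} (h : Landing u i α) (H : Nonlin n f b β)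
    (hu : Family n f u) {t : ℝ} (h0 : 0 ≤ t) (ht : Before u i α t) :
    0 ≤ En f (vb u i α) (wb u i α) t := by
  have S := isSol_vb H hu h.pos i
  by_cases hb : BddAbove (ZsetK u (i + 1) α)
  · have h1 := S.En_antitoneOn H h0 (h0.trans (ht.lt_Z hb).le) (ht.lt_Z hb).le
    refine le_trans ?_ h1
    rw [En, h.v_Z hb, H.F_zero]
    positivity
  · obtain ⟨h1, h2⟩ := h.tendsto H hu hb
    have h3 : Tendsto (En f (vb u i α) (wb u i α)) atTop (𝓝 0) := by
      have := ((h2.pow 2).div_const 2).add ((H.continuous_F.tendsto 0).comp h1)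
      rw [H.F_zero] at this
      refine (this.congr fun _ => rfl).trans_eq ?_
      norm_num
    exact le_of_tendsto (h3.comp (tendsto_atTop_mono (fun x => le_max_right t x) tendsto_id))
      (Eventually.of_forall fun x => S.En_antitoneOn H h0 (h0.trans (le_max_left t x))
        (le_max_left t x))

theorem Landing.En_pos {i : ℕ} {α : ℝ} (h : Landing u i α) (H : Nonlin n f b β)
    (hu : Family n f u) (j : ℕ) {t : ℝ} (h0 : 0 ≤ t) (ht : Before u i α t) :
    0 < En f (vb u j α) (wb u j α) t := by
  rw [En_vb H j, ← En_vb H i]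
  have S := isSol_vb H hu h.pos i
  have hT0 := h.good.T_nonneg
  have hm : Before u i α (max t (Tk u i α)) := by
    rcases max_choice t (Tk u i α) with e | e <;> rw [e]
    exacts [ht, h.T_before hu]
  obtain ⟨s, hs, hts⟩ := Before.exists_gt hm
  have hm0 : 0 ≤ max t (Tk u i α) := h0.trans (le_max_left _ _)
  have h1 := S.En_antitoneOn H h0 hm0 (le_max_left _ _)
  have h2 := strictAntiOn_of_hasDerivAt_neg ((S.continuousOn_En H).mono fun r hr => hm0.trans hr.1)
    (fun r hr => S.hasDerivAt_En H (hm0.trans_lt hr.1)) (fun r hr => by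
      have hr0 := hm0.trans_lt hr.1
      have hw := (hs.of_le hr.2.le).props ((le_max_right _ _).trans_lt hr.1)
      have := H.one_le
      have : 0 < ((n : ℝ) - 1) / r := div_pos (by linarith) hr0
      have := mul_pos this (pow_pos (neg_pos.2 hw.2) 2)
      rw [neg_sq] at this
      linarith) (left_mem_Icc.2 hts.le) (right_mem_Icc.2 hts.le) hts
  exact ((h.En_nonneg H hu (hm0.trans hts.le) hs).trans_lt h2).trans_le h1

theorem Good.T_le {i j : ℕ} {α : ℝ} (h : Good u i α) (hj : j ≤ i) : Tk u j α ≤ Tk u i α := by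
  induction i, hj using Nat.le_induction with
  | base => exact le_rfl
  | succ i hi ih =>
    have s := h i i.lt_succ_self
    exact (ih (h.mono i.le_succ)).trans (s.T_lt_Z.trans s.Z_lt_T).le

theorem Landing.tops {i : ℕ} {α : ℝ} (h : Landing u i α) (H : Nonlin n f b β)
    (hu : Family n f u) (j : ℕ) (hj : j ≤ i) : β < vb u j α (Tk u j α) := by
  have g := h.good.mono hj
  refine g.top_gt H hu h.pos ?_
  have := h.En_pos H hu 0 g.T_nonneg ((h.T_before hu).of_le (h.good.T_le hj))
  rwa [En_vb H 0] at this

theorem Landing.biLip {i : ℕ} (h : Landing u i αs) (H : Nonlin n f b β) (hu : Family n f u)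
    {R : ℝ} (hR : Before u i αs R) : BiLip u αs R := by
  refine Paper.biLip H hu h.pos fun r hr hrR => ?_
  by_contra hc
  push Not at hc
  have := h.En_pos H hu 0 hr.le (hR.of_le hrR)
  rw [En, vb_eq_zero.2 hc.1, wb_eq_zero.2 hc.2, H.F_zero] at this
  norm_num at this

theorem IsSol.hasDerivAt_flux {v w : ℝ → ℝ} (S : IsSol n f v w) (H : Nonlin n f b β) {r : ℝ}
    (hr : 0 < r) : HasDerivAt (fun t => t ^ (n - 1) * w t) (-(r ^ (n - 1) * f (v r))) r := by
  obtain ⟨m, rfl⟩ : ∃ m, n = m + 2 := ⟨n - 2, by have := H.two_le; omega⟩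
  refine ((hasDerivAt_pow (m + 2 - 1) r).mul (S.d2 r hr)).congr_deriv ?_
  have e : m + 2 - 1 = m + 1 := rfl
  rw [e]
  simp only [Nat.add_sub_cancel]
  push_cast
  field_simp
  ring

/-- The inverse flux of a solution landing at zero with zero slope has divergent integral. -/
theorem Landing.exists_primitive {i : ℕ} (h : Landing u i αs) (H : Nonlin n f b β)
    (hu : Family n f u) (hd : duAtZ u (i + 1) αs = 0) {t₁ : ℝ} (ht₁ : Tk u i αs < t₁)
    (hb₁ : Before u i αs t₁) (hv : vb u i αs t₁ ≤ b) {A : ℝ} (hA : 0 ≤ A) :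
    ∃ R, Before u i αs R ∧ t₁ < R ∧ ∃ Φ φ : ℝ → ℝ, ContinuousOn Φ (Icc t₁ R) ∧
      (∀ t ∈ Ioo t₁ R, HasDerivAt Φ (φ t) t) ∧
      (∀ t ∈ Ioo t₁ R, φ t * (t ^ (n - 1) * -wb u i αs t) ≤ 1) ∧ A ≤ Φ R - Φ t₁ := by
  have S := isSol_vb H hu h.pos i
  have ht0 : 0 < t₁ := h.good.T_nonneg.trans_lt ht₁
  by_cases hb : BddAbove (ZsetK u (i + 1) αs)
  · set Z := Zk u (i + 1) αs with hZ
    have hlt := hb₁.lt_Z hb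
    have hwZ : wb u i αs Z = 0 := by
      unfold duAtZ at hd
      rw [if_pos hb] at hd
      exact wb_eq_zero.2 hd
    have hc : ContinuousOn (fun r => ((n : ℝ) - 1) / r * wb u i αs r + f (vb u i αs r))
        (Icc t₁ Z) := by
      refine ((continuousOn_const.div continuousOn_id fun r hr => (ht0.trans_le hr.1).ne').mul
        (S.dcont.mono fun r hr => ht0.le.trans hr.1)).add
        (H.cont.comp_continuousOn (S.cont.mono fun r hr => ht0.le.trans hr.1))
    obtain ⟨M₀, hM₀⟩ := isCompact_Icc.exists_bound_of_continuousOn hc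
    set M := max M₀ 1
    have hM : 0 < M := lt_max_of_lt_right one_pos
    have hZ0 : 0 < Z := ht0.trans hlt
    have hB : 0 < Z ^ (n - 1) * M := by positivity
    set B := Z ^ (n - 1) * M
    have hw : ∀ t ∈ Icc t₁ Z, -wb u i αs t ≤ M * (Z - t) := fun t ht => by
      have := mul_le_sub_of_le_hasDerivAt ht.2 (S.dcont.mono fun r hr => ht0.le.trans
        (ht.1.trans hr.1)).neg (fun r hr => (S.d2 r (ht0.trans_le (ht.1.trans hr.1.le))).neg)
        (m := -M) fun r hr => by
        have h1 := hM₀ r ⟨ht.1.trans hr.1.le, hr.2.le⟩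
        have h2 := (abs_le.1 h1).1
        have h3 : M₀ ≤ M := le_max_left _ _
        linarith
      simp only [Pi.neg_apply, hwZ] at this
      linarith
    set R := Z - (Z - t₁) * Real.exp (-(A * B + 1)) with hR
    have hd0 : 0 < Z - t₁ := sub_pos.2 hlt
    have he : Real.exp (-(A * B + 1)) < 1 := by
      rw [Real.exp_lt_one_iff]
      have := mul_nonneg hA hB.le
      linarith
    have hRZ : R < Z := by have := mul_pos hd0 (Real.exp_pos (-(A * B + 1))); linarith
    have hRt : t₁ < R := by have := mul_lt_mul_of_pos_left he hd0; linarith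
    refine ⟨R, before_of_lt_Z (h.nonempty hu) hRZ, hRt, fun t => -Real.log (Z - t) / B,
      fun t => 1 / (B * (Z - t)), ?_, ?_, ?_, ?_⟩
    · refine ((ContinuousOn.log (continuousOn_const.sub continuousOn_id) fun t ht => ?_).neg).div_const B
      have : (0 : ℝ) < Z - t := by linarith [ht.2]
      exact this.ne'
    · intro t ht
      have h1 : 0 < Z - t := by linarith [ht.2]
      have := ((((hasDerivAt_id t).const_sub Z).log h1.ne').neg).div_const B
      refine this.congr_deriv ?_
      simp only [id]
      field_simp
    · intro t ht
      have h1 : 0 < Z - t := by linarith [ht.2]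
      rw [one_div_mul_eq_div, div_le_one (by positivity)]
      have h2 : t ^ (n - 1) ≤ Z ^ (n - 1) :=
        pow_le_pow_left₀ (ht0.trans ht.1).le (ht.2.trans hRZ).le _
      have h3 := hw t ⟨ht.1.le, (ht.2.trans hRZ).le⟩
      have h4 := (before_of_lt_Z (h.nonempty hu) (ht.2.trans hRZ)).props (ht₁.trans ht.1)
      calc t ^ (n - 1) * -wb u i αs t ≤ Z ^ (n - 1) * (M * (Z - t)) :=
            mul_le_mul h2 h3 (by linarith [h4.2]) (by positivity)
        _ = B * (Z - t) := by ring
    · have e : Z - R = (Z - t₁) * Real.exp (-(A * B + 1)) := by rw [hR]; ring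
      simp only [e, Real.log_mul hd0.ne' (Real.exp_pos _).ne', Real.log_exp]
      rw [← sub_div, le_div_iff₀ hB]
      linarith
  · have hB : 0 < t₁ ^ (n - 1) * -wb u i αs t₁ :=
      mul_pos (pow_pos ht0 _) (neg_pos.2 (hb₁.props ht₁).2)
    set B := t₁ ^ (n - 1) * -wb u i αs t₁
    have hAB : 0 ≤ A * B := mul_nonneg hA hB.le
    refine ⟨t₁ + A * B + 1, before_of_unbounded hb _, by linarith, fun t => t / B,
      fun _ => 1 / B, continuousOn_id.div_const B, fun t _ => (hasDerivAt_id t).div_const B, ?_, ?_⟩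
    · intro t ht
      rw [one_div_mul_eq_div, div_le_one hB]
      have hmono := monotoneOn_of_hasDerivAt_nonneg
        (((continuous_pow (n - 1)).continuousOn.mul
          (S.dcont.mono fun r (hr : r ∈ Icc t₁ t) => ht0.le.trans hr.1)))
        (fun r hr => S.hasDerivAt_flux H (ht0.trans hr.1)) fun r hr => by
          have hv1 := (before_of_unbounded hb r).props (ht₁.trans hr.1)
          have hv2 : vb u i αs r ≤ vb u i αs t₁ := ((S.strictAntiOn ht0.le fun s hs =>
            ((before_of_unbounded hb s).props (ht₁.trans hs.1)).2).antitoneOn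
            (left_mem_Icc.2 hr.1.le) (right_mem_Icc.2 hr.1.le) hr.1.le)
          have := H.f_nonpos hv1.1.le (hv2.trans hv)
          have := mul_nonneg (pow_nonneg (ht0.trans hr.1).le (n - 1)) (neg_nonneg.2 this)
          linarith
      have := hmono (left_mem_Icc.2 ht.1.le) (right_mem_Icc.2 ht.1.le) ht.1.le
      simp only [Pi.mul_apply] at this
      simp only [B]
      linarith
    · rw [← sub_div, le_div_iff₀ hB]
      linarith

/-- Nearby solutions stay positive and decreasing on a fixed part of the last branch. -/
theorem eventually_branch (H : Nonlin n f b β) (hu : Family n f u) {i : ℕ}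
    (h : Landing u i αs) (hg : ∀ᶠ α in 𝓝 αs, Good u i α)
    (htend : Tendsto (Tk u i) (𝓝 αs) (𝓝 (Tk u i αs))) {R : ℝ}
    (hR : Before u i αs R) : ∀ᶠ α in 𝓝 αs, ∀ r ∈ Ioc (Tk u i α) R,
      0 < vb u i α r ∧ wb u i α r < 0 := by
  have hα := h.pos
  have hT0 := h.good.T_nonneg
  have hβ0 := H.β_pos
  obtain ⟨β', hβ', κ, hκ, η, hη, hz⟩ := zone H hu hα i hT0 (h.tops H hu i le_rfl)
    (wb_eq_zero.2 (h.good.crit hu hα))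
  have hη2 := half_pos hη
  have e1 := eventually_on_Icc (continuousOn_vb hu i) hα (A := Tk u i αs + η / 2) (B := R)
    (by linarith) fun r hr => ((hR.of_le hr.2).props (by linarith [hr.1])).1
  have e2 := eventually_on_Icc (continuousOn_wb hu i).neg hα (A := Tk u i αs + η / 2) (B := R)
    (by linarith) fun r hr => neg_pos.2 ((hR.of_le hr.2).props (by linarith [hr.1])).2
  filter_upwards [e1, e2, hz, hg, htend (Metric.closedBall_mem_nhds _ hη2), Ioi_mem_nhds hα]
    with α e1 e2 hz hg ht hp r hr
  have ht' : |Tk u i α - Tk u i αs| ≤ η / 2 := ht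
  rw [abs_le] at ht'
  have hn := hg.T_nonneg
  rcases le_total r (Tk u i αs + η / 2) with hc | hc
  · have hin : ∀ s ∈ Ioc (Tk u i α) r, |s - Tk u i αs| ≤ η := fun s hs =>
      abs_le.2 ⟨by linarith [hs.1], by linarith [hs.2]⟩
    refine ⟨by linarith [(hz r (hn.trans_lt hr.1) (hin r ⟨hr.1, le_rfl⟩)).1], ?_⟩
    have := (isSol_vb H hu hp i).slope_strictAntiOn (x := Tk u i α) (y := r) hκ hn
      (fun s hs => (hz s (hn.trans_lt hs.1) (hin s ⟨hs.1, hs.2.le⟩)).2)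
      (left_mem_Icc.2 hr.1.le) (right_mem_Icc.2 hr.1.le) hr.1
    rwa [wb_eq_zero.2 (hg.crit hu hp)] at this
  · exact ⟨e1 r ⟨hc, hr.2⟩, neg_pos.1 (e2 r ⟨hc, hr.2⟩)⟩

/-- As long as two decreasing solutions stay ordered, an initial gap between their squared
slopes persists. -/
theorem slope_gap_of_lt {v₁ w₁ v₂ w₂ : ℝ → ℝ} (H : Nonlin n f b β) (S₁ : IsSol n f v₁ w₁)
    (S₂ : IsSol n f v₂ w₂) {T₁ T₂ t₀ τ c : ℝ} (n₁ : 0 ≤ T₁) (n₂ : 0 ≤ T₂) (l₁ : T₁ < t₀)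
    (l₂ : T₂ < t₀) (hτ : t₀ < τ) (hw₁ : ∀ t ∈ Ioo T₁ τ, w₁ t < 0) (hw₂ : ∀ t ∈ Ioo T₂ τ, w₂ t < 0)
    (htop : v₁ T₁ < v₂ T₂) (hlt : ∀ t ∈ Icc t₀ τ, v₁ t < v₂ t) (hv : v₂ τ < v₁ t₀)
    (h0 : 0 ≤ v₁ τ) (hb : v₂ τ ≤ b) (hc : 0 ≤ c)
    (hex : ∀ r, t₀ < r → r ≤ τ → v₂ r = v₁ t₀ → c ≤ w₂ r ^ 2 - w₁ t₀ ^ 2) :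
    t₀ ^ (n - 1) * c ≤ τ ^ (n - 1) * (w₂ τ ^ 2 - w₁ τ ^ 2) := by
  have hτ0 : 0 ≤ τ := n₁.trans (l₁.trans hτ).le
  obtain ⟨y, hy, hyv⟩ := intermediate_value_Icc' hτ.le
    (S₁.cont.mono fun t ht => n₁.trans (l₁.le.trans ht.1))
    (show v₂ τ ∈ Icc _ _ from ⟨(hlt τ ⟨hτ.le, le_rfl⟩).le, hv.le⟩)
  have hy0 : t₀ < y := hy.1.lt_of_ne (by rintro rfl; linarith)
  have hyτ : y < τ := hy.2.lt_of_ne (by rintro rfl; linarith [hlt y ⟨hτ.le, le_rfl⟩])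
  have a₂ := S₂.strictAntiOn n₂ hw₂
  obtain ⟨ρ, M, m1, m2⟩ := exists_matched S₁ S₂ n₁ (l₁.trans hy0) n₂ (l₂.trans hτ)
    (fun t ht => hw₁ t ⟨ht.1, ht.2.trans hyτ⟩) hw₂ htop hyv.ge
  have hρy : ρ y = τ := by
    have hm := right_mem_Icc.2 (l₁.trans hy0).le
    exact a₂.injOn ⟨(m1 y hm).1.le, (m1 y hm).2⟩ ⟨(l₂.trans hτ).le, le_rfl⟩
      ((M.val y hm).trans hyv)
  have hρ : ∀ t ∈ Icc t₀ y, t < ρ t := fun t ht => by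
    have hm : t ∈ Icc T₁ y := ⟨l₁.le.trans ht.1, ht.2⟩
    by_contra hcon
    have := a₂.antitoneOn ⟨(m1 t hm).1.le, (m1 t hm).2⟩
      ⟨l₂.le.trans ht.1, ht.2.trans hyτ.le⟩ (not_lt.1 hcon)
    rw [M.val t hm] at this
    linarith [hlt t ⟨ht.1, ht.2.trans hyτ.le⟩]
  have hm0 : t₀ ∈ Icc T₁ y := ⟨l₁.le, hy0.le⟩
  have h1 := hex (ρ t₀) (hρ t₀ ⟨le_rfl, hy0.le⟩) (m1 t₀ hm0).2 (M.val t₀ hm0)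
  have h2 := (M.sub l₁.le le_rfl).slope_mono H S₁ S₂
    (fun t ht => (hρ t (Ioo_subset_Icc_self ht)).le) (left_mem_Icc.2 hy0.le)
    (right_mem_Icc.2 hy0.le) hy0.le
  simp only [hρy] at h2
  have ht₀ : 0 ≤ t₀ := n₁.trans l₁.le
  have h3 : t₀ ^ (n - 1) * c ≤ y ^ (n - 1) * (w₂ τ ^ 2 - w₁ y ^ 2) :=
    (mul_le_mul_of_nonneg_left h1 (pow_nonneg ht₀ _)).trans h2
  have hyp : 0 < y := ht₀.trans_lt hy0
  have hpos : 0 ≤ w₂ τ ^ 2 - w₁ y ^ 2 := by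
    by_contra hcon
    have := mul_neg_of_pos_of_neg (pow_pos hyp (n - 1)) (not_le.1 hcon)
    have := mul_nonneg (pow_nonneg ht₀ (n - 1)) hc
    linarith
  have hE := S₁.En_antitoneOn H hyp.le hτ0 hyτ.le
  unfold En at hE
  have hlτ := hlt τ ⟨hτ.le, le_rfl⟩
  have hF := H.F_antitoneOn (show v₁ τ ∈ Icc 0 b from ⟨h0, by linarith⟩)
    (show v₁ y ∈ Icc 0 b from ⟨by linarith, by linarith⟩) (by linarith)
  refine h3.trans (mul_le_mul (pow_le_pow_left₀ hyp.le hyτ.le _) ?_ hpos (pow_nonneg hτ0 _))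
  linarith

set_option maxHeartbeats 800000 in
/-- Two solutions close to one landing at zero with zero slope meet on the last branch. -/
theorem TopInv.last_crossing {i : ℕ} (hT : TopInv n f β u αs i) (H : Nonlin n f b β)
    (hu : Family n f u) (h : Landing u i αs) (hd : duAtZ u (i + 1) αs = 0)
    (hg : ∀ᶠ α in 𝓝 αs, Good u i α)
    (htend : Tendsto (Tk u i) (𝓝 αs) (𝓝 (Tk u i αs))) :
    ∃ R, Tk u i αs < R ∧ Before u i αs R ∧ vb u i αs R < b ∧ ∀ᶠ p : ℝ × ℝ in 𝓝 (αs, αs), p.1 < p.2 →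
      ∃ t ≤ R, Tk u i p.1 < t ∧ Tk u i p.2 < t ∧ vb u i p.2 t ≤ vb u i p.1 t := by
  have hα := h.pos
  have hT0 := h.good.T_nonneg
  have hv := h.tops H hu i le_rfl
  obtain ⟨t₁, hB₁, -, hT₁, hv₁⟩ := h.exists_small H hu H.b_pos (h.T_before hu)
  have hBL := h.biLip H hu hB₁
  obtain ⟨c₁, hc₁, t₀, ht₀, ht₀', hex⟩ := hT.excess H hu hα hg htend hv hT₁ hBL
  obtain ⟨C, hC, hbd⟩ := hBL.bounds i
  have ht₀0 : 0 < t₀ := hT0.trans_lt ht₀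
  have ht₁0 : 0 < t₁ := ht₀0.trans ht₀'
  set κ := t₀ ^ (n - 1) * c₁ / 3 with hκdef
  have hκ : 0 < κ := by positivity
  obtain ⟨R, hBR, htR, Φ, φ, hΦc, hΦd, hφ, hA⟩ := h.exists_primitive H hu hd hT₁ hB₁ hv₁.le
    (A := C / κ + 1) (by positivity)
  have hprop : ∀ t, Tk u i αs < t → t ≤ R → 0 < vb u i αs t ∧ wb u i αs t < 0 := fun t h1 h2 =>
    (hBR.of_le h2).props h1
  have hdec : vb u i αs t₁ < vb u i αs t₀ := (isSol_vb H hu hα i).strictAntiOn ht₀0.le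
    (fun s hs => (hprop s (ht₀.trans hs.1) (hs.2.le.trans htR.le)).2) (left_mem_Icc.2 ht₀'.le)
    (right_mem_Icc.2 ht₀'.le) ht₀'
  have hdecR : vb u i αs R < vb u i αs t₁ := (isSol_vb H hu hα i).strictAntiOn ht₁0.le
    (fun s hs => (hprop s (hT₁.trans hs.1) hs.2.le).2) (left_mem_Icc.2 htR.le)
    (right_mem_Icc.2 htR.le) htR
  refine ⟨R, hT₁.trans htR, hBR, hdecR.trans hv₁, ?_⟩
  obtain ⟨m, hm1, hm2⟩ := exists_between hdec
  have e1 := eventually_at (continuousOn_vb hu i) hα ht₀0.le (O := Ioi m) (Ioi_mem_nhds hm2)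
  have e2 := eventually_at (continuousOn_vb hu i) hα ht₁0.le (O := Iio m) (Iio_mem_nhds hm1)
  have e3 := eventually_at (continuousOn_vb hu i) hα ht₁0.le (O := Iio b) (Iio_mem_nhds hv₁)
  have hcw : ContinuousOn (fun p : ℝ × ℝ => wb u i p.1 p.2 - 3 / 2 * wb u i αs p.2)
      (Ioi 0 ×ˢ Ici 0) :=
    (continuousOn_wb hu i).sub (continuousOn_const.mul
      ((isSol_vb H hu hα i).dcont.comp continuousOn_snd fun p hp => hp.2))
  have e4 := eventually_on_Icc hcw hα (A := t₁) (B := R) ht₁0.le fun r hr => by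
    have := (hprop r (hT₁.trans_le hr.1) hr.2).2
    simp only
    linarith
  filter_upwards [hex, hbd, hT.top_lt H hu hα hg htend hv, eventually_both e1, eventually_both e2,
    eventually_both e3, eventually_both e4, eventually_both hg,
    eventually_both (eventually_branch H hu h hg htend hBR),
    eventually_both (htend (Iio_mem_nhds ht₀)), eventually_both (Ioi_mem_nhds hα)]
    with p hex hbd htop e1 e2 e3 e4 hg hbr htd hp0 hlt
  by_contra hcon
  push Not at hcon
  have hΔ : 0 < p.2 - p.1 := sub_pos.2 hlt
  have S₁ := isSol_vb H hu hp0.1 i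
  have S₂ := isSol_vb H hu hp0.2 i
  have l₁ : Tk u i p.1 < t₀ := htd.1
  have l₂ : Tk u i p.2 < t₀ := htd.2
  have hord : ∀ t ∈ Icc t₀ R, vb u i p.1 t < vb u i p.2 t := fun t ht =>
    hcon t ht.2 (l₁.trans_le ht.1) (l₂.trans_le ht.1)
  have hgap : ∀ τ ∈ Ioo t₁ R, κ * (p.2 - p.1) * φ τ ≤ wb u i p.1 τ - wb u i p.2 τ := by
    intro τ hτ
    have hτ0 : 0 < τ := ht₁0.trans hτ.1
    have hanti : vb u i p.2 τ < vb u i p.2 t₁ := S₂.strictAntiOn ht₁0.le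
      (fun s hs => (hbr.2 s ⟨(l₂.trans ht₀').trans hs.1, (hs.2.trans hτ.2).le⟩).2)
      (left_mem_Icc.2 hτ.1.le) (right_mem_Icc.2 hτ.1.le) hτ.1
    have q1 : vb u i p.2 t₁ < m := e2.2
    have q2 : m < vb u i p.1 t₀ := e1.1
    have q3 : vb u i p.2 t₁ < b := e3.2
    have hs := slope_gap_of_lt H S₁ S₂ hg.1.T_nonneg hg.2.T_nonneg l₁ l₂ (ht₀'.trans hτ.1)
      (fun t ht => (hbr.1 t ⟨ht.1, (ht.2.trans hτ.2).le⟩).2)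
      (fun t ht => (hbr.2 t ⟨ht.1, (ht.2.trans hτ.2).le⟩).2) (htop hlt)
      (fun t ht => hord t ⟨ht.1, ht.2.trans hτ.2.le⟩) (by linarith)
      (hbr.1 τ ⟨l₁.trans (ht₀'.trans hτ.1), hτ.2.le⟩).1.le (by linarith)
      (mul_pos hc₁ hΔ).le
      (fun r h1 h2 h3 => hex hlt r h1 (fun s hs =>
        (hbr.2 s ⟨hs.1, (hs.2.trans_le (h2.trans hτ.2.le)).le⟩).2) h3)
    have w1 := (hbr.1 τ ⟨l₁.trans (ht₀'.trans hτ.1), hτ.2.le⟩).2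
    have w2 := (hbr.2 τ ⟨l₂.trans (ht₀'.trans hτ.1), hτ.2.le⟩).2
    have ws := (hprop τ (hT₁.trans hτ.1) hτ.2.le).2
    have b1 := e4.1 τ ⟨hτ.1.le, hτ.2.le⟩
    have b2 := e4.2 τ ⟨hτ.1.le, hτ.2.le⟩
    have hφτ := hφ τ hτ
    set P := τ ^ (n - 1) with hP
    have hP0 : 0 < P := pow_pos hτ0 _
    set g := wb u i p.1 τ - wb u i p.2 τ with hgdef
    set s := -wb u i p.1 τ - wb u i p.2 τ with hsdef
    have hs' : 3 * (κ * (p.2 - p.1)) ≤ P * (g * s) := by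
      have e : wb u i p.2 τ ^ 2 - wb u i p.1 τ ^ 2 = g * s := by rw [hgdef, hsdef]; ring
      rw [e] at hs
      have e' : 3 * (κ * (p.2 - p.1)) = t₀ ^ (n - 1) * (c₁ * (p.2 - p.1)) := by
        rw [hκdef]; ring
      linarith
    have hs0 : 0 < s := by linarith
    have hk : 0 < κ * (p.2 - p.1) := mul_pos hκ hΔ
    have hg0 : 0 < g := by
      by_contra hc
      have := mul_nonpos_of_nonpos_of_nonneg (not_lt.1 hc) hs0.le
      have := mul_nonpos_of_nonneg_of_nonpos hP0.le this
      linarith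
    have hsw : s ≤ 3 * -wb u i αs τ := by linarith
    have h5 : κ * (p.2 - p.1) ≤ g * (P * -wb u i αs τ) := by
      have := mul_le_mul_of_nonneg_left hsw (mul_pos hP0 hg0).le
      nlinarith
    have hPw : 0 < P * -wb u i αs τ := mul_pos hP0 (neg_pos.2 ws)
    refine le_of_mul_le_mul_right ?_ hPw
    calc κ * (p.2 - p.1) * φ τ * (P * -wb u i αs τ)
        = κ * (p.2 - p.1) * (φ τ * (P * -wb u i αs τ)) := by ring
      _ ≤ κ * (p.2 - p.1) * 1 := mul_le_mul_of_nonneg_left hφτ hk.le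
      _ ≤ _ := by rw [mul_one]; exact h5
  have hmono := antitoneOn_of_hasDerivAt_nonpos (x := t₁) (y := R)
    (g := fun t => vb u i p.2 t - vb u i p.1 t + κ * (p.2 - p.1) * Φ t)
    (((S₂.cont.mono fun t ht => ht₁0.le.trans ht.1).sub
      (S₁.cont.mono fun t ht => ht₁0.le.trans ht.1)).add (continuousOn_const.mul hΦc))
    (fun t ht => ((S₂.d1 t (ht₁0.trans ht.1)).sub (S₁.d1 t (ht₁0.trans ht.1))).add
      ((hΦd t ht).const_mul _)) (fun t ht => by linarith [hgap t ht])
    (left_mem_Icc.2 htR.le) (right_mem_Icc.2 htR.le) htR.le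
  simp only at hmono
  have hDR := hord R ⟨(ht₀'.trans htR).le, le_rfl⟩
  have hD1 := (abs_le.1 (hbd hlt t₁ ⟨ht₁0.le, le_rfl⟩).1).2
  have hk : 0 < κ * (p.2 - p.1) := mul_pos hκ hΔ
  have h6 := mul_le_mul_of_nonneg_left hA hk.le
  have h7 : κ * (p.2 - p.1) * (C / κ + 1) = C * (p.2 - p.1) + κ * (p.2 - p.1) := by
    field_simp
  rw [h7] at h6
  linarith

end Paper

namespace Paper

/-- Two solutions in their comparison position at consecutive extrema. -/
structure TopPair (n : ℕ) (f : ℝ → ℝ) (β : ℝ) (v₁ w₁ v₂ w₂ : ℝ → ℝ) (T₁ T₂ : ℝ) : Prop where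
  S₁ : IsSol n f v₁ w₁
  S₂ : IsSol n f v₂ w₂
  nonneg₁ : 0 ≤ T₁
  nonneg₂ : 0 ≤ T₂
  top : v₁ T₁ < v₂ T₂
  gt : β < v₁ T₁
  crit : w₁ T₁ = 0
  Q : ∀ r, T₂ < r → (∀ s ∈ Ioo T₂ r, w₂ s < 0) → v₂ r = v₁ T₁ →
    Qv n f β r (v₁ T₁) (w₂ r) ≤ Qv n f β T₁ (v₁ T₁) (w₁ T₁)

namespace TopPair

variable {n : ℕ} {f v₁ w₁ v₂ w₂ : ℝ → ℝ} {b β T₁ T₂ y q : ℝ}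

theorem exists_matched (P : TopPair n f β v₁ w₁ v₂ w₂ T₁ T₂) (H : Nonlin n f b β)
    (hy : T₁ < y) (hq : T₂ < q) (h1 : ∀ t ∈ Ioo T₁ y, w₁ t < 0) (h2 : ∀ t ∈ Ioo T₂ q, w₂ t < 0)
    (hE : ∀ t ∈ Ico T₁ y, 0 < En f v₁ w₁ t) (hv : v₂ q = v₁ y) :
    ∃ ρ, Matched v₁ w₁ v₂ w₂ ρ T₁ y ∧ (∀ t ∈ Icc T₁ y, ρ t ∈ Ioc T₂ q) ∧
      (∀ t ∈ Icc T₁ y, ∀ r ∈ Icc T₂ q, v₂ r = v₁ t → ρ t = r) ∧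
      ∀ t ∈ Ioo T₁ y, w₂ (ρ t) < w₁ t ∧
        ((∃ s ∈ Icc T₁ t, ρ s ≤ s) → Matched.LeftState n f β v₁ w₁ w₂ ρ t) := by
  obtain ⟨ρ, M, m1, -⟩ := Paper.exists_matched P.S₁ P.S₂ P.nonneg₁ hy P.nonneg₂ hq h1 h2 P.top hv.le
  have hx := left_mem_Icc.2 hy.le
  have hw0 : w₂ (ρ T₁) < w₁ T₁ := by rw [P.crit]; exact M.w2neg _ ⟨le_rfl, hy⟩
  have hX : 0 < T₁ * w₁ T₁ - ρ T₁ * w₂ (ρ T₁) := by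
    rw [P.crit] at hw0 ⊢
    nlinarith [mul_pos (M.pos _ hx) (neg_pos.2 hw0)]
  have hQ0 := P.Q (ρ T₁) (m1 _ hx).1
    (fun s hs => h2 s ⟨hs.1, hs.2.trans_le (m1 _ hx).2⟩) (M.val _ hx)
  refine ⟨ρ, M, m1, fun t ht r hr e => ?_, fun t ht => ?_⟩
  · exact (P.S₂.strictAntiOn P.nonneg₂ h2).injOn ⟨(m1 t ht).1.le, (m1 t ht).2⟩ hr
      ((M.val t ht).trans e.symm)
  · exact (M.sub le_rfl ht.2.le).branch H P.S₁ P.S₂ ht.1 P.gt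
      (fun s hs => hE s ⟨hs.1, hs.2.trans_lt ht.2⟩) hw0 hX hQ0
      fun _ => M.w2neg t ⟨ht.1.le, ht.2⟩

theorem matched_le (P : TopPair n f β v₁ w₁ v₂ w₂ T₁ T₂) {ρ : ℝ → ℝ}
    (M : Matched v₁ w₁ v₂ w₂ ρ T₁ y) (m1 : ∀ t ∈ Icc T₁ y, ρ t ∈ Ioc T₂ q)
    (h2 : ∀ t ∈ Ioo T₂ q, w₂ t < 0) {t : ℝ} (ht : t ∈ Icc T₁ y) (ht2 : t ∈ Icc T₂ q)
    (hle : v₂ t ≤ v₁ t) : ρ t ≤ t := by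
  by_contra hc
  have := P.S₂.strictAntiOn P.nonneg₂ h2 ht2 ⟨(m1 t ht).1.le, (m1 t ht).2⟩ (not_le.1 hc)
  rw [M.val t ht] at this
  linarith

/-- After a crossing the functional `W` becomes strictly ordered. -/
theorem exists_W_gap (P : TopPair n f β v₁ w₁ v₂ w₂ T₁ T₂) (H : Nonlin n f b β)
    (hy : T₁ < y) (hq : T₂ < q) (h1 : ∀ t ∈ Ioo T₁ y, w₁ t < 0) (h2 : ∀ t ∈ Ioo T₂ q, w₂ t < 0)
    (hE : ∀ t ∈ Ico T₁ y, 0 < En f v₁ w₁ t) (hv : v₂ q = v₁ y) (h0 : 0 ≤ v₁ y) (hb : v₁ y < b)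
    {t : ℝ} (ht : t ∈ Ioo T₁ y) (ht2 : t ∈ Icc T₂ q) (hle : v₂ t ≤ v₁ t) :
    ∃ t' ∈ Ioo T₁ y, ∃ r' ∈ Ioc T₂ q, v₂ r' = v₁ t' ∧ v₁ t' ≤ β ∧
      Wv f t' (v₁ t') (w₁ t') < Wv f r' (v₁ t') (w₂ r') := by
  obtain ⟨ρ, M, m1, -, hbr⟩ := P.exists_matched H hy hq h1 h2 hE hv
  have hρt := P.matched_le M m1 h2 (Ioo_subset_Icc_self ht) ht2 hle
  have hbβ := H.b_lt
  have hb0 := H.b_pos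
  have hgt := P.gt
  have anti := P.S₁.strictAntiOn P.nonneg₁ h1
  obtain ⟨tm, htm, hvm⟩ := intermediate_value_Icc' hy.le
    (P.S₁.cont.mono fun s hs => P.nonneg₁.trans hs.1)
    (show β ∈ Icc (v₁ y) (v₁ T₁) from ⟨by linarith, hgt.le⟩)
  have htm1 : T₁ < tm := htm.1.lt_of_ne (by rintro rfl; linarith)
  have htm2 : tm < y := htm.2.lt_of_ne (by rintro rfl; linarith)
  rcases le_or_gt (ρ tm) tm with hc | hc
  · obtain ⟨tb, htb, hvb⟩ := intermediate_value_Icc' htm.2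
      (P.S₁.cont.mono fun s hs => P.nonneg₁.trans (htm.1.trans hs.1))
      (show b ∈ Icc (v₁ y) (v₁ tm) from ⟨hb.le, by linarith⟩)
    have htb1 : tm < tb := htb.1.lt_of_ne (by rintro rfl; linarith)
    have htb2 : tb < y := htb.2.lt_of_ne (by rintro rfl; linarith)
    have hmid : ∀ s ∈ Ioo tm tb, b < v₁ s ∧ v₁ s < β := fun s hs => by
      rw [← hvb, ← hvm]
      exact ⟨anti ⟨(htm1.trans hs.1).le, (hs.2.trans htb2).le⟩ ⟨(htm1.trans htb1).le, htb.2⟩ hs.2,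
        anti htm ⟨(htm1.trans hs.1).le, (hs.2.trans htb2).le⟩ hs.1⟩
    have hL := ((hbr tm ⟨htm1, htm2⟩).2 ⟨tm, ⟨htm1.le, le_rfl⟩, hc⟩).W
      (by rw [hvm, abs_of_pos (hb0.trans hbβ)])
    have hW := ((M.sub htm1.le htb.2).W_mono H P.S₁ P.S₂
      (fun s hs => abs_le.2 ⟨by linarith [(hmid s hs).1], (hmid s hs).2.le⟩)
      (fun s hs => hE s ⟨(htm1.trans hs.1).le, hs.2.trans htb2⟩)
      (fun s hs => (hbr s ⟨htm1.trans hs.1, hs.2.trans htb2⟩).1)).2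
      (fun s hs => H.F_lt (hmid s hs).1.le (hmid s hs).2)
      (left_mem_Icc.2 htb1.le) (right_mem_Icc.2 htb1.le) htb1
    have hI : tb ∈ Icc T₁ y := ⟨(htm1.trans htb1).le, htb.2⟩
    refine ⟨tb, ⟨htm1.trans htb1, htb2⟩, ρ tb, m1 tb hI, M.val tb hI, by linarith, ?_⟩
    simp only at hW
    linarith
  · have hsub := M.sub_id_strictAnti fun s hs => (hbr s hs).1
    have htmt : tm < t := by
      by_contra hcon
      have := hsub.antitoneOn (Ioo_subset_Icc_self ht) htm (not_lt.1 hcon)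
      linarith
    obtain ⟨tx, htx, hvx⟩ := intermediate_value_Icc' htmt.le
      ((M.cont.mono (Icc_subset_Icc htm.1 ht.2.le)).sub continuousOn_id)
      (show (0 : ℝ) ∈ Icc (ρ t - t) (ρ tm - tm) from ⟨by linarith, by linarith⟩)
    have hρx : ρ tx = tx := sub_eq_zero.1 hvx
    have hI : tx ∈ Ioo T₁ y := ⟨htm1.trans_le htx.1, htx.2.trans_lt ht.2⟩
    have hI' := Ioo_subset_Icc_self hI
    refine ⟨tx, hI, ρ tx, m1 tx hI', M.val tx hI', ?_, ?_⟩
    · rw [← hvm]; exact anti.antitoneOn htm hI' htx.1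
    · have hw := (hbr tx hI).1
      have hEx := hE tx ⟨hI.1.le, hI.2⟩
      have hw1 := h1 tx hI
      rw [hρx] at hw ⊢
      unfold En at hEx
      unfold Wv
      exact mul_lt_mul_of_pos_left (Real.sqrt_lt_sqrt (by linarith) (by nlinarith))
        (P.nonneg₁.trans_lt hI.1)

/-- The gap in `W` persists along the branch. -/
theorem W_gap_le (P : TopPair n f β v₁ w₁ v₂ w₂ T₁ T₂) (H : Nonlin n f b β)
    (hy : T₁ < y) (hq : T₂ < q) (h1 : ∀ t ∈ Ioo T₁ y, w₁ t < 0) (h2 : ∀ t ∈ Ioo T₂ q, w₂ t < 0)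
    (hE : ∀ t ∈ Ico T₁ y, 0 < En f v₁ w₁ t) (hv : v₂ q = v₁ y) (h0 : 0 ≤ v₁ y)
    {t' r' : ℝ} (ht : t' ∈ Ioo T₁ y) (hr : r' ∈ Ioc T₂ q) (he : v₂ r' = v₁ t')
    (hle : v₁ t' ≤ β) :
    Wv f y (v₁ y) (w₁ y) + (Wv f r' (v₁ t') (w₂ r') - Wv f t' (v₁ t') (w₁ t')) ≤
      Wv f q (v₁ y) (w₂ q) := by
  obtain ⟨ρ, M, m1, hinj, hbr⟩ := P.exists_matched H hy hq h1 h2 hE hv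
  have e1 := hinj t' (Ioo_subset_Icc_self ht) r' ⟨hr.1.le, hr.2⟩ he
  have e2 := hinj y (right_mem_Icc.2 hy.le) q (right_mem_Icc.2 hq.le) hv
  have anti := P.S₁.strictAntiOn P.nonneg₁ h1
  have hW := ((M.sub ht.1.le le_rfl).W_mono H P.S₁ P.S₂
    (fun s hs => by
      have hI : s ∈ Icc T₁ y := ⟨(ht.1.trans hs.1).le, hs.2.le⟩
      have q1 := anti.antitoneOn (Ioo_subset_Icc_self ht) hI hs.1.le
      have q2 := anti.antitoneOn hI (right_mem_Icc.2 hy.le) hs.2.le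
      have := H.β_pos
      exact abs_le.2 ⟨by linarith, by linarith⟩)
    (fun s hs => hE s ⟨(ht.1.trans hs.1).le, hs.2⟩)
    (fun s hs => (hbr s ⟨ht.1.trans hs.1, hs.2⟩).1)).1
    (left_mem_Icc.2 ht.2.le) (right_mem_Icc.2 ht.2.le) ht.2.le
  simp only [e1, e2] at hW
  linarith

theorem end_lt (P : TopPair n f β v₁ w₁ v₂ w₂ T₁ T₂) (H : Nonlin n f b β)
    (hy : T₁ < y) (hq : T₂ < q) (h1 : ∀ t ∈ Ioo T₁ y, w₁ t < 0) (h2 : ∀ t ∈ Ioo T₂ q, w₂ t < 0)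
    (hE : ∀ t ∈ Ico T₁ y, 0 < En f v₁ w₁ t) (hv : v₂ q = v₁ y)
    {t : ℝ} (ht : t ∈ Ioo T₁ y) (ht2 : t ∈ Icc T₂ q) (hle : v₂ t ≤ v₁ t) : q < y := by
  obtain ⟨ρ, M, m1, hinj, hbr⟩ := P.exists_matched H hy hq h1 h2 hE hv
  have e2 := hinj y (right_mem_Icc.2 hy.le) q (right_mem_Icc.2 hq.le) hv
  have hρt := P.matched_le M m1 h2 (Ioo_subset_Icc_self ht) ht2 hle
  have := M.sub_id_strictAnti (fun s hs => (hbr s hs).1) (Ioo_subset_Icc_self ht)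
    (right_mem_Icc.2 hy.le) ht.2
  simp only [e2] at this
  linarith

end TopPair

theorem W_le {n : ℕ} {f : ℝ → ℝ} {b β : ℝ} (H : Nonlin n f b β) {t s p : ℝ} (ht : 0 ≤ t)
    (hs : |s| ≤ β) (hp : p ≤ 0) :
    Wv f t s p ≤ -(t * p) := by
  have h1 : √(p ^ 2 + 2 * Fint f s) ≤ √(p ^ 2) :=
    Real.sqrt_le_sqrt (by linarith [H.F_nonpos hs])
  rw [Real.sqrt_sq_eq_abs, abs_of_nonpos hp] at h1
  have := mul_le_mul_of_nonneg_left h1 ht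
  unfold Wv
  linarith

end Paper

namespace Paper

variable {n : ℕ} {f : ℝ → ℝ} {b β : ℝ} {u : ℝ → ℝ → ℝ} {αs : ℝ}

theorem mem_ZsetK_of_props {i : ℕ} {α r : ℝ} (hr : Tk u i α < r)
    (h : ∀ s ∈ Ioo (Tk u i α) r, 0 < vb u i α s ∧ wb u i α s < 0) : r ∈ ZsetK u (i + 1) α := by
  rw [ZsetK_succ]
  exact mem_ZsetAux_iff.2 ⟨hr, h⟩

/-- A branch can be continued past a point where it is positive and decreasing. -/
theorem before_of_mem {i : ℕ} {α r : ℝ} (H : Nonlin n f b β) (hu : Family n f u) (hα : 0 < α)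
    (hT : 0 ≤ Tk u i α) (hr : r ∈ ZsetK u (i + 1) α) (h1 : 0 < vb u i α r)
    (h2 : wb u i α r < 0) : Before u i α r := by
  have S := isSol_vb H hu hα i
  have hTr : Tk u i α < r := (mem_ZsetAux_iff.1 hr).1
  have hr0 : 0 < r := hT.trans_lt hTr
  have e1 := (S.cont.continuousAt (Ici_mem_nhds hr0)).eventually (lt_mem_nhds h1)
  have e2 := (S.dcont.continuousAt (Ici_mem_nhds hr0)).eventually (gt_mem_nhds h2)
  obtain ⟨ε, hε, hb⟩ := Metric.eventually_nhds_iff_ball.1 (e1.and e2)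
  refine ⟨r + ε / 2, mem_ZsetK_of_props (by linarith) fun s hs => ?_, by linarith⟩
  rcases lt_or_ge s r with h | h
  · exact ZsetK_props hr ⟨hs.1, h⟩
  · exact hb s (by rw [Real.ball_eq_Ioo]; exact ⟨by linarith, by linarith [hs.2]⟩)

set_option maxHeartbeats 800000 in
/-- Comparison of two solutions on the last branch, when the first one lands at zero and the
two cross at `t`. -/
theorem Landing.compare {i : ℕ} {α₁ α₂ : ℝ} (L : Landing u i α₁) (H : Nonlin n f b β)
    (hu : Family n f u) (hα₂ : 0 < α₂) (g₂ : Good u i α₂)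
    (P : TopPair n f β (vb u i α₁) (wb u i α₁) (vb u i α₂) (wb u i α₂) (Tk u i α₁) (Tk u i α₂))
    {t q : ℝ} (ht₁ : Tk u i α₁ < t) (ht₂ : Tk u i α₂ < t) (hbt : Before u i α₁ t)
    (hcr : vb u i α₂ t ≤ vb u i α₁ t) (htq : t < q)
    (hq : ∀ r ∈ Ioc (Tk u i α₂) q, 0 < vb u i α₂ r ∧ wb u i α₂ r < 0) (hqb : vb u i α₂ q < b) :
    α₂ ∈ Nk u (i + 1) ∧ ZkE u (i + 1) α₂ < ZkE u (i + 1) α₁ ∧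
      |duAtZ u (i + 1) α₁| < |duAtZ u (i + 1) α₂| := by
  have S₁ := P.S₁
  have S₂ := P.S₂
  have n₁ := P.nonneg₁
  have n₂ := P.nonneg₂
  set T₁ := Tk u i α₁ with hT₁
  set T₂ := Tk u i α₂ with hT₂
  have hTq : T₂ < q := ht₂.trans htq
  have hq0 : 0 < q := n₂.trans_lt hTq
  have hβ0 := H.β_pos
  have hbβ := H.b_lt
  have hmem : q ∈ ZsetK u (i + 1) α₂ :=
    mem_ZsetK_of_props hTq fun s hs => hq s ⟨hs.1, hs.2.le⟩
  have hBq : Before u i α₂ q :=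
    before_of_mem H hu hα₂ n₂ hmem (hq q ⟨hTq, le_rfl⟩).1 (hq q ⟨hTq, le_rfl⟩).2
  have hne₂ : (ZsetK u (i + 1) α₂).Nonempty := ⟨q, hmem⟩
  have w1 : ∀ y, Before u i α₁ y → ∀ s ∈ Ioo T₁ y, wb u i α₁ s < 0 := fun y hy s hs =>
    ((hy.of_le hs.2.le).props hs.1).2
  have E1 : ∀ y, Before u i α₁ y → ∀ s ∈ Ico T₁ y, 0 < En f (vb u i α₁) (wb u i α₁) s :=
    fun y hy s hs => L.En_pos H hu i (n₁.trans hs.1) (hy.of_le hs.2.le)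
  -- every value of the second branch is taken by the first one
  have hlevel : ∀ x r, T₁ < x → Before u i α₁ x → 0 < vb u i α₂ r →
      vb u i α₂ r < vb u i α₁ x → ∃ y, x < y ∧ Before u i α₁ y ∧ vb u i α₂ r = vb u i α₁ y := by
    intro x r hx hbx h0 hlt
    obtain ⟨y₀, hb0, hxy, -, hv0⟩ := L.exists_small H hu h0 hbx
    obtain ⟨y, hy, hyv⟩ := intermediate_value_Icc' hxy.le
      (S₁.cont.mono fun s hs => n₁.trans (hx.le.trans hs.1))
      (show vb u i α₂ r ∈ Icc _ _ from ⟨hv0.le, hlt.le⟩)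
    exact ⟨y, hy.1.lt_of_ne (by rintro rfl; linarith), hb0.of_le hy.2, hyv.symm⟩
  have hqt : vb u i α₂ q < vb u i α₂ t := S₂.strictAntiOn (n₂.trans ht₂.le)
    (fun s hs => (hq s ⟨ht₂.trans hs.1, hs.2.le⟩).2) (left_mem_Icc.2 htq.le)
    (right_mem_Icc.2 htq.le) htq
  have hqp := (hq q ⟨hTq, le_rfl⟩).1
  obtain ⟨y₁, hty₁, hb₁, hv₁⟩ := hlevel t q ht₁ hbt hqp (hqt.trans_le hcr)
  obtain ⟨t', ht', r', hr', hval, hle, hgap⟩ := P.exists_W_gap H (ht₁.trans hty₁) hTq (w1 y₁ hb₁)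
    (fun s hs => (hq s ⟨hs.1, hs.2.le⟩).2) (E1 y₁ hb₁) hv₁ (by linarith) (by linarith)
    ⟨ht₁, hty₁⟩ ⟨ht₂.le, htq.le⟩ hcr
  have hb' : Before u i α₁ t' := hb₁.of_le ht'.2.le
  set c := Wv f r' (vb u i α₁ t') (wb u i α₂ r') - Wv f t' (vb u i α₁ t') (wb u i α₁ t') with hc
  have hc0 : 0 < c := sub_pos.2 hgap
  have hslope : ∀ r, q < r → Before u i α₂ r → c ≤ -(r * wb u i α₂ r) := by
    intro r hqr hbr
    have hTr : T₂ < r := hTq.trans hqr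
    have h2 : ∀ s ∈ Ioo T₂ r, wb u i α₂ s < 0 := fun s hs => ((hbr.of_le hs.2.le).props hs.1).2
    have hrp := hbr.props hTr
    have hrv : vb u i α₂ r < vb u i α₁ t' := by
      rw [← hval]
      exact S₂.strictAntiOn n₂ h2 ⟨hr'.1.le, hr'.2.trans hqr.le⟩ (right_mem_Icc.2 hTr.le)
        (hr'.2.trans_lt hqr)
    obtain ⟨y, hy, hby, hvy⟩ := hlevel t' r ht'.1 hb' hrp.1 hrv
    have := P.W_gap_le H (ht'.1.trans hy) hTr (w1 y hby) h2 (E1 y hby) hvy (by linarith [hrp.1])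
      ⟨ht'.1, hy⟩ ⟨hr'.1, hr'.2.trans hqr.le⟩ hval hle
    have hW1 : 0 ≤ Wv f y (vb u i α₁ y) (wb u i α₁ y) :=
      mul_nonneg (n₁.trans (ht'.1.trans hy).le) (Real.sqrt_nonneg _)
    have hW2 := W_le H (n₂.trans hTr.le) (s := vb u i α₁ y) (p := wb u i α₂ r)
      (abs_le.2 ⟨by linarith [hrp.1], by linarith⟩) hrp.2.le
    linarith
  -- the second branch reaches zero at a finite radius
  have hbdd : BddAbove (ZsetK u (i + 1) α₂) := by
    by_contra hb
    set r := q * Real.exp (vb u i α₂ q / c + 1) with hr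
    have hexp : 1 < Real.exp (vb u i α₂ q / c + 1) := by
      rw [Real.one_lt_exp_iff]; positivity
    have hqr : q < r := by
      have := mul_lt_mul_of_pos_left hexp hq0
      linarith
    have hmono := antitoneOn_of_hasDerivAt_nonpos (x := q) (y := r)
      (g := fun s => vb u i α₂ s + c * Real.log s)
      ((S₂.cont.mono fun s hs => hq0.le.trans hs.1).add (continuousOn_const.mul
        (continuousOn_id.log fun s hs => (hq0.trans_le hs.1).ne')))
      (fun s hs => (S₂.d1 s (hq0.trans hs.1)).add
        ((Real.hasDerivAt_log (hq0.trans hs.1).ne').const_mul c))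
      (fun s hs => by
        have hs0 := hq0.trans hs.1
        have := hslope s hs.1 (before_of_unbounded hb s)
        have h3 : c * s⁻¹ ≤ -(s * wb u i α₂ s) * s⁻¹ :=
          mul_le_mul_of_nonneg_right this (inv_nonneg.2 hs0.le)
        have h4 : -(s * wb u i α₂ s) * s⁻¹ = -wb u i α₂ s := by field_simp
        linarith)
      (left_mem_Icc.2 hqr.le) (right_mem_Icc.2 hqr.le) hqr.le
    simp only [hr, Real.log_mul hq0.ne' (Real.exp_pos _).ne', Real.log_exp] at hmono
    rw [← hr] at hmono
    have := ((before_of_unbounded hb r).props (hTq.trans hqr)).1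
    have e : c * (vb u i α₂ q / c + 1) = vb u i α₂ q + c := by field_simp
    linarith
  set Y := Zk u (i + 1) α₂ with hY
  have hqY : q < Y := hBq.lt_Z hbdd
  have hTY : T₂ < Y := hTq.trans hqY
  have hY0 : 0 < Y := hq0.trans hqY
  have hbY : ∀ r, r < Y → Before u i α₂ r := fun r hr => before_of_lt_Z hne₂ hr
  have hsY : c ≤ -(Y * wb u i α₂ Y) := by
    have := nonneg_right_of_Ioo (g := fun r => -(r * wb u i α₂ r) - c) hqY
      ((((continuousOn_id.mul S₂.dcont).neg.sub continuousOn_const).mono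
        fun s hs => hq0.le.trans hs.1) Y (right_mem_Icc.2 hqY.le))
      (fun s hs => sub_nonneg.2 (hslope s hs.1 (hbY s hs.2)))
    linarith
  have hwY : wb u i α₂ Y < 0 := by
    by_contra hcon
    have := mul_nonneg hY0.le (not_lt.1 hcon)
    linarith
  have hvY : vb u i α₂ Y = 0 := by
    have h0 : 0 ≤ vb u i α₂ Y := nonneg_right_of_Ioo hqY
      ((S₂.cont.mono fun s hs => hq0.le.trans hs.1) Y (right_mem_Icc.2 hqY.le))
      (fun s hs => ((hbY s hs.2).props (hTq.trans hs.1)).1.le)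
    refine h0.eq_of_not_lt' fun hpos => ?_
    exact lt_irrefl Y ((before_of_mem H hu hα₂ n₂
      (mem_ZsetK_of_props hTY fun s hs => (hbY s hs.2).props hs.1) hpos hwY).lt_Z hbdd)
  have hdu₂ : duAtZ u (i + 1) α₂ = deriv (u α₂) Y := by unfold duAtZ; rw [if_pos hbdd]
  have habs : ∀ (α r : ℝ), |deriv (u α) r| = |wb u i α r| := fun α r => by
    unfold wb; rw [abs_mul, abs_pow, abs_neg, abs_one, one_pow, one_mul]
  obtain ⟨hN, hF⟩ := g₂.mem H hu hα₂
  refine ⟨Nk_succ_iff.2 ⟨hN, hF, ?_, ?_⟩, ?_⟩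
  · unfold uAtZ; rw [if_pos hbdd]; exact vb_eq_zero.1 hvY
  · rw [hdu₂]; exact hwY
  rw [hdu₂, habs]
  have hZE₂ : ZkE u (i + 1) α₂ = (Y : WithTop ℝ) := by unfold ZkE; rw [if_pos hbdd]
  by_cases hbd₁ : BddAbove (ZsetK u (i + 1) α₁)
  · set Z := Zk u (i + 1) α₁ with hZ
    have htZ : t < Z := hbt.lt_Z hbd₁
    have hTZ : T₁ < Z := ht₁.trans htZ
    have hbZ : ∀ r, r < Z → Before u i α₁ r := fun r hr => before_of_lt_Z (L.nonempty hu) hr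
    have hvZ := L.v_Z hbd₁
    have w1' : ∀ s ∈ Ioo T₁ Z, wb u i α₁ s < 0 := fun s hs => ((hbZ s hs.2).props hs.1).2
    have w2' : ∀ s ∈ Ioo T₂ Y, wb u i α₂ s < 0 := fun s hs => ((hbY s hs.2).props hs.1).2
    have E' : ∀ s ∈ Ico T₁ Z, 0 < En f (vb u i α₁) (wb u i α₁) s := fun s hs =>
      L.En_pos H hu i (n₁.trans hs.1) (hbZ s hs.2)
    have hYZ : Y < Z := P.end_lt H hTZ hTY w1' w2' E' (hvY.trans hvZ.symm) ⟨ht₁, htZ⟩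
      ⟨ht₂.le, (htq.trans hqY).le⟩ hcr
    have hWW := P.W_gap_le H hTZ hTY w1' w2' E' (hvY.trans hvZ.symm) hvZ.ge
      ⟨ht'.1, hb'.lt_Z hbd₁⟩ ⟨hr'.1, hr'.2.trans hqY.le⟩ hval hle
    have hwZ : wb u i α₁ Z ≤ 0 := by
      have := nonneg_right_of_Ioo (g := fun r => -wb u i α₁ r) hTZ
        ((S₁.dcont.neg.mono fun s hs => n₁.trans hs.1) Z (right_mem_Icc.2 hTZ.le))
        (fun s hs => neg_nonneg.2 (w1' s hs).le)
      linarith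
    have hF0 : Fint f (vb u i α₁ Z) = 0 := by rw [hvZ, H.F_zero]
    rw [W_of_F_eq_zero hF0 hwZ, W_of_F_eq_zero hF0 hwY.le] at hWW
    have hdu₁ : duAtZ u (i + 1) α₁ = deriv (u α₁) Z := by unfold duAtZ; rw [if_pos hbd₁]
    have hZE₁ : ZkE u (i + 1) α₁ = (Z : WithTop ℝ) := by unfold ZkE; rw [if_pos hbd₁]
    rw [hZE₁, hZE₂, hdu₁, habs, abs_of_nonpos hwZ, abs_of_neg hwY]
    refine ⟨WithTop.coe_lt_coe.2 hYZ, ?_⟩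
    by_contra hcon
    have h5 := mul_le_mul hYZ.le (not_lt.1 hcon) (neg_pos.2 hwY).le (hY0.trans hYZ).le
    linarith
  · have hZE₁ : ZkE u (i + 1) α₁ = ⊤ := by unfold ZkE; rw [if_neg hbd₁]
    have hdu₁ : duAtZ u (i + 1) α₁ = 0 := by
      by_contra hcon
      exact hbd₁ (bddAbove_of_duAtZ L.good H hu L.pos hcon)
    rw [hZE₁, hZE₂, hdu₁, abs_zero]
    exact ⟨WithTop.coe_lt_top _, abs_pos.2 hwY.ne⟩

/-- A branch that starts decreasing belongs to one of `F_k`, `G_k`, `N_k`. -/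
theorem Good.classify {i : ℕ} {α : ℝ} (g : Good u i α) (H : Nonlin n f b β) (hu : Family n f u)
    (hα : 0 < α) {r : ℝ} (hr : r ∈ ZsetK u (i + 1) α) :
    α ∈ Fk u (i + 1) ∨ α ∈ Gk u (i + 1) ∪ Nk u (i + 1) := by
  have S := isSol_vb H hu hα i
  have n₀ := g.T_nonneg
  have hTr : Tk u i α < r := (mem_ZsetAux_iff.1 hr).1
  obtain ⟨hN, hF⟩ := g.mem H hu hα
  have hF' : ¬Ftil u (i + 1) α := by
    rcases Nat.eq_zero_or_pos i with rfl | hi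
    · intro hf
      have h1 := (ZsetK_props hr (s := (Tk u 0 α + r) / 2) ⟨by linarith, by linarith⟩).2
      have h2 := hf ((Tk u 0 α + r) / 2) (by
        have : Zk u 0 α = 0 := rfl
        simp only [zero_add, Nat.sub_self, this]
        linarith)
      unfold wb at h1
      simp only [pow_zero, one_mul, zero_add, pow_one] at h1 h2
      linarith
    · exact hF hi.ne'
  have hle : 0 ≤ (-1) ^ i * uAtZ u (i + 1) α ∧ (-1) ^ i * duAtZ u (i + 1) α ≤ 0 := by
    unfold uAtZ duAtZ
    by_cases hb : BddAbove (ZsetK u (i + 1) α)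
    · rw [if_pos hb, if_pos hb]
      have hTZ := ZsetK_lt_Z ⟨r, hr⟩ hb
      have hp := fun s (hs : s ∈ Ioo (Tk u i α) (Zk u (i + 1) α)) =>
        ZsetK_props_of_lt_Z ⟨r, hr⟩ hs.1 hs.2
      constructor
      · exact nonneg_right_of_Ioo (g := vb u i α) hTZ ((S.cont.mono fun s hs => n₀.trans hs.1) _
          (right_mem_Icc.2 hTZ.le)) fun s hs => (hp s hs).1.le
      · exact neg_nonneg.1 (nonneg_right_of_Ioo (g := fun r => -wb u i α r) hTZ
          ((S.dcont.neg.mono fun s hs => n₀.trans hs.1) _ (right_mem_Icc.2 hTZ.le))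
          fun s hs => neg_nonneg.2 (hp s hs).2.le)
    · rw [if_neg hb, if_neg hb]
      obtain ⟨⟨L, hL, hv⟩, hw⟩ := limUnder_wb_zero g H hu hα hb
      rw [(tendsto_of_vb hv).limUnder_eq, (tendsto_of_wb hw).limUnder_eq, ← mul_assoc, ← mul_pow]
      simpa using hL
  have hne : ((-1 : ℝ)) ^ i ≠ 0 := pow_ne_zero _ (by norm_num)
  rcases hle.1.eq_or_lt with h | h
  · right
    have hu0 : uAtZ u (i + 1) α = 0 := (mul_eq_zero.1 h.symm).resolve_left hne
    rcases hle.2.eq_or_lt with h' | h'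
    · exact Or.inl (Gk_succ_iff.2 ⟨hN, hF, hu0, (mul_eq_zero.1 h').resolve_left hne⟩)
    · exact Or.inr (Nk_succ_iff.2 ⟨hN, hF, hu0, h'⟩)
  · left
    refine ⟨hN, hF', ?_⟩
    rw [pow_succ]
    linarith

set_option maxHeartbeats 800000 in
theorem eventually_compare (H : Nonlin n f b β) (hu : Family n f u) {i : ℕ}
    (hαs : αs ∈ Gk u (i + 1)) : ∀ᶠ p : ℝ × ℝ in 𝓝 (αs, αs), p.1 < p.2 →
      (p.1 ∈ Gk u (i + 1) ∪ Nk u (i + 1) →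
        p.2 ∈ Nk u (i + 1) ∧ ZkE u (i + 1) p.2 < ZkE u (i + 1) p.1 ∧
          |duAtZ u (i + 1) p.1| < |duAtZ u (i + 1) p.2|) ∧
      (p.2 ∈ Gk u (i + 1) → p.1 ∈ Fk u (i + 1)) := by
  have L := landing_of_mem H hu (Or.inl hαs)
  have hα := L.pos
  have hd := (Gk_succ_iff.1 hαs).2.2.2
  have hv := L.tops H hu i le_rfl
  obtain ⟨hg, htend⟩ := good_perturb H hu hα L.good (L.tops H hu)
  have hT := topInv_of_good H hu hα L.good (L.tops H hu)
  obtain ⟨R, hTR, hBR, hbR, hcr⟩ := hT.last_crossing H hu L hd hg htend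
  obtain ⟨R', hBR', hRR'⟩ := hBR.exists_gt
  have hR0 : 0 ≤ R := L.good.T_nonneg.trans hTR.le
  have hbR' : vb u i αs R' < b := ((isSol_vb H hu hα i).strictAntiOn hR0
    (fun s hs => ((hBR'.of_le hs.2.le).props (hTR.trans hs.1)).2) (left_mem_Icc.2 hRR'.le)
    (right_mem_Icc.2 hRR'.le) hRR').trans hbR
  have eb := eventually_at (continuousOn_vb hu i) hα (hR0.trans hRR'.le) (O := Iio b)
    (Iio_mem_nhds hbR')
  have htop := hT.top_lt H hu hα hg htend hv
  obtain ⟨c, -, hT⟩ := hT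
  filter_upwards [hcr, htop, hT, eventually_both eb, eventually_both hg,
    eventually_both (eventually_branch H hu L hg htend hBR'),
    eventually_both (htend (Iio_mem_nhds (hTR.trans hRR'))),
    eventually_both (eventually_top_gt hu hα hg htend hv),
    eventually_both (Ioi_mem_nhds hα)] with p hcr htop hT eb hg hbr hTl hgt hp hlt
  have hm₁ : R' ∈ ZsetK u (i + 1) p.1 :=
    mem_ZsetK_of_props hTl.1 fun s hs => hbr.1 s ⟨hs.1, hs.2.le⟩
  have main : p.1 ∈ Gk u (i + 1) ∪ Nk u (i + 1) → p.2 ∈ Nk u (i + 1) ∧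
      ZkE u (i + 1) p.2 < ZkE u (i + 1) p.1 ∧
        |duAtZ u (i + 1) p.1| < |duAtZ u (i + 1) p.2| := by
    intro h
    obtain ⟨t, htR, ht₁, ht₂, hle⟩ := hcr hlt
    exact (landing_of_mem H hu h).compare H hu hp.2 hg.2
      { S₁ := isSol_vb H hu hp.1 i
        S₂ := isSol_vb H hu hp.2 i
        nonneg₁ := hg.1.T_nonneg
        nonneg₂ := hg.2.T_nonneg
        top := htop hlt
        gt := hgt.1
        crit := wb_eq_zero.2 (hg.1.crit hu hp.1)
        Q := (hT hlt).2 }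
      ht₁ ht₂ ⟨R', hm₁, htR.trans_lt hRR'⟩ hle (htR.trans_lt hRR') hbr.2 eb.2
  refine ⟨main, fun hG => ?_⟩
  refine (hg.1.classify H hu hp.1 hm₁).resolve_right fun h => ?_
  have h1 := (Nk_succ_iff.1 (main h).1).2.2.2
  rw [(Gk_succ_iff.1 hG).2.2.2, mul_zero] at h1
  exact lt_irrefl _ h1

end Paper

end

open Paper Set Filter MeasureTheory

/-- **Proposition 4.6.** Under (f1), (f2), (f4'), for `k` odd and `α* ∈ G_k`: nearby
initial values `α₁ < α₂` satisfy: if `α₁ ∈ G_k ∪ N_k` then `α₂ ∈ N_k`,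
`Z_k(α₁) > Z_k(α₂)` and `|u₁'(Z_k(α₁))| < |u₂'(Z_k(α₂))|`; if `α₂ ∈ G_k` then
`α₁ ∈ F_k`. -/
theorem Gk_Nk_Fk_trichotomy
    (n : ℕ) (hn : 2 ≤ n)
    (f : ℝ → ℝ) (b β : ℝ) (hf : Continuous f)
    (h1 : Hf1 f b β) (h2 : Hf2 f) (h4 : Hf4' n f β)
    (u : ℝ → ℝ → ℝ) (hu : Family n f u)
    (k : ℕ) (hkodd : Odd k) (αs : ℝ) (hαs : αs ∈ Gk u k) :
    ∃ δ : ℝ, 0 < δ ∧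
      ∀ α₁ ∈ Ioo (αs - δ) (αs + δ), ∀ α₂ ∈ Ioo (αs - δ) (αs + δ), α₁ < α₂ →
        (α₁ ∈ Gk u k ∪ Nk u k →
          α₂ ∈ Nk u k ∧ ZkE u k α₂ < ZkE u k α₁ ∧
            |duAtZ u k α₁| < |duAtZ u k α₂|) ∧
        (α₂ ∈ Gk u k → α₁ ∈ Fk u k) := by
  obtain ⟨i, rfl⟩ : ∃ i, k = i + 1 := ⟨k - 1, by have := hkodd.pos; omega⟩
  obtain ⟨δ, hδ, h⟩ := Metric.eventually_nhds_iff_ball.1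
    (eventually_compare ⟨hn, hf, h1, h2, h4⟩ hu hαs)
  refine ⟨δ, hδ, fun α₁ h₁ α₂ h₂ hlt => h (α₁, α₂) ?_ hlt⟩
  rw [← ball_prod_same]
  exact ⟨by rwa [Real.ball_eq_Ioo], by rwa [Real.ball_eq_Ioo]⟩
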